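/- Let s, m_1, m_2 be integers with s ≥ 0 and 2 ≤ m_1 ≤ m_2, set m = m_1 + m_2 and n = s + m. If m is odd and n ≡ m (mod 2m), then HOP(2^⟨s⟩, 2m_1, 2m_2) has a solution. -/

import Mathlib

/-- The vertex set of the complete graph `K_{2n}`: the `n` couples are indexed by `Fin n`,
and the two members of a couple by `Fin 2`. -/
abbrev HOPVertex (n : ℕ) : Type := Fin n × Fin 2

/-- The spouse of a participant: the other member of the same couple. -/
def HOPspouse {n : ℕ} (v : HOPVertex n) : HOPVertex n := (v.1, v.2 + 1)

/-- An edge of `K_{2n}` is an `I`-edge (an edge of the distinguished perfect matching `I`)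
if it joins a participant to their spouse. -/
def IsIEdge {n : ℕ} (e : Sym2 (HOPVertex n)) : Prop :=
  ∃ v, e = s(v, HOPspouse v)

/-- An `I`-alternating `(K_2^⟨s⟩, C_{2m_1}, …, C_{2m_t})`-factor of `K_{2n}`:
a spanning subgraph of `K_{2n}` which is a vertex-disjoint union of `s` edges of `I`
(one for each `a : Fin s`, namely the edge joining `pair a` to its spouse) together with
`t` cycles, the `i`-th of which has length `2 * m i` (given by the cyclic vertex sequence
`cyc i : ZMod (2 * m i) → HOPVertex n`), such that along each cycle the edges alternate
between `I`-edges (at even positions) and non-`I`-edges (at odd positions).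
The field `spanning` says that the listed vertices are pairwise distinct and exhaust the
whole vertex set; in particular each `cyc i` is injective, so it really traces a cycle. -/
structure HOPFactor (n s t : ℕ) (m : Fin t → ℕ) : Type where
  pair : Fin s → HOPVertex n
  cyc : (i : Fin t) → ZMod (2 * m i) → HOPVertex n
  alt_even : ∀ (i : Fin t) (j : ZMod (2 * m i)),
      j.val % 2 = 0 → cyc i (j + 1) = HOPspouse (cyc i j)
  alt_odd : ∀ (i : Fin t) (j : ZMod (2 * m i)),
      j.val % 2 = 1 → ¬ IsIEdge s(cyc i j, cyc i (j + 1))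
  spanning : Function.Bijective
      (Sum.elim
        (fun a : Fin s × Fin 2 => if a.2 = 0 then pair a.1 else HOPspouse (pair a.1))
        (fun x : (i : Fin t) × ZMod (2 * m i) => cyc x.1 x.2))

/-- The edge set of an `I`-alternating `(K_2^⟨s⟩, C_{2m_1}, …, C_{2m_t})`-factor. -/
def HOPFactor.edges {n s t : ℕ} {m : Fin t → ℕ} (F : HOPFactor n s t m) :
    Set (Sym2 (HOPVertex n)) :=
  {e | (∃ a : Fin s, e = s(F.pair a, HOPspouse (F.pair a))) ∨
    ∃ (i : Fin t) (j : ZMod (2 * m i)), e = s(F.cyc i j, F.cyc i (j + 1))}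

/-- A solution to the generalized Honeymoon Oberwolfach Problem
`HOP(2^⟨s⟩, 2 m_1, …, 2 m_t)`: a family of `γ` `I`-alternating
`(K_2^⟨s⟩, C_{2m_1}, …, C_{2m_t})`-factors of `K_{2n}`, where `γ` is the natural number
with `γ * (m_1 + ⋯ + m_t) = 2n(n-1)`, such that every edge of `K_{2n}` that is not an
`I`-edge lies in exactly one factor of the family. -/
def HOPSolution (n s t : ℕ) (m : Fin t → ℕ) : Prop :=
  ∃ γ : ℕ, γ * (∑ i, m i) = 2 * n * (n - 1) ∧
    ∃ F : Fin γ → HOPFactor n s t m,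
      ∀ e : Sym2 (HOPVertex n), ¬ e.IsDiag → ¬ IsIEdge e →
        ∃! k : Fin γ, e ∈ (F k).edges


set_option linter.all false

namespace HOPaux

/-- successor map on two disjoint cycles of lengths `a` and `b` -/
def nxt (a b i : ℕ) : ℕ := if i + 1 = a then 0 else if i + 1 = a + b then a else i + 1

structure Cfg (V : Type) (a b : ℕ) where
  u : ℕ → V
  t : ℕ → Fin 2
  inj : ∀ i < a + b, ∀ j < a + b, u i = u j → i = j

def Cfg.E {V : Type} {a b : ℕ} (C : Cfg V a b) (x : V) (p : Fin 2) (y : V) (q : Fin 2) : Prop :=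
  ∃ i < a + b, C.u i = x ∧ C.t i + 1 = p ∧ C.u (nxt a b i) = y ∧ C.t (nxt a b i) = q

def Cov (V K : Type) (a b : ℕ) : Prop :=
  ∃ c : K → Cfg V a b, ∀ x y, x ≠ y → ∀ p q, ∃ k, (c k).E x p y q ∨ (c k).E y q x p

theorem nxt_lt {a b i : ℕ} (ha : 2 ≤ a) (hb : 2 ≤ b) (hi : i < a + b) : nxt a b i < a + b := by
  unfold nxt; split_ifs <;> omega

theorem nxt_ne {a b i : ℕ} (ha : 2 ≤ a) (hb : 2 ≤ b) (hi : i < a + b) : nxt a b i ≠ i := by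
  unfold nxt; split_ifs <;> omega

theorem Cov.transport {V W K L : Type} {a b : ℕ} (h : Cov V K a b) (f : V ≃ W) (g : K ≃ L) :
    Cov W L a b := by
  obtain ⟨c, hc⟩ := h
  refine ⟨fun l => ⟨fun i => f ((c (g.symm l)).u i), (c (g.symm l)).t, fun i hi j hj h =>
    (c (g.symm l)).inj i hi j hj (f.injective h)⟩, fun x y hxy p q => ?_⟩
  obtain ⟨k, hk⟩ := hc (f.symm x) (f.symm y) (fun h => hxy (f.symm.injective h)) p q
  refine ⟨g k, ?_⟩
  rcases hk with ⟨i, hi, h1, h2, h3, h4⟩ | ⟨i, hi, h1, h2, h3, h4⟩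
  · left; exact ⟨i, hi, by simp [h1], by simpa using h2, by simp [h3], by simpa using h4⟩
  · right; exact ⟨i, hi, by simp [h1], by simpa using h2, by simp [h3], by simpa using h4⟩

theorem Cov.swap {V K : Type} {a b : ℕ} (h : Cov V K a b) (ha : 2 ≤ a) (hb : 2 ≤ b) :
    Cov V K b a := by
  obtain ⟨c, hc⟩ := h
  have key : ∀ i < b + a, ∃ j < a + b, j = (if i < b then i + a else i - b) := fun i hi =>
    ⟨_, by split_ifs <;> omega, rfl⟩
  refine ⟨fun k => ⟨fun i => (c k).u (if i < b then i + a else i - b),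
    fun i => (c k).t (if i < b then i + a else i - b), fun i hi j hj h => ?_⟩,
    fun x y hxy p q => ?_⟩
  · have := (c k).inj _ (by split_ifs <;> omega) _ (by split_ifs <;> omega) h
    split_ifs at this <;> omega
  · obtain ⟨k, hk⟩ := hc x y hxy p q
    refine ⟨k, ?_⟩
    have main : ∀ x p y q, (c k).E x p y q → ∃ i < b + a,
        (c k).u (if i < b then i + a else i - b) = x ∧
        (c k).t (if i < b then i + a else i - b) + 1 = p ∧
        (c k).u (if nxt b a i < b then nxt b a i + a else nxt b a i - b) = y ∧
        (c k).t (if nxt b a i < b then nxt b a i + a else nxt b a i - b) = q := by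
      rintro x p y q ⟨i, hi, h1, h2, h3, h4⟩
      refine ⟨if i < a then i + b else i - a, by split_ifs <;> omega, ?_⟩
      have e1 : (if (if i < a then i + b else i - a) < b then (if i < a then i + b else i - a) + a
        else (if i < a then i + b else i - a) - b) = i := by split_ifs <;> omega
      have e2 : (if nxt b a (if i < a then i + b else i - a) < b then
          nxt b a (if i < a then i + b else i - a) + a
          else nxt b a (if i < a then i + b else i - a) - b) = nxt a b i := by
        unfold nxt; split_ifs <;> omega
      rw [e1, e2]; exact ⟨h1, h2, h3, h4⟩
    exact hk.imp (main _ _ _ _) (main _ _ _ _)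

section core
variable {n s a b : ℕ}

def off (a : ℕ) (i : Fin 2) : ℕ := if i = 0 then 0 else a

def vtx (C : Cfg (Fin n) a b) (pos r : ℕ) : HOPVertex n :=
  (C.u pos, C.t pos + (if r % 2 = 0 then 0 else 1))

theorem exists_pair (C : Cfg (Fin n) a b) (hn : n = s + (a + b)) :
    ∃ p : Fin s → Fin n, Function.Injective p ∧ ∀ k, ∀ i < a + b, p k ≠ C.u i := by
  classical
  let S : Finset (Fin n) := (Finset.range (a + b)).image C.u
  have hS : S.card = a + b := by
    rw [Finset.card_image_of_injOn]; simp
    intro i hi j hj h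
    simp at hi hj
    exact C.inj i hi j hj h
  have hc : Sᶜ.card = s := by rw [Finset.card_compl, hS]; simp; omega
  let e := (Sᶜ.equivFinOfCardEq hc).symm
  refine ⟨fun k => (e k).1, fun x y h => e.injective (Subtype.ext h), fun k i hi h => ?_⟩
  have := (e k).2
  rw [Finset.mem_compl] at this
  apply this
  have h' : (e k).1 = C.u i := h
  rw [h']
  exact Finset.mem_image_of_mem _ (by simpa using hi)

theorem val_succ {N : ℕ} (hN : 2 ≤ N) (j : ZMod N) :
    (j + 1).val = if j.val + 1 = N then 0 else j.val + 1 := by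
  have : NeZero N := ⟨by omega⟩
  have : Fact (1 < N) := ⟨by omega⟩
  rw [ZMod.val_add, ZMod.val_one]
  have := j.val_lt
  split_ifs with h
  · rw [h]; simp
  · exact Nat.mod_eq_of_lt (by omega)

theorem len_ge (ha : 2 ≤ a) (hb : 2 ≤ b) (i : Fin 2) : 2 ≤ (![a, b] : Fin 2 → ℕ) i := by
  fin_cases i <;> simp [ha, hb]

theorem pos_lt (ha : 2 ≤ a) (hb : 2 ≤ b) (i : Fin 2) (j : ZMod (2 * (![a, b] : Fin 2 → ℕ) i)) :
    off a i + j.val / 2 < a + b := by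
  have : NeZero (2 * (![a, b] : Fin 2 → ℕ) i) := ⟨by have := len_ge ha hb i; omega⟩
  have := j.val_lt
  fin_cases i <;> simp [off] at this ⊢ <;> omega

theorem pos_next_aux (ha : 2 ≤ a) (hb : 2 ≤ b) (o L : ℕ) (ho : (o = 0 ∧ L = a) ∨ (o = a ∧ L = b))
    (v : ℕ) (hv : v < 2 * L) (hj : v % 2 = 1) :
    o + (if v + 1 = 2 * L then 0 else v + 1) / 2 = nxt a b (o + v / 2) ∧
      (if v + 1 = 2 * L then 0 else v + 1) % 2 = 0 := by
  unfold nxt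
  by_cases h : v + 1 = 2 * L
  · rw [if_pos h]; split_ifs <;> omega
  · rw [if_neg h]; split_ifs <;> omega

theorem pos_next (ha : 2 ≤ a) (hb : 2 ≤ b) (i : Fin 2) (j : ZMod (2 * (![a, b] : Fin 2 → ℕ) i))
    (hj : j.val % 2 = 1) :
    off a i + (j + 1).val / 2 = nxt a b (off a i + j.val / 2) ∧ (j + 1).val % 2 = 0 := by
  have : NeZero (2 * (![a, b] : Fin 2 → ℕ) i) := ⟨by have := len_ge ha hb i; omega⟩
  have h1 := j.val_lt
  have h2 := val_succ (by have := len_ge ha hb i; omega) j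
  rw [h2]
  refine pos_next_aux ha hb _ _ ?_ _ h1 hj
  fin_cases i
  · left; exact ⟨rfl, rfl⟩
  · right; exact ⟨rfl, rfl⟩

theorem pos_even (ha : 2 ≤ a) (hb : 2 ≤ b) (i : Fin 2) (j : ZMod (2 * (![a, b] : Fin 2 → ℕ) i))
    (hj : j.val % 2 = 0) :
    (j + 1).val / 2 = j.val / 2 ∧ (j + 1).val % 2 = 1 := by
  have : NeZero (2 * (![a, b] : Fin 2 → ℕ) i) := ⟨by have := len_ge ha hb i; omega⟩
  have h1 := j.val_lt
  have h2 := val_succ (by have := len_ge ha hb i; omega) j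
  rw [h2]
  split_ifs <;> omega

theorem fin2_add (x y : Fin 2) : x + y + 1 = x + (y + 1) := by
  revert x y; decide

/-- the factor of a configuration -/
theorem exists_factor (C : Cfg (Fin n) a b) (ha : 2 ≤ a) (hb : 2 ≤ b) (hn : n = s + (a + b)) :
    ∃ F : HOPFactor n s 2 ![a, b], ∀ i j, F.cyc i j = vtx C (off a i + j.val / 2) j.val := by
  obtain ⟨p, hp1, hp2⟩ := exists_pair (s := s) C hn
  refine ⟨⟨fun k => (p k, 0), fun i j => vtx C (off a i + j.val / 2) j.val, ?_, ?_, ?_⟩,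
    fun i j => rfl⟩
  · intro i j hj
    obtain ⟨h1, h2⟩ := pos_even ha hb i j hj
    simp [vtx, HOPspouse, h1, h2, hj]
  · rintro i j hj ⟨v, hv⟩
    obtain ⟨h1, h2⟩ := pos_next ha hb i j hj
    have h3 := pos_lt ha hb i j
    have key : C.u (off a i + j.val / 2) = C.u (nxt a b (off a i + j.val / 2)) := by
      simp only [vtx, h1, HOPspouse] at hv
      rcases Sym2.eq_iff.1 hv with ⟨q1, q2⟩ | ⟨q1, q2⟩
      · exact (congrArg Prod.fst q1).trans (congrArg Prod.fst q2).symm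
      · exact (congrArg Prod.fst q1).trans (congrArg Prod.fst q2).symm
    exact nxt_ne ha hb h3 (C.inj _ h3 _ (nxt_lt ha hb h3) key).symm
  · have : ∀ i : Fin 2, NeZero (2 * (![a, b] : Fin 2 → ℕ) i) := fun i =>
      ⟨by have := len_ge ha hb i; omega⟩
    rw [Fintype.bijective_iff_injective_and_card]
    constructor
    · rintro (⟨k, e⟩ | ⟨i, j⟩) (⟨k', e'⟩ | ⟨i', j'⟩) h
      · have hk : p k = p k' := by
          simp only [Sum.elim_inl] at h
          split_ifs at h <;> simp [HOPspouse] at h <;> exact h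
        have := hp1 hk
        subst this
        have : e = e' := by
          simp only [Sum.elim_inl] at h
          split_ifs at h <;> simp_all [HOPspouse] <;> omega
        rw [this]
      · exfalso
        simp only [Sum.elim_inl, Sum.elim_inr] at h
        refine hp2 k _ (pos_lt ha hb i' j') ?_
        have := congrArg Prod.fst h
        split_ifs at this <;> simpa [HOPspouse, vtx] using this
      · exfalso
        simp only [Sum.elim_inl, Sum.elim_inr] at h
        refine hp2 k' _ (pos_lt ha hb i j) ?_
        have := congrArg Prod.fst h.symm
        split_ifs at this <;> simpa [HOPspouse, vtx] using this
      · simp only [Sum.elim_inr] at h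
        have h1 := C.inj _ (pos_lt ha hb i j) _ (pos_lt ha hb i' j') (congrArg Prod.fst h)
        have h2 := congrArg Prod.snd h
        simp only [vtx, h1, add_right_inj] at h2
        have h3 : j.val % 2 = j'.val % 2 := by
          split_ifs at h2 <;> simp at h2 <;> omega
        have b1 := j.val_lt
        have b2 := j'.val_lt
        have hi : i = i' := by
          fin_cases i <;> fin_cases i' <;> simp [off] at h1 b1 b2 ⊢ <;> omega
        subst hi
        have : j = j' := ZMod.val_injective _ (by omega)
        rw [this]
    · simp [ZMod.card]; omega

theorem card_nonI (n : ℕ) : ∃ X : Finset (Sym2 (HOPVertex n)),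
    (∀ e, e ∈ X ↔ ¬ e.IsDiag ∧ ¬ IsIEdge e) ∧ 2 * n * (n - 1) ≤ X.card := by
  classical
  let D : Finset (Sym2 (HOPVertex n)) := Finset.univ.filter (fun e => ¬ e.IsDiag)
  let I : Finset (Sym2 (HOPVertex n)) := Finset.univ.image (fun i : Fin n => s((i, 0), (i, 1)))
  refine ⟨D \ I, fun e => ?_, ?_⟩
  · simp only [D, I, Finset.mem_sdiff, Finset.mem_filter, Finset.mem_univ, true_and,
      Finset.mem_image, not_exists, IsIEdge]
    refine and_congr_right fun _ => ⟨fun h v hv => ?_, fun h i hi => h (i, 0) ?_⟩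
    · obtain ⟨v, w⟩ := v
      apply h v
      rw [hv]
      fin_cases w
      · rfl
      · exact Sym2.eq_swap
    · rw [← hi]; rfl
  · have h1 : D.card = (2 * n).choose 2 := by
      have := Sym2.card_subtype_not_diag (α := HOPVertex n)
      rw [Fintype.card_subtype] at this
      simp only [Fintype.card_prod, Fintype.card_fin] at this
      rw [mul_comm, ← this]
    have h2 : I.card ≤ n := by
      refine Finset.card_image_le.trans ?_
      simp
    have h3 := Finset.le_card_sdiff I D
    rw [h1, Nat.choose_two_right] at h3
    have : 2 * n * (2 * n - 1) / 2 = n * (2 * n - 1) := by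
      rw [mul_assoc, Nat.mul_div_cancel_left _ (by norm_num)]
    rw [this] at h3
    have h4 : n * (2 * n - 1) = 2 * n * (n - 1) + n := by
      rcases n with _ | n
      · rfl
      · simp only [Nat.add_sub_cancel]
        have : 2 * (n + 1) - 1 = 2 * n + 1 := by omega
        rw [this]; ring
    omega

def eo (C : Cfg (Fin n) a b) (i : ℕ) : Sym2 (HOPVertex n) :=
  s((C.u i, C.t i + 1), (C.u (nxt a b i), C.t (nxt a b i)))

theorem edges_sub (C : Cfg (Fin n) a b) (ha : 2 ≤ a) (hb : 2 ≤ b)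
    (F : HOPFactor n s 2 ![a, b]) (hF : ∀ i j, F.cyc i j = vtx C (off a i + j.val / 2) j.val)
    (e : Sym2 (HOPVertex n)) (he : e ∈ F.edges) (hI : ¬ IsIEdge e) : ∃ i < a + b, e = eo C i := by
  rcases he with ⟨k, hk⟩ | ⟨i, j, hij⟩
  · exact absurd ⟨_, hk⟩ hI
  · by_cases hj : j.val % 2 = 0
    · exact absurd ⟨_, by rw [hij, F.alt_even i j hj]⟩ hI
    · obtain ⟨h1, h2⟩ := pos_next ha hb i j (by omega)
      refine ⟨_, pos_lt ha hb i j, ?_⟩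
      rw [hij, hF, hF, eo, h1]
      simp [vtx, hj, h2]

theorem sub_edges (C : Cfg (Fin n) a b) (ha : 2 ≤ a) (hb : 2 ≤ b)
    (F : HOPFactor n s 2 ![a, b]) (hF : ∀ i j, F.cyc i j = vtx C (off a i + j.val / 2) j.val)
    (i : ℕ) (hi : i < a + b) : eo C i ∈ F.edges := by
  have main : ∀ (k : Fin 2) (r : ℕ), r < (![a, b] : Fin 2 → ℕ) k → i = off a k + r →
      eo C i ∈ F.edges := by
    intro k r hr hk
    have : NeZero (2 * (![a, b] : Fin 2 → ℕ) k) := ⟨by have := len_ge ha hb k; omega⟩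
    have hv : ((2 * r + 1 : ℕ) : ZMod (2 * (![a, b] : Fin 2 → ℕ) k)).val = 2 * r + 1 :=
      ZMod.val_natCast_of_lt (by omega)
    obtain ⟨h1, h2⟩ := pos_next ha hb k ((2 * r + 1 : ℕ)) (by rw [hv]; omega)
    right
    refine ⟨k, ((2 * r + 1 : ℕ)), ?_⟩
    have h3 : (2 * r + 1) / 2 = r := by omega
    have h4 : (2 * r + 1) % 2 = 1 := by omega
    rw [hF, hF, h1, hv, h3, ← hk, eo]
    simp only [vtx, h2, h4]
    simp
  by_cases h : i < a
  · exact main 0 i (by simpa using h) (by simp [off])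
  · exact main 1 (i - a) (by simp; omega) (by simp [off]; omega)

theorem sol_of_cov {V K : Type} [Fintype V] [Fintype K] (h : Cov V K a b) (ha : 2 ≤ a)
    (hb : 2 ≤ b) (hV : Fintype.card V = n) (hn : n = s + (a + b))
    (hK : Fintype.card K * (a + b) = 2 * n * (n - 1)) : HOPSolution n s 2 ![a, b] := by
  classical
  obtain ⟨c, hc⟩ := h.transport (Fintype.equivFinOfCardEq hV) (Fintype.equivFin K)
  refine ⟨Fintype.card K, by simpa using hK, ?_⟩
  choose F hF using fun k => exists_factor (s := s) (c k) ha hb hn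
  refine ⟨F, ?_⟩
  obtain ⟨X, hX, hcard⟩ := card_nonI n
  have cover : ∀ e ∈ X, ∃ k, ∃ i < a + b, e = eo (c k) i := by
    intro e
    induction e using Sym2.ind with
    | _ x y =>
      obtain ⟨x, p⟩ := x
      obtain ⟨y, q⟩ := y
      intro he
      obtain ⟨h1, h2⟩ := (hX _).1 he
      have hxy : x ≠ y := by
        rintro rfl
        have : p ≠ q := by rintro rfl; exact h1 rfl
        exact h2 ⟨(x, p), by simp [HOPspouse]; omega⟩
      obtain ⟨k, ⟨i, hi, e1, e2, e3, e4⟩ | ⟨i, hi, e1, e2, e3, e4⟩⟩ := hc x y hxy p q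
      · exact ⟨k, i, hi, by rw [eo, e1, e2, e3, e4]⟩
      · exact ⟨k, i, hi, by rw [eo, e1, e2, e3, e4, Sym2.eq_swap]⟩
  intro e hd hI
  have heX := (hX e).2 ⟨hd, hI⟩
  obtain ⟨k, i, hi, he⟩ := cover e heX
  refine ⟨k, by show e ∈ (F k).edges; rw [he]; exact sub_edges (c k) ha hb (F k) (hF k) i hi, ?_⟩
  intro k' hk'
  by_contra hne
  obtain ⟨i', hi', he'⟩ := edges_sub (c k') ha hb (F k') (hF k') e hk' hI
  let P : Finset (Fin (Fintype.card K) × ℕ) :=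
    (Finset.univ ×ˢ Finset.range (a + b)).erase (k', i')
  have hsub : X ⊆ P.image (fun z => eo (c z.1) z.2) := by
    intro f hf
    obtain ⟨l, j, hj, hf'⟩ := cover f hf
    rw [Finset.mem_image]
    by_cases hl : (l, j) = (k', i')
    · refine ⟨(k, i), ?_, ?_⟩
      · simp [P, hi, Ne.symm hne]
      · have h1 : l = k' := congrArg Prod.fst hl
        have h2 : j = i' := congrArg Prod.snd hl
        rw [hf', h1, h2, ← he', he]
    · exact ⟨(l, j), by simp only [P, Finset.mem_erase]; exact ⟨hl, by simp [hj]⟩, hf'.symm⟩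
  have h1 := (Finset.card_le_card hsub).trans Finset.card_image_le
  have h2 : P.card + 1 = Fintype.card K * (a + b) := by
    rw [Finset.card_erase_add_one (by simp [hi'])]
    simp
  omega

end core


section T2

def lev (e o i : ℕ) : ℕ := if i < e then i % 2 + 1 else if i + 1 = e + o then 2 else (i - e) % 2

def cb (κ : Fin 2 × Fin 2) (l : ℕ) : Fin 2 :=
  if l = 0 then κ.1 else if l = 1 then κ.2 else κ.1 + κ.2

/-- data of a template for the mixed differences -/
structure Tmpl (e o : ℕ) where
  tx : Fin 2 → ℕ → ℤ
  inj : ∀ κ, ∀ i < e + o, ∀ j < e + o, lev e o i = lev e o j →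
    ((e + o : ℕ) : ℤ) ∣ tx κ i - tx κ j → i = j
  last : ∀ κ, tx κ (e + o - 1) = tx κ e
  cov : ∀ d : ℤ, 1 ≤ d → d < (e + o : ℕ) → ∀ p q : Fin 2, ∃ κ : Fin 2 × Fin 2, ∃ i < e + o,
    ∃ w : ℤ,
    (lev e o (nxt e o i) = lev e o i + 1 ∧
      tx κ.2 (nxt e o i) - tx κ.2 i = d + ((e + o : ℕ) : ℤ) * w ∧
      cb κ (lev e o i) + 1 = p ∧ cb κ (lev e o (nxt e o i)) = q) ∨
    (lev e o i = lev e o (nxt e o i) + 1 ∧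
      tx κ.2 i - tx κ.2 (nxt e o i) = d + ((e + o : ℕ) : ℤ) * w ∧
      cb κ (lev e o (nxt e o i)) = p ∧ cb κ (lev e o i) + 1 = q)

theorem lev_le (e o i : ℕ) : lev e o i ≤ 2 := by
  unfold lev; split_ifs <;> omega

theorem zmod_pm (k : ℕ) (z : ZMod (2 * k + 1)) (hz : z ≠ 0) :
    ∃ j : Fin k, z = ((j.1 + 1 : ℕ) : ZMod (2 * k + 1)) ∨
      z = -((j.1 + 1 : ℕ) : ZMod (2 * k + 1)) := by
  have h1 := z.val_lt
  have h0 : z.val ≠ 0 := by rwa [Ne, ZMod.val_eq_zero]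
  have hz' : z = (z.val : ZMod (2 * k + 1)) := (ZMod.natCast_zmod_val z).symm
  by_cases h : z.val ≤ k
  · refine ⟨⟨z.val - 1, by omega⟩, Or.inl ?_⟩
    have : z.val - 1 + 1 = z.val := by omega
    simp only [this]; exact hz'
  · refine ⟨⟨2 * k - z.val, by omega⟩, Or.inr ?_⟩
    rw [eq_neg_iff_add_eq_zero]
    have e1 : ((z.val + (2 * k - z.val + 1) : ℕ) : ZMod (2 * k + 1)) = 0 := by
      have : z.val + (2 * k - z.val + 1) = 2 * k + 1 := by omega
      rw [this]; exact ZMod.natCast_self _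
    rw [Nat.cast_add, ZMod.natCast_zmod_val] at e1
    exact e1

def Tmpl.cfg {e o k : ℕ} (T : Tmpl e o) (j : Fin k)
    (g : ZMod (e + o) × ZMod (2 * k + 1)) (κ : Fin 2 × Fin 2) :
    Cfg (ZMod (e + o) × ZMod (2 * k + 1)) e o where
  u i := ((T.tx κ.2 i : ZMod (e + o)) + g.1, (((j.1 + 1) * lev e o i : ℕ) : ZMod (2 * k + 1)) + g.2)
  t i := cb κ (lev e o i)
  inj := by
    intro i hi i' hi' h
    have h1 := add_right_cancel (congrArg Prod.fst h)
    have h2 := add_right_cancel (congrArg Prod.snd h)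
    refine T.inj κ.2 i hi i' hi' ?_ ?_
    · rw [ZMod.natCast_eq_natCast_iff'] at h2
      have hj := j.2
      have a1 := lev_le e o i
      have a2 := lev_le e o i'
      rw [Nat.mod_eq_of_lt, Nat.mod_eq_of_lt] at h2
      · exact Nat.eq_of_mul_eq_mul_left (by omega) h2
      · calc (j.1 + 1) * lev e o i' ≤ k * 2 := Nat.mul_le_mul hj a2
          _ < _ := by omega
      · calc (j.1 + 1) * lev e o i ≤ k * 2 := Nat.mul_le_mul hj a1
          _ < _ := by omega
    · exact (ZMod.intCast_eq_intCast_iff_dvd_sub _ _ _).1 h1.symm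

theorem T2_one {e o k : ℕ} (T : Tmpl e o) (j : Fin k) (x y : ZMod (e + o))
    (hxy : x ≠ y) (g : ZMod (2 * k + 1)) (p q : Fin 2) (he : 2 ≤ e) :
    ∃ g' κ, (T.cfg j g' κ).E (x, g) p (y, g + ((j.1 + 1 : ℕ) : ZMod (2 * k + 1))) q ∨
      (T.cfg j g' κ).E (y, g + ((j.1 + 1 : ℕ) : ZMod (2 * k + 1))) q (x, g) p := by
  have : NeZero (e + o) := ⟨by omega⟩
  have hd : (y - x).val ≠ 0 := by
    rw [Ne, ZMod.val_eq_zero, sub_eq_zero]; exact fun h => hxy h.symm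
  have hd2 := (y - x).val_lt
  have hval : (((y - x).val : ℤ) : ZMod (e + o)) = y - x := by
    rw [Int.cast_natCast, ZMod.natCast_zmod_val]
  obtain ⟨κ, i, hi, w, ⟨h1, h2, h3, h4⟩ | ⟨h1, h2, h3, h4⟩⟩ :=
    T.cov ((y - x).val : ℤ) (by omega) (by omega) p q
  · refine ⟨(x - (T.tx κ.2 i : ZMod (e + o)), g - (((j.1 + 1) * lev e o i : ℕ) : ZMod (2 * k + 1))),
      κ, Or.inl ⟨i, hi, ?_, h3, ?_, h4⟩⟩
    · simp [Tmpl.cfg]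
    · have h5 := congrArg (Int.cast : ℤ → ZMod (e + o)) h2
      simp only [Int.cast_sub, Int.cast_add, Int.cast_mul, hval, Int.cast_natCast,
        ZMod.natCast_self, zero_mul, add_zero] at h5
      simp only [Tmpl.cfg, h1, Prod.mk.injEq]
      constructor
      · linear_combination h5
      · push_cast; ring
  · refine ⟨(y - (T.tx κ.2 i : ZMod (e + o)),
        g + ((j.1 + 1 : ℕ) : ZMod (2 * k + 1)) - (((j.1 + 1) * lev e o i : ℕ) : ZMod (2 * k + 1))),
      κ, Or.inr ⟨i, hi, ?_, h4, ?_, h3⟩⟩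
    · simp [Tmpl.cfg]
    · have h5 := congrArg (Int.cast : ℤ → ZMod (e + o)) h2
      simp only [Int.cast_sub, Int.cast_add, Int.cast_mul, hval, Int.cast_natCast,
        ZMod.natCast_self, zero_mul, add_zero] at h5
      simp only [Tmpl.cfg, h1, Prod.mk.injEq]
      constructor
      · linear_combination -h5
      · push_cast; ring

theorem T2_two {e o k : ℕ} (T : Tmpl e o) (j : Fin k) (x : ZMod (e + o))
    (g : ZMod (2 * k + 1)) (p q : Fin 2) (he : 2 ≤ e) (ho : 3 ≤ o) :
    ∃ g' κ, (T.cfg j g' κ).E (x, g + 2 * ((j.1 + 1 : ℕ) : ZMod (2 * k + 1))) q (x, g) p := by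
  refine ⟨(x - (T.tx (p + q + 1) e : ZMod (e + o)), g), (p, p + q + 1),
    e + o - 1, by omega, ?_⟩
  have hn : nxt e o (e + o - 1) = e := by unfold nxt; split_ifs <;> omega
  have l1 : lev e o (e + o - 1) = 2 := by unfold lev; split_ifs <;> omega
  have l2 : lev e o e = 0 := by unfold lev; split_ifs <;> omega
  refine ⟨?_, ?_, ?_, ?_⟩
  · simp only [Tmpl.cfg, l1, T.last, Prod.mk.injEq]
    constructor
    · ring
    · push_cast; ring
  · simp only [Tmpl.cfg, l1]
    revert p q; decide
  · simp only [Tmpl.cfg, hn, l2, Prod.mk.injEq]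
    constructor
    · ring
    · push_cast; ring
  · simp only [Tmpl.cfg, hn, l2]
    revert p q; decide

theorem cov_T2 {e o k : ℕ} {K : Type} (T : Tmpl e o) (he : 2 ≤ e) (ho : 3 ≤ o)
    (T1 : Cov (ZMod (e + o)) K e o) :
    Cov (ZMod (e + o) × ZMod (2 * k + 1))
      ((K × ZMod (2 * k + 1)) ⊕ (Fin k × (ZMod (e + o) × ZMod (2 * k + 1)) × (Fin 2 × Fin 2)))
      e o := by
  obtain ⟨c, hc⟩ := T1
  refine ⟨Sum.elim (fun z => ⟨fun i => ((c z.1).u i, z.2), (c z.1).t, fun i hi j hj h =>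
    (c z.1).inj i hi j hj (congrArg Prod.fst h)⟩) (fun z => T.cfg z.1 z.2.1 z.2.2), ?_⟩
  rintro ⟨x, g⟩ ⟨y, g'⟩ hne p q
  by_cases hg : g = g'
  · subst hg
    have hxy : x ≠ y := by rintro rfl; exact hne rfl
    obtain ⟨k, ⟨i, hi, h1, h2, h3, h4⟩ | ⟨i, hi, h1, h2, h3, h4⟩⟩ := hc x y hxy p q
    · exact ⟨Sum.inl (k, g), Or.inl ⟨i, hi, by simp [h1], h2, by simp [h3], h4⟩⟩
    · exact ⟨Sum.inl (k, g), Or.inr ⟨i, hi, by simp [h1], h2, by simp [h3], h4⟩⟩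
  · by_cases hxy : x = y
    · subst hxy
      have h2 : (2 : ZMod (2 * k + 1)) * (k + 1) = 1 := by
        have := ZMod.natCast_self (2 * k + 1)
        push_cast at this
        linear_combination this
      obtain ⟨j, hj | hj⟩ := zmod_pm k ((g' - g) * (k + 1)) (fun h => hg (by
        have : g' - g = 0 := by linear_combination 2 * h - (g' - g) * h2
        exact (sub_eq_zero.1 this).symm))
      · obtain ⟨z, κ, h⟩ := T2_two T j x g p q he ho
        refine ⟨Sum.inr (j, z, κ), Or.inr ?_⟩
        have : g' = g + 2 * ((j.1 + 1 : ℕ) : ZMod (2 * k + 1)) := by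
          rw [← hj]; linear_combination -(g' - g) * h2
        rw [this]; exact h
      · obtain ⟨z, κ, h⟩ := T2_two T j x g' q p he ho
        refine ⟨Sum.inr (j, z, κ), Or.inl ?_⟩
        have : g = g' + 2 * ((j.1 + 1 : ℕ) : ZMod (2 * k + 1)) := by
          rw [← neg_eq_iff_eq_neg.2 hj]; linear_combination (g' - g) * h2
        rw [this]; exact h
    · obtain ⟨j, hj | hj⟩ := zmod_pm k (g' - g) (fun h => hg (sub_eq_zero.1 h).symm)
      · obtain ⟨z, κ, h⟩ := T2_one T j x y hxy g p q he
        refine ⟨Sum.inr (j, z, κ), ?_⟩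
        have : g' = g + ((j.1 + 1 : ℕ) : ZMod (2 * k + 1)) := by rw [← hj]; ring
        rw [this]; exact h
      · obtain ⟨z, κ, h⟩ := T2_one T j y x (Ne.symm hxy) g' q p he
        refine ⟨Sum.inr (j, z, κ), ?_⟩
        have : g = g' + ((j.1 + 1 : ℕ) : ZMod (2 * k + 1)) := by
          rw [← neg_eq_iff_eq_neg.2 hj]; ring
        rw [this]; exact h.symm

end T2


section T2build

/-- label function of a template from its strands -/
def tlab (e o : ℕ) (x y p q : ℕ → ℤ) (i : ℕ) : ℤ :=
  if i < e then (if i % 2 = 0 then x (i / 2) else y (i / 2))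
  else if i + 1 = e + o then 0
  else (if (i - e) % 2 = 0 then p ((i - e) / 2) else q ((i - e) / 2))

theorem tlab_inj (f r : ℕ) (x y p q : ℕ → ℤ) (L0 L1 L2 : ℤ) (hf : 1 ≤ f) (hr : 1 ≤ r)
    (m : ℕ) (hm : m = 2 * f + (2 * r + 1))
    (hx : ∀ t t', t < t' → t' < f → x t < x t') (hy : ∀ t t', t < t' → t' < f → y t' < y t)
    (hp : ∀ t t', t < t' → t' < r → p t < p t') (hq : ∀ t t', t < t' → t' < r → q t' < q t)
    (hxq : ∀ t t', t < f → t' < r → x t ≠ q t') (hy0 : ∀ t, t < f → y t ≠ 0)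
    (bx : ∀ t, t < f → L1 ≤ x t ∧ x t < L1 + m) (bq : ∀ t, t < r → L1 ≤ q t ∧ q t < L1 + m)
    (bp : ∀ t, t < r → L0 ≤ p t ∧ p t < L0 + m)
    (by' : ∀ t, t < f → L2 ≤ y t ∧ y t < L2 + m) (hL2 : L2 ≤ 0 ∧ 0 < L2 + m)
    (i : ℕ) (hi : i < m) (j : ℕ) (hj : j < m)
    (hl : lev (2 * f) (2 * r + 1) i = lev (2 * f) (2 * r + 1) j)
    (hd : (m : ℤ) ∣ tlab (2 * f) (2 * r + 1) x y p q i - tlab (2 * f) (2 * r + 1) x y p q j) :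
    i = j := by
  have key : ∀ (A B L : ℤ), L ≤ A → A < L + m → L ≤ B → B < L + m → (m : ℤ) ∣ A - B → A = B := by
    intro A B L h1 h2 h3 h4 h5
    have := Int.eq_zero_of_abs_lt_dvd h5 (by rw [abs_lt]; constructor <;> linarith)
    linarith
  have mono : ∀ (g : ℕ → ℤ) (N : ℕ), (∀ t t', t < t' → t' < N → g t < g t') →
      ∀ t t', t < N → t' < N → g t = g t' → t = t' := by
    intro g N h t t' ht ht' hg
    rcases lt_trichotomy t t' with h1 | h1 | h1
    · have := h _ _ h1 ht'; omega
    · exact h1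
    · have := h _ _ h1 ht; omega
  have anti : ∀ (g : ℕ → ℤ) (N : ℕ), (∀ t t', t < t' → t' < N → g t' < g t) →
      ∀ t t', t < N → t' < N → g t = g t' → t = t' := by
    intro g N h t t' ht ht' hg
    rcases lt_trichotomy t t' with h1 | h1 | h1
    · have := h _ _ h1 ht'; omega
    · exact h1
    · have := h _ _ h1 ht; omega
  unfold lev at hl
  unfold tlab at hd
  split_ifs at hl hd <;> first
    | omega
    | (have b1 := bx (i / 2) (by omega)
       have b2 := bx (j / 2) (by omega)
       have := mono x f hx (i / 2) (j / 2) (by omega) (by omega)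
        (key _ _ L1 b1.1 b1.2 b2.1 b2.2 hd)
       omega)
    | (have b1 := by' (i / 2) (by omega)
       have b2 := by' (j / 2) (by omega)
       have := anti y f hy (i / 2) (j / 2) (by omega) (by omega)
        (key _ _ L2 b1.1 b1.2 b2.1 b2.2 hd)
       omega)
    | (have b1 := bp ((i - 2 * f) / 2) (by omega)
       have b2 := bp ((j - 2 * f) / 2) (by omega)
       have := mono p r hp ((i - 2 * f) / 2) ((j - 2 * f) / 2) (by omega) (by omega)
        (key _ _ L0 b1.1 b1.2 b2.1 b2.2 hd)
       omega)
    | (have b1 := bq ((i - 2 * f) / 2) (by omega)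
       have b2 := bq ((j - 2 * f) / 2) (by omega)
       have := anti q r hq ((i - 2 * f) / 2) ((j - 2 * f) / 2) (by omega) (by omega)
        (key _ _ L1 b1.1 b1.2 b2.1 b2.2 hd)
       omega)
    | (have b1 := bx (i / 2) (by omega)
       have b2 := bq ((j - 2 * f) / 2) (by omega)
       exact absurd (key _ _ L1 b1.1 b1.2 b2.1 b2.2 hd) (hxq _ _ (by omega) (by omega)))
    | (have b1 := bx (j / 2) (by omega)
       have b2 := bq ((i - 2 * f) / 2) (by omega)
       exact absurd (key _ _ L1 b2.1 b2.2 b1.1 b1.2 hd).symm (hxq _ _ (by omega) (by omega)))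
    | (have b1 := by' (i / 2) (by omega)
       exact absurd (key _ _ L2 b1.1 b1.2 hL2.1 hL2.2 hd) (hy0 _ (by omega)))
    | (have b1 := by' (j / 2) (by omega)
       exact absurd (key _ _ L2 hL2.1 hL2.2 b1.1 b1.2 hd).symm (hy0 _ (by omega)))

theorem bits_up (l : ℕ) (hl : l ≤ 1) (p q : Fin 2) :
    ∃ κ : Fin 2 × Fin 2, cb κ l + 1 = p ∧ cb κ (l + 1) = q := by
  interval_cases l <;> revert p q <;> decide

theorem bits_down (l : ℕ) (hl : l ≤ 1) (p q : Fin 2) :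
    ∃ κ : Fin 2 × Fin 2, cb κ l = p ∧ cb κ (l + 1) + 1 = q := by
  interval_cases l <;> revert p q <;> decide

theorem tmpl_build (f r : ℕ) (x y p q : ℕ → ℤ) (L0 L1 L2 : ℤ) (hf : 2 ≤ f) (hr : 1 ≤ r)
    (m : ℕ) (hm : m = 2 * f + (2 * r + 1))
    (hx : ∀ t t', t < t' → t' < f → x t < x t') (hy : ∀ t t', t < t' → t' < f → y t' < y t)
    (hp : ∀ t t', t < t' → t' < r → p t < p t') (hq : ∀ t t', t < t' → t' < r → q t' < q t)
    (hxq : ∀ t t', t < f → t' < r → x t ≠ q t') (hy0 : ∀ t, t < f → y t ≠ 0)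
    (bx : ∀ t, t < f → L1 ≤ x t ∧ x t < L1 + m) (bq : ∀ t, t < r → L1 ≤ q t ∧ q t < L1 + m)
    (bp : ∀ t, t < r → L0 ≤ p t ∧ p t < L0 + m)
    (by' : ∀ t, t < f → L2 ≤ y t ∧ y t < L2 + m) (hL2 : L2 ≤ 0 ∧ 0 < L2 + m) (hp0 : p 0 = 0)
    (hcov : ∀ d : ℤ, 1 ≤ d → d < m → ∃ w : ℤ,
      (∃ t < f, y t - x t = d + m * w) ∨ (∃ t, t + 1 < f ∧ y t - x (t + 1) = d + m * w) ∨
      y (f - 1) - x 0 = d + m * w ∨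
      (∃ t < r, q t - p t = d + m * w) ∨ (∃ t, t + 1 < r ∧ q t - p (t + 1) = d + m * w) ∨
      - q (r - 1) = d + m * w) :
    Nonempty (Tmpl (2 * f) (2 * r + 1)) := by
  refine ⟨⟨fun _ => tlab (2 * f) (2 * r + 1) x y p q, fun κ i hi j hj hl hd => ?_, fun κ => ?_,
    fun d hd1 hd2 a b => ?_⟩⟩
  · exact tlab_inj f r x y p q L0 L1 L2 (by omega) hr m hm hx hy hp hq hxq hy0 bx bq bp by' hL2
      i (by omega) j (by omega) hl (by rw [hm]; exact hd)
  · have h1 : tlab (2 * f) (2 * r + 1) x y p q (2 * f + (2 * r + 1) - 1) = 0 := by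
      unfold tlab; split_ifs <;> first | omega | rfl
    have h2 : tlab (2 * f) (2 * r + 1) x y p q (2 * f) = p 0 := by
      unfold tlab; split_ifs <;> first | omega | simp
    rw [h1, h2, hp0]
  · by_contra hno
    have up : ∀ i < 2 * f + (2 * r + 1), ∀ w : ℤ,
        lev (2 * f) (2 * r + 1) (nxt (2 * f) (2 * r + 1) i) = lev (2 * f) (2 * r + 1) i + 1 →
        tlab (2 * f) (2 * r + 1) x y p q (nxt (2 * f) (2 * r + 1) i)
          - tlab (2 * f) (2 * r + 1) x y p q i = d + m * w → False := by
      intro i hi w h1 h2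
      obtain ⟨κ, k1, k2⟩ := bits_up (lev (2 * f) (2 * r + 1) i)
        (by have := lev_le (2 * f) (2 * r + 1) (nxt (2 * f) (2 * r + 1) i); omega) a b
      exact hno ⟨κ, i, hi, w, Or.inl ⟨h1, by rw [← hm]; exact h2, k1, by rw [h1]; exact k2⟩⟩
    have dn : ∀ i < 2 * f + (2 * r + 1), ∀ w : ℤ,
        lev (2 * f) (2 * r + 1) i = lev (2 * f) (2 * r + 1) (nxt (2 * f) (2 * r + 1) i) + 1 →
        tlab (2 * f) (2 * r + 1) x y p q i
          - tlab (2 * f) (2 * r + 1) x y p q (nxt (2 * f) (2 * r + 1) i) = d + m * w → False := by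
      intro i hi w h1 h2
      obtain ⟨κ, k1, k2⟩ := bits_down (lev (2 * f) (2 * r + 1) (nxt (2 * f) (2 * r + 1) i))
        (by have := lev_le (2 * f) (2 * r + 1) i; omega) a b
      exact hno ⟨κ, i, hi, w, Or.inr ⟨h1, by rw [← hm]; exact h2, k1, by rw [h1]; exact k2⟩⟩
    have tx : ∀ t < f, tlab (2 * f) (2 * r + 1) x y p q (2 * t) = x t ∧
        lev (2 * f) (2 * r + 1) (2 * t) = 1 := by
      intro t ht; unfold tlab lev
      rw [if_pos (by omega), if_pos (by omega), if_pos (by omega)]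
      constructor <;> [congr 1; skip] <;> omega
    have ty : ∀ t < f, tlab (2 * f) (2 * r + 1) x y p q (2 * t + 1) = y t ∧
        lev (2 * f) (2 * r + 1) (2 * t + 1) = 2 := by
      intro t ht; unfold tlab lev
      rw [if_pos (by omega), if_neg (by omega), if_pos (by omega)]
      constructor <;> [congr 1; skip] <;> omega
    have tp : ∀ t < r, tlab (2 * f) (2 * r + 1) x y p q (2 * f + 2 * t) = p t ∧
        lev (2 * f) (2 * r + 1) (2 * f + 2 * t) = 0 := by
      intro t ht; unfold tlab lev
      rw [if_neg (by omega), if_neg (by omega), if_pos (by omega), if_neg (by omega),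
        if_neg (by omega)]
      constructor <;> [congr 1; skip] <;> omega
    have tq : ∀ t < r, tlab (2 * f) (2 * r + 1) x y p q (2 * f + 2 * t + 1) = q t ∧
        lev (2 * f) (2 * r + 1) (2 * f + 2 * t + 1) = 1 := by
      intro t ht; unfold tlab lev
      rw [if_neg (by omega), if_neg (by omega), if_neg (by omega), if_neg (by omega),
        if_neg (by omega)]
      constructor <;> [congr 1; skip] <;> omega
    have tl : tlab (2 * f) (2 * r + 1) x y p q (2 * f + 2 * r) = 0 ∧
        lev (2 * f) (2 * r + 1) (2 * f + 2 * r) = 2 := by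
      unfold tlab lev
      rw [if_neg (by omega), if_pos (by omega), if_neg (by omega), if_pos (by omega)]
      exact ⟨rfl, rfl⟩
    have nx : ∀ i j, (i + 1 = j ∧ i + 1 ≠ 2 * f ∧ i + 1 ≠ 2 * f + (2 * r + 1)) ∨
        (i + 1 = 2 * f ∧ j = 0) → nxt (2 * f) (2 * r + 1) i = j := by
      intro i j h; unfold nxt; split_ifs <;> omega
    obtain ⟨w, ⟨t, ht, h⟩ | ⟨t, ht, h⟩ | h | ⟨t, ht, h⟩ | ⟨t, ht, h⟩ | h⟩ :=
      hcov d hd1 (by omega)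
    · have hn := nx (2 * t) (2 * t + 1) (by omega)
      exact up (2 * t) (by omega) w (by rw [hn, (tx t ht).2, (ty t ht).2])
        (by rw [hn, (tx t ht).1, (ty t ht).1, h])
    · have hn := nx (2 * t + 1) (2 * (t + 1)) (by omega)
      exact dn (2 * t + 1) (by omega) w (by rw [hn, (tx (t + 1) ht).2, (ty t (by omega)).2])
        (by rw [hn, (tx (t + 1) ht).1, (ty t (by omega)).1, h])
    · have hn := nx (2 * (f - 1) + 1) (2 * 0) (by omega)
      exact dn (2 * (f - 1) + 1) (by omega) w
        (by rw [hn, (tx 0 (by omega)).2, (ty (f - 1) (by omega)).2])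
        (by rw [hn, (tx 0 (by omega)).1, (ty (f - 1) (by omega)).1, h])
    · have hn := nx (2 * f + 2 * t) (2 * f + 2 * t + 1) (by omega)
      exact up (2 * f + 2 * t) (by omega) w (by rw [hn, (tp t ht).2, (tq t ht).2])
        (by rw [hn, (tp t ht).1, (tq t ht).1, h])
    · have hn := nx (2 * f + 2 * t + 1) (2 * f + 2 * (t + 1)) (by omega)
      exact dn (2 * f + 2 * t + 1) (by omega) w
        (by rw [hn, (tp (t + 1) ht).2, (tq t (by omega)).2])
        (by rw [hn, (tp (t + 1) ht).1, (tq t (by omega)).1, h])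
    · have hn := nx (2 * f + 2 * (r - 1) + 1) (2 * f + 2 * r) (by omega)
      exact up (2 * f + 2 * (r - 1) + 1) (by omega) w
        (by rw [hn, tl.2, (tq (r - 1) (by omega)).2])
        (by rw [hn, tl.1, (tq (r - 1) (by omega)).1, ← h]; ring)

end T2build


section T2fam

set_option maxHeartbeats 2000000 in
theorem tmpl_a (f r : ℕ) (hf : 2 ≤ f) (hf2 : f % 2 = 0) (hr : r % 2 = 1) :
    Nonempty (Tmpl (2 * f) (2 * r + 1)) := by
  refine tmpl_build f r (fun t => (t : ℤ) - f - r + 1)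
    (fun t => if 2 * t < f then (f : ℤ) + 1 - t else (f : ℤ) - t)
    (fun t => (t : ℤ))
    (fun t => if 2 * t + 1 < r ∨ r = 1 then (r : ℤ) - t else (r : ℤ) - 2 - t)
    (0) (-f - r) (0) (by omega) (by omega) (2 * f + (2 * r + 1)) rfl ?_ ?_ ?_ ?_ ?_ ?_ ?_ ?_ ?_ ?_ (by omega) ?_ ?_
  iterate 5 (on_goal 1 => intro t t' h1 h2; beta_reduce; (try split_ifs) <;> omega)
  iterate 5 (on_goal 1 => intro t h1; beta_reduce; (try split_ifs) <;> omega)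
  · beta_reduce; (try split_ifs) <;> first | omega | simp
  · intro d hd1 hd2; beta_reduce; push_cast at hd2 ⊢
    by_cases hg : r = 1
    · by_cases h0 : d ≤ 1
      · exact ⟨0, Or.inr (Or.inr (Or.inr (Or.inl ⟨(0 : ℤ).toNat, by omega, by (try split_ifs) <;> omega⟩)))⟩
      by_cases h1 : d ≤ (2 * f + r : ℤ) - f - 1
      · rcases Int.emod_two_eq_zero_or_one ((2 * f + r : ℤ) - d - 1) with h | h
        · exact ⟨0, Or.inl ⟨(((2 * f + r : ℤ) - d - 1) / 2 : ℤ).toNat, by omega, by (try split_ifs) <;> omega⟩⟩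
        · exact ⟨0, Or.inr (Or.inl ⟨(((2 * f + r : ℤ) - d - 1) / 2 : ℤ).toNat, by omega, by (try split_ifs) <;> omega⟩)⟩
      by_cases h2 : d ≤ (2 * f + r : ℤ) - f
      · exact ⟨0, Or.inr (Or.inr (Or.inl (by (try split_ifs) <;> omega)))⟩
      by_cases h3 : d ≤ (2 * f + r : ℤ)
      · rcases Int.emod_two_eq_zero_or_one ((2 * f + r : ℤ) - d - 0) with h | h
        · exact ⟨0, Or.inl ⟨(((2 * f + r : ℤ) - d - 0) / 2 : ℤ).toNat, by omega, by (try split_ifs) <;> omega⟩⟩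
        · exact ⟨0, Or.inr (Or.inl ⟨(((2 * f + r : ℤ) - d - 0) / 2 : ℤ).toNat, by omega, by (try split_ifs) <;> omega⟩)⟩
      exact ⟨-1, Or.inr (Or.inr (Or.inr (Or.inr (Or.inr (by (try split_ifs) <;> omega)))))⟩
    by_cases h0 : d ≤ 1
    · exact ⟨0, Or.inr (Or.inr (Or.inr (Or.inr (Or.inr (by (try split_ifs) <;> omega)))))⟩
    by_cases h1 : d ≤ r
    · rcases Int.emod_two_eq_zero_or_one (r - d - 0) with h | h
      · exact ⟨0, Or.inr (Or.inr (Or.inr (Or.inl ⟨((r - d - 0) / 2 : ℤ).toNat, by omega, by (try split_ifs) <;> omega⟩)))⟩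
      · exact ⟨0, Or.inr (Or.inr (Or.inr (Or.inr (Or.inl ⟨((r - d - 0) / 2 : ℤ).toNat, by omega, by (try split_ifs) <;> omega⟩))))⟩
    by_cases h2 : d ≤ (2 * f + r : ℤ) - f - 1
    · rcases Int.emod_two_eq_zero_or_one ((2 * f + r : ℤ) - d - 1) with h | h
      · exact ⟨0, Or.inl ⟨(((2 * f + r : ℤ) - d - 1) / 2 : ℤ).toNat, by omega, by (try split_ifs) <;> omega⟩⟩
      · exact ⟨0, Or.inr (Or.inl ⟨(((2 * f + r : ℤ) - d - 1) / 2 : ℤ).toNat, by omega, by (try split_ifs) <;> omega⟩)⟩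
    by_cases h3 : d ≤ (2 * f + r : ℤ) - f
    · exact ⟨0, Or.inr (Or.inr (Or.inl (by (try split_ifs) <;> omega)))⟩
    by_cases h4 : d ≤ (2 * f + r : ℤ)
    · rcases Int.emod_two_eq_zero_or_one ((2 * f + r : ℤ) - d - 0) with h | h
      · exact ⟨0, Or.inl ⟨(((2 * f + r : ℤ) - d - 0) / 2 : ℤ).toNat, by omega, by (try split_ifs) <;> omega⟩⟩
      · exact ⟨0, Or.inr (Or.inl ⟨(((2 * f + r : ℤ) - d - 0) / 2 : ℤ).toNat, by omega, by (try split_ifs) <;> omega⟩)⟩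
    rcases Int.emod_two_eq_zero_or_one (r - 2 - (d - (2 * f + 2 * r + 1)) - 0) with h | h
    · exact ⟨-1, Or.inr (Or.inr (Or.inr (Or.inl ⟨((r - 2 - (d - (2 * f + 2 * r + 1)) - 0) / 2 : ℤ).toNat, by omega, by (try split_ifs) <;> omega⟩)))⟩
    · exact ⟨-1, Or.inr (Or.inr (Or.inr (Or.inr (Or.inl ⟨((r - 2 - (d - (2 * f + 2 * r + 1)) - 0) / 2 : ℤ).toNat, by omega, by (try split_ifs) <;> omega⟩))))⟩

set_option maxHeartbeats 2000000 in
theorem tmpl_b (f r : ℕ) (hf : 2 ≤ f) (hf2 : f % 2 = 0) (hr : r % 2 = 0) (hr4 : 4 ≤ r) :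
    Nonempty (Tmpl (2 * f) (2 * r + 1)) := by
  refine tmpl_build f r (fun t => (t : ℤ) + r)
    (fun t => if 2 * t < f then 2 * (f : ℤ) + 2 * r - 2 - t else 2 * (f : ℤ) + 2 * r - 3 - t)
    (fun t => if 2 * t + 4 ≤ r then (t : ℤ) else t + 1)
    (fun t => if 2 * t + 4 < r then (r : ℤ) - 2 - t else if 2 * t + 4 = r then (t : ℤ) + 1 else (r : ℤ) - 3 - t)
    (0) (-2) (0) (by omega) (by omega) (2 * f + (2 * r + 1)) rfl ?_ ?_ ?_ ?_ ?_ ?_ ?_ ?_ ?_ ?_ (by omega) ?_ ?_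
  iterate 5 (on_goal 1 => intro t t' h1 h2; beta_reduce; (try split_ifs) <;> omega)
  iterate 5 (on_goal 1 => intro t h1; beta_reduce; (try split_ifs) <;> omega)
  · beta_reduce; (try split_ifs) <;> first | omega | simp
  · intro d hd1 hd2; beta_reduce; push_cast at hd2 ⊢
    by_cases h0 : d ≤ 1
    · exact ⟨0, Or.inr (Or.inr (Or.inr (Or.inl ⟨((r - 4 : ℤ) / 2 : ℤ).toNat, by omega, by (try split_ifs) <;> omega⟩)))⟩
    by_cases h1 : d ≤ 2
    · exact ⟨0, Or.inr (Or.inr (Or.inr (Or.inr (Or.inr (by (try split_ifs) <;> omega)))))⟩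
    by_cases h2 : d ≤ r - 2
    · rcases Int.emod_two_eq_zero_or_one (r - 2 - d - 0) with h | h
      · exact ⟨0, Or.inr (Or.inr (Or.inr (Or.inl ⟨((r - 2 - d - 0) / 2 : ℤ).toNat, by omega, by (try split_ifs) <;> omega⟩)))⟩
      · exact ⟨0, Or.inr (Or.inr (Or.inr (Or.inr (Or.inl ⟨((r - 2 - d - 0) / 2 : ℤ).toNat, by omega, by (try split_ifs) <;> omega⟩))))⟩
    by_cases h3 : d ≤ (2 * f + r - 2 : ℤ) - f - 1
    · rcases Int.emod_two_eq_zero_or_one ((2 * f + r - 2 : ℤ) - d - 1) with h | h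
      · exact ⟨0, Or.inl ⟨(((2 * f + r - 2 : ℤ) - d - 1) / 2 : ℤ).toNat, by omega, by (try split_ifs) <;> omega⟩⟩
      · exact ⟨0, Or.inr (Or.inl ⟨(((2 * f + r - 2 : ℤ) - d - 1) / 2 : ℤ).toNat, by omega, by (try split_ifs) <;> omega⟩)⟩
    by_cases h4 : d ≤ (2 * f + r - 2 : ℤ) - f
    · exact ⟨0, Or.inr (Or.inr (Or.inl (by (try split_ifs) <;> omega)))⟩
    by_cases h5 : d ≤ (2 * f + r - 2 : ℤ)
    · rcases Int.emod_two_eq_zero_or_one ((2 * f + r - 2 : ℤ) - d - 0) with h | h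
      · exact ⟨0, Or.inl ⟨(((2 * f + r - 2 : ℤ) - d - 0) / 2 : ℤ).toNat, by omega, by (try split_ifs) <;> omega⟩⟩
      · exact ⟨0, Or.inr (Or.inl ⟨(((2 * f + r - 2 : ℤ) - d - 0) / 2 : ℤ).toNat, by omega, by (try split_ifs) <;> omega⟩)⟩
    rcases Int.emod_two_eq_zero_or_one (r - 4 - (d - (2 * f + 2 * r + 1)) - 0) with h | h
    · exact ⟨-1, Or.inr (Or.inr (Or.inr (Or.inl ⟨((r - 4 - (d - (2 * f + 2 * r + 1)) - 0) / 2 : ℤ).toNat, by omega, by (try split_ifs) <;> omega⟩)))⟩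
    · exact ⟨-1, Or.inr (Or.inr (Or.inr (Or.inr (Or.inl ⟨((r - 4 - (d - (2 * f + 2 * r + 1)) - 0) / 2 : ℤ).toNat, by omega, by (try split_ifs) <;> omega⟩))))⟩

set_option maxHeartbeats 2000000 in
theorem tmpl_c (f r : ℕ) (hf : 2 ≤ f) (hf2 : f % 2 = 0) (hr : r = 2) :
    Nonempty (Tmpl (2 * f) (2 * r + 1)) := by
  refine tmpl_build f r (fun t => (t : ℤ) - f - 1)
    (fun t => if t = 0 then (f : ℤ) + 2 else if 2 * t < f then (f : ℤ) + 1 - t else (f : ℤ) - t)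
    (fun t => if t = 0 then (0 : ℤ) else 3)
    (fun t => if t = 0 then (2 : ℤ) else -1)
    (0) (-f - 1) (0) (by omega) (by omega) (2 * f + (2 * r + 1)) rfl ?_ ?_ ?_ ?_ ?_ ?_ ?_ ?_ ?_ ?_ (by omega) ?_ ?_
  iterate 5 (on_goal 1 => intro t t' h1 h2; beta_reduce; (try split_ifs) <;> omega)
  iterate 5 (on_goal 1 => intro t h1; beta_reduce; (try split_ifs) <;> omega)
  · beta_reduce; (try split_ifs) <;> first | omega | simp
  · intro d hd1 hd2; beta_reduce; push_cast at hd2 ⊢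
    by_cases h0 : d ≤ 1
    · exact ⟨0, Or.inr (Or.inr (Or.inr (Or.inr (Or.inr (by (try split_ifs) <;> omega)))))⟩
    by_cases h1 : d ≤ 2
    · exact ⟨0, Or.inr (Or.inr (Or.inr (Or.inl ⟨(0 : ℤ).toNat, by omega, by (try split_ifs) <;> omega⟩)))⟩
    by_cases h2 : d ≤ (2 * f + 2 : ℤ) - f - 1
    · rcases Int.emod_two_eq_zero_or_one ((2 * f + 2 : ℤ) - d - 1) with h | h
      · exact ⟨0, Or.inl ⟨(((2 * f + 2 : ℤ) - d - 1) / 2 : ℤ).toNat, by omega, by (try split_ifs) <;> omega⟩⟩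
      · exact ⟨0, Or.inr (Or.inl ⟨(((2 * f + 2 : ℤ) - d - 1) / 2 : ℤ).toNat, by omega, by (try split_ifs) <;> omega⟩)⟩
    by_cases h3 : d ≤ (2 * f + 2 : ℤ) - f
    · exact ⟨0, Or.inr (Or.inr (Or.inl (by (try split_ifs) <;> omega)))⟩
    by_cases h4 : d ≤ 2 * f
    · rcases Int.emod_two_eq_zero_or_one ((2 * f + 2 : ℤ) - d - 0) with h | h
      · exact ⟨0, Or.inl ⟨(((2 * f + 2 : ℤ) - d - 0) / 2 : ℤ).toNat, by omega, by (try split_ifs) <;> omega⟩⟩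
      · exact ⟨0, Or.inr (Or.inl ⟨(((2 * f + 2 : ℤ) - d - 0) / 2 : ℤ).toNat, by omega, by (try split_ifs) <;> omega⟩)⟩
    by_cases h5 : d ≤ -4 + (2 * f + 2 * r + 1)
    · exact ⟨-1, Or.inr (Or.inr (Or.inr (Or.inl ⟨(1 : ℤ).toNat, by omega, by (try split_ifs) <;> omega⟩)))⟩
    by_cases h6 : d ≤ 2 * f + 2
    · exact ⟨0, Or.inr (Or.inl ⟨(0 : ℤ).toNat, by omega, by (try split_ifs) <;> omega⟩)⟩
    by_cases h7 : d ≤ 2 * f + 3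
    · exact ⟨0, Or.inl ⟨(0 : ℤ).toNat, by omega, by (try split_ifs) <;> omega⟩⟩
    exact ⟨-1, Or.inr (Or.inr (Or.inr (Or.inr (Or.inl ⟨(0 : ℤ).toNat, by omega, by (try split_ifs) <;> omega⟩))))⟩

set_option maxHeartbeats 2000000 in
theorem tmpl_d (f r : ℕ) (hf : 3 ≤ f) (hf2 : f % 2 = 1) (hr : r = 1) :
    Nonempty (Tmpl (2 * f) (2 * r + 1)) := by
  refine tmpl_build f r (fun t => if t = 0 then -(f : ℤ) else (t : ℤ) + 1 - f)
    (fun t => if t = 0 then 1 - (f : ℤ) else if 2 * t + 1 < f then -(t : ℤ) - f else -(t : ℤ) - 1 - f)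
    (fun t => (0 : ℤ))
    (fun t => (2 : ℤ))
    (0) (-f) (-2 * f) (by omega) (by omega) (2 * f + (2 * r + 1)) rfl ?_ ?_ ?_ ?_ ?_ ?_ ?_ ?_ ?_ ?_ (by omega) ?_ ?_
  iterate 5 (on_goal 1 => intro t t' h1 h2; beta_reduce; (try split_ifs) <;> omega)
  iterate 5 (on_goal 1 => intro t h1; beta_reduce; (try split_ifs) <;> omega)
  · beta_reduce; (try split_ifs) <;> first | omega | simp
  · intro d hd1 hd2; beta_reduce; push_cast at hd2 ⊢
    by_cases h0 : d ≤ 1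
    · exact ⟨0, Or.inl ⟨(0 : ℤ).toNat, by omega, by (try split_ifs) <;> omega⟩⟩
    by_cases h1 : d ≤ 2
    · exact ⟨0, Or.inr (Or.inr (Or.inr (Or.inl ⟨(0 : ℤ).toNat, by omega, by (try split_ifs) <;> omega⟩)))⟩
    by_cases h2 : d ≤ -f - 1 + (2 * f + 2 * r + 1)
    · rcases Int.emod_two_eq_zero_or_one ((-1 : ℤ) - (d - (2 * f + 2 * r + 1)) - 1) with h | h
      · exact ⟨-1, Or.inl ⟨(((-1 : ℤ) - (d - (2 * f + 2 * r + 1)) - 1) / 2 : ℤ).toNat, by omega, by (try split_ifs) <;> omega⟩⟩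
      · exact ⟨-1, Or.inr (Or.inl ⟨(((-1 : ℤ) - (d - (2 * f + 2 * r + 1)) - 1) / 2 : ℤ).toNat, by omega, by (try split_ifs) <;> omega⟩)⟩
    by_cases h3 : d ≤ -f + (2 * f + 2 * r + 1)
    · exact ⟨-1, Or.inr (Or.inr (Or.inl (by (try split_ifs) <;> omega)))⟩
    by_cases h4 : d ≤ -3 + (2 * f + 2 * r + 1)
    · rcases Int.emod_two_eq_zero_or_one ((-1 : ℤ) - (d - (2 * f + 2 * r + 1)) - 0) with h | h
      · exact ⟨-1, Or.inl ⟨(((-1 : ℤ) - (d - (2 * f + 2 * r + 1)) - 0) / 2 : ℤ).toNat, by omega, by (try split_ifs) <;> omega⟩⟩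
      · exact ⟨-1, Or.inr (Or.inl ⟨(((-1 : ℤ) - (d - (2 * f + 2 * r + 1)) - 0) / 2 : ℤ).toNat, by omega, by (try split_ifs) <;> omega⟩)⟩
    by_cases h5 : d ≤ -2 + (2 * f + 2 * r + 1)
    · exact ⟨-1, Or.inr (Or.inr (Or.inr (Or.inr (Or.inr (by (try split_ifs) <;> omega)))))⟩
    exact ⟨-1, Or.inr (Or.inl ⟨(0 : ℤ).toNat, by omega, by (try split_ifs) <;> omega⟩)⟩

set_option maxHeartbeats 2000000 in
theorem tmpl_e (f r : ℕ) (hf : 3 ≤ f) (hf2 : f % 2 = 1) (hr : r % 2 = 1) (hr3 : 3 ≤ r) :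
    Nonempty (Tmpl (2 * f) (2 * r + 1)) := by
  refine tmpl_build f r (fun t => if t = 0 then -(f : ℤ) - r + 1 else (t : ℤ) - f - r + 2)
    (fun t => if 2 * t + 1 < f then (f : ℤ) + 1 - t else (f : ℤ) - t)
    (fun t => if 2 * t + 3 ≤ r then (t : ℤ) else t + 2)
    (fun t => if t + 1 < r then (r : ℤ) - 1 - t else -1)
    (0) (-f - r) (0) (by omega) (by omega) (2 * f + (2 * r + 1)) rfl ?_ ?_ ?_ ?_ ?_ ?_ ?_ ?_ ?_ ?_ (by omega) ?_ ?_
  iterate 5 (on_goal 1 => intro t t' h1 h2; beta_reduce; (try split_ifs) <;> omega)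
  iterate 5 (on_goal 1 => intro t h1; beta_reduce; (try split_ifs) <;> omega)
  · beta_reduce; (try split_ifs) <;> first | omega | simp
  · intro d hd1 hd2; beta_reduce; push_cast at hd2 ⊢
    by_cases h0 : d ≤ 1
    · exact ⟨0, Or.inr (Or.inr (Or.inr (Or.inr (Or.inr (by (try split_ifs) <;> omega)))))⟩
    by_cases h1 : d ≤ r - 1
    · rcases Int.emod_two_eq_zero_or_one (r - 1 - d - 0) with h | h
      · exact ⟨0, Or.inr (Or.inr (Or.inr (Or.inl ⟨((r - 1 - d - 0) / 2 : ℤ).toNat, by omega, by (try split_ifs) <;> omega⟩)))⟩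
      · exact ⟨0, Or.inr (Or.inr (Or.inr (Or.inr (Or.inl ⟨((r - 1 - d - 0) / 2 : ℤ).toNat, by omega, by (try split_ifs) <;> omega⟩))))⟩
    by_cases h2 : d ≤ (2 * f + r) - f - 1
    · rcases Int.emod_two_eq_zero_or_one (((2 * f + r) - 1 : ℤ) - d - 1) with h | h
      · exact ⟨0, Or.inl ⟨((((2 * f + r) - 1 : ℤ) - d - 1) / 2 : ℤ).toNat, by omega, by (try split_ifs) <;> omega⟩⟩
      · exact ⟨0, Or.inr (Or.inl ⟨((((2 * f + r) - 1 : ℤ) - d - 1) / 2 : ℤ).toNat, by omega, by (try split_ifs) <;> omega⟩)⟩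
    by_cases h3 : d ≤ (2 * f + r) - f
    · exact ⟨0, Or.inr (Or.inr (Or.inl (by (try split_ifs) <;> omega)))⟩
    by_cases h4 : d ≤ (2 * f + r) - 2
    · rcases Int.emod_two_eq_zero_or_one (((2 * f + r) - 1 : ℤ) - d - 0) with h | h
      · exact ⟨0, Or.inl ⟨((((2 * f + r) - 1 : ℤ) - d - 0) / 2 : ℤ).toNat, by omega, by (try split_ifs) <;> omega⟩⟩
      · exact ⟨0, Or.inr (Or.inl ⟨((((2 * f + r) - 1 : ℤ) - d - 0) / 2 : ℤ).toNat, by omega, by (try split_ifs) <;> omega⟩)⟩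
    by_cases h5 : d ≤ -r - 2 + (2 * f + 2 * r + 1)
    · exact ⟨-1, Or.inr (Or.inr (Or.inr (Or.inl ⟨(r - 1 : ℤ).toNat, by omega, by (try split_ifs) <;> omega⟩)))⟩
    by_cases h6 : d ≤ (2 * f + r)
    · exact ⟨0, Or.inl ⟨(0 : ℤ).toNat, by omega, by (try split_ifs) <;> omega⟩⟩
    rcases Int.emod_two_eq_zero_or_one (r - 3 - (d - (2 * f + 2 * r + 1)) - 0) with h | h
    · exact ⟨-1, Or.inr (Or.inr (Or.inr (Or.inl ⟨((r - 3 - (d - (2 * f + 2 * r + 1)) - 0) / 2 : ℤ).toNat, by omega, by (try split_ifs) <;> omega⟩)))⟩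
    · exact ⟨-1, Or.inr (Or.inr (Or.inr (Or.inr (Or.inl ⟨((r - 3 - (d - (2 * f + 2 * r + 1)) - 0) / 2 : ℤ).toNat, by omega, by (try split_ifs) <;> omega⟩))))⟩

set_option maxHeartbeats 2000000 in
theorem tmpl_f (f r : ℕ) (hf : 3 ≤ f) (hf2 : f % 2 = 1) (hr : r % 2 = 0) (hr4 : 4 ≤ r) :
    Nonempty (Tmpl (2 * f) (2 * r + 1)) := by
  refine tmpl_build f r (fun t => if t = 0 then -(f : ℤ) - r + 1 else (t : ℤ) - f - r + 2)
    (fun t => if 2 * t + 1 < f then (f : ℤ) + 1 - t else (f : ℤ) - t)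
    (fun t => if 2 * t + 4 ≤ r then (t : ℤ) else t + 1)
    (fun t => if 2 * t + 4 ≤ r then (r : ℤ) - 1 - t else if t + 1 < r then (r : ℤ) - 2 - t else -2)
    (0) (-f - r) (0) (by omega) (by omega) (2 * f + (2 * r + 1)) rfl ?_ ?_ ?_ ?_ ?_ ?_ ?_ ?_ ?_ ?_ (by omega) ?_ ?_
  iterate 5 (on_goal 1 => intro t t' h1 h2; beta_reduce; (try split_ifs) <;> omega)
  iterate 5 (on_goal 1 => intro t h1; beta_reduce; (try split_ifs) <;> omega)
  · beta_reduce; (try split_ifs) <;> first | omega | simp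
  · intro d hd1 hd2; beta_reduce; push_cast at hd2 ⊢
    by_cases h0 : d ≤ 1
    · exact ⟨0, Or.inr (Or.inr (Or.inr (Or.inr (Or.inl ⟨((r - 4 : ℤ) / 2 : ℤ).toNat, by omega, by (try split_ifs) <;> omega⟩))))⟩
    by_cases h1 : d ≤ 2
    · exact ⟨0, Or.inr (Or.inr (Or.inr (Or.inr (Or.inr (by (try split_ifs) <;> omega)))))⟩
    by_cases h2 : d ≤ r - 1
    · rcases Int.emod_two_eq_zero_or_one (r - 1 - d - 0) with h | h
      · exact ⟨0, Or.inr (Or.inr (Or.inr (Or.inl ⟨((r - 1 - d - 0) / 2 : ℤ).toNat, by omega, by (try split_ifs) <;> omega⟩)))⟩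
      · exact ⟨0, Or.inr (Or.inr (Or.inr (Or.inr (Or.inl ⟨((r - 1 - d - 0) / 2 : ℤ).toNat, by omega, by (try split_ifs) <;> omega⟩))))⟩
    by_cases h3 : d ≤ (2 * f + r) - f - 1
    · rcases Int.emod_two_eq_zero_or_one (((2 * f + r) - 1 : ℤ) - d - 1) with h | h
      · exact ⟨0, Or.inl ⟨((((2 * f + r) - 1 : ℤ) - d - 1) / 2 : ℤ).toNat, by omega, by (try split_ifs) <;> omega⟩⟩
      · exact ⟨0, Or.inr (Or.inl ⟨((((2 * f + r) - 1 : ℤ) - d - 1) / 2 : ℤ).toNat, by omega, by (try split_ifs) <;> omega⟩)⟩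
    by_cases h4 : d ≤ (2 * f + r) - f
    · exact ⟨0, Or.inr (Or.inr (Or.inl (by (try split_ifs) <;> omega)))⟩
    by_cases h5 : d ≤ (2 * f + r) - 2
    · rcases Int.emod_two_eq_zero_or_one (((2 * f + r) - 1 : ℤ) - d - 0) with h | h
      · exact ⟨0, Or.inl ⟨((((2 * f + r) - 1 : ℤ) - d - 0) / 2 : ℤ).toNat, by omega, by (try split_ifs) <;> omega⟩⟩
      · exact ⟨0, Or.inr (Or.inl ⟨((((2 * f + r) - 1 : ℤ) - d - 0) / 2 : ℤ).toNat, by omega, by (try split_ifs) <;> omega⟩)⟩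
    by_cases h6 : d ≤ -r - 2 + (2 * f + 2 * r + 1)
    · exact ⟨-1, Or.inr (Or.inr (Or.inr (Or.inl ⟨(r - 1 : ℤ).toNat, by omega, by (try split_ifs) <;> omega⟩)))⟩
    by_cases h7 : d ≤ (2 * f + r)
    · exact ⟨0, Or.inl ⟨(0 : ℤ).toNat, by omega, by (try split_ifs) <;> omega⟩⟩
    rcases Int.emod_two_eq_zero_or_one (r - 3 - (d - (2 * f + 2 * r + 1)) - 0) with h | h
    · exact ⟨-1, Or.inr (Or.inr (Or.inr (Or.inl ⟨((r - 3 - (d - (2 * f + 2 * r + 1)) - 0) / 2 : ℤ).toNat, by omega, by (try split_ifs) <;> omega⟩)))⟩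
    · exact ⟨-1, Or.inr (Or.inr (Or.inr (Or.inr (Or.inl ⟨((r - 3 - (d - (2 * f + 2 * r + 1)) - 0) / 2 : ℤ).toNat, by omega, by (try split_ifs) <;> omega⟩))))⟩

set_option maxHeartbeats 2000000 in
theorem tmpl_g (f r : ℕ) (hf : 3 ≤ f) (hf2 : f % 2 = 1) (hr : r = 2) :
    Nonempty (Tmpl (2 * f) (2 * r + 1)) := by
  refine tmpl_build f r (fun t => if t = 0 then -(f : ℤ) - 1 else (t : ℤ) - f)
    (fun t => if 2 * t + 1 < f then (f : ℤ) + 3 - t else (f : ℤ) + 2 - t)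
    (fun t => (t : ℤ))
    (fun t => 3 - (t : ℤ))
    (0) (-f - 1) (0) (by omega) (by omega) (2 * f + (2 * r + 1)) rfl ?_ ?_ ?_ ?_ ?_ ?_ ?_ ?_ ?_ ?_ (by omega) ?_ ?_
  iterate 5 (on_goal 1 => intro t t' h1 h2; beta_reduce; (try split_ifs) <;> omega)
  iterate 5 (on_goal 1 => intro t h1; beta_reduce; (try split_ifs) <;> omega)
  · beta_reduce; (try split_ifs) <;> first | omega | simp
  · intro d hd1 hd2; beta_reduce; push_cast at hd2 ⊢
    by_cases h0 : d ≤ 1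
    · exact ⟨0, Or.inr (Or.inr (Or.inr (Or.inl ⟨(1 : ℤ).toNat, by omega, by (try split_ifs) <;> omega⟩)))⟩
    by_cases h1 : d ≤ 2
    · exact ⟨0, Or.inr (Or.inr (Or.inr (Or.inr (Or.inl ⟨(0 : ℤ).toNat, by omega, by (try split_ifs) <;> omega⟩))))⟩
    by_cases h2 : d ≤ 3
    · exact ⟨0, Or.inr (Or.inr (Or.inr (Or.inl ⟨(0 : ℤ).toNat, by omega, by (try split_ifs) <;> omega⟩)))⟩
    by_cases h3 : d ≤ (2 * f + 4) - f - 1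
    · rcases Int.emod_two_eq_zero_or_one (((2 * f + 4) - 1 : ℤ) - d - 1) with h | h
      · exact ⟨0, Or.inl ⟨((((2 * f + 4) - 1 : ℤ) - d - 1) / 2 : ℤ).toNat, by omega, by (try split_ifs) <;> omega⟩⟩
      · exact ⟨0, Or.inr (Or.inl ⟨((((2 * f + 4) - 1 : ℤ) - d - 1) / 2 : ℤ).toNat, by omega, by (try split_ifs) <;> omega⟩)⟩
    by_cases h4 : d ≤ (2 * f + 4) - f
    · exact ⟨0, Or.inr (Or.inr (Or.inl (by (try split_ifs) <;> omega)))⟩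
    by_cases h5 : d ≤ (2 * f + 4) - 2
    · rcases Int.emod_two_eq_zero_or_one (((2 * f + 4) - 1 : ℤ) - d - 0) with h | h
      · exact ⟨0, Or.inl ⟨((((2 * f + 4) - 1 : ℤ) - d - 0) / 2 : ℤ).toNat, by omega, by (try split_ifs) <;> omega⟩⟩
      · exact ⟨0, Or.inr (Or.inl ⟨((((2 * f + 4) - 1 : ℤ) - d - 0) / 2 : ℤ).toNat, by omega, by (try split_ifs) <;> omega⟩)⟩
    by_cases h6 : d ≤ -2 + (2 * f + 2 * r + 1)
    · exact ⟨-1, Or.inr (Or.inr (Or.inr (Or.inr (Or.inr (by (try split_ifs) <;> omega)))))⟩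
    exact ⟨0, Or.inl ⟨(0 : ℤ).toNat, by omega, by (try split_ifs) <;> omega⟩⟩

end T2fam


section T2digon

theorem digon_bits : ∀ κ2 a b : Fin 2, ∃ κ1 : Fin 2, (cb (κ1, κ2) 1 + 1 = a ∧ cb (κ1, κ2) 2 = b) ∨
        (cb (κ1, κ2) 1 = a ∧ cb (κ1, κ2) 2 + 1 = b) := by decide

theorem tmpl_build1 (r : ℕ) (s : ℤ) (X : Fin 2 → ℤ) (p q : ℕ → ℤ) (L0 L1 L2 : ℤ) (hr : 1 ≤ r)
    (m : ℕ) (hm : m = 2 * 1 + (2 * r + 1))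
    (hp : ∀ t t', t < t' → t' < r → p t < p t') (hq : ∀ t t', t < t' → t' < r → q t' < q t)
    (hxq : ∀ t', t' < r → s ≠ q t') (hy0 : ∀ κ, s + X κ ≠ 0)
    (bx : L1 ≤ s ∧ s < L1 + m) (bq : ∀ t, t < r → L1 ≤ q t ∧ q t < L1 + m)
    (bp : ∀ t, t < r → L0 ≤ p t ∧ p t < L0 + m)
    (by' : ∀ κ, L2 ≤ s + X κ ∧ s + X κ < L2 + m) (hL2 : L2 ≤ 0 ∧ 0 < L2 + m) (hp0 : p 0 = 0)
    (hcov : ∀ d : ℤ, 1 ≤ d → d < m → ∃ w : ℤ,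
      (∃ κ, X κ = d + m * w) ∨
      (∃ t < r, q t - p t = d + m * w) ∨ (∃ t, t + 1 < r ∧ q t - p (t + 1) = d + m * w) ∨
      - q (r - 1) = d + m * w) :
    Nonempty (Tmpl (2 * 1) (2 * r + 1)) := by
  refine ⟨⟨fun κ => tlab (2 * 1) (2 * r + 1) (fun _ => s) (fun _ => s + X κ) p q, fun κ i hi j hj hl hd => ?_, fun κ => ?_,
    fun d hd1 hd2 a b => ?_⟩⟩
  · exact tlab_inj 1 r _ _ p q L0 L1 L2 (by omega) hr m hm (fun t t' h1 h2 => by omega) (fun t t' h1 h2 => by omega) hp hq (fun t t' _ h => hxq t' h) (fun _ _ => hy0 κ) (fun _ _ => bx) bq bp (fun _ _ => by' κ) hL2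
      i (by omega) j (by omega) hl (by rw [hm]; exact hd)
  · have h1 : tlab (2 * 1) (2 * r + 1) (fun _ => s) (fun _ => s + X κ) p q (2 * 1 + (2 * r + 1) - 1) = 0 := by
      unfold tlab; split_ifs <;> first | omega | rfl
    have h2 : tlab (2 * 1) (2 * r + 1) (fun _ => s) (fun _ => s + X κ) p q (2 * 1) = p 0 := by
      unfold tlab; split_ifs <;> first | omega | simp
    rw [h1, h2, hp0]
  · by_contra hno
    have up : ∀ i < 2 * 1 + (2 * r + 1), ∀ w : ℤ,
        lev (2 * 1) (2 * r + 1) (nxt (2 * 1) (2 * r + 1) i) = lev (2 * 1) (2 * r + 1) i + 1 →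
        (∀ κ, tlab (2 * 1) (2 * r + 1) (fun _ => s) (fun _ => s + X κ) p q (nxt (2 * 1) (2 * r + 1) i)
          - tlab (2 * 1) (2 * r + 1) (fun _ => s) (fun _ => s + X κ) p q i = d + m * w) → False := by
      intro i hi w h1 h2
      obtain ⟨κ, k1, k2⟩ := bits_up (lev (2 * 1) (2 * r + 1) i)
        (by have := lev_le (2 * 1) (2 * r + 1) (nxt (2 * 1) (2 * r + 1) i); omega) a b
      exact hno ⟨κ, i, hi, w, Or.inl ⟨h1, by rw [← hm]; exact h2 κ.2, k1, by rw [h1]; exact k2⟩⟩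
    have dn : ∀ i < 2 * 1 + (2 * r + 1), ∀ w : ℤ,
        lev (2 * 1) (2 * r + 1) i = lev (2 * 1) (2 * r + 1) (nxt (2 * 1) (2 * r + 1) i) + 1 →
        (∀ κ, tlab (2 * 1) (2 * r + 1) (fun _ => s) (fun _ => s + X κ) p q i
          - tlab (2 * 1) (2 * r + 1) (fun _ => s) (fun _ => s + X κ) p q (nxt (2 * 1) (2 * r + 1) i) = d + m * w) → False := by
      intro i hi w h1 h2
      obtain ⟨κ, k1, k2⟩ := bits_down (lev (2 * 1) (2 * r + 1) (nxt (2 * 1) (2 * r + 1) i))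
        (by have := lev_le (2 * 1) (2 * r + 1) i; omega) a b
      exact hno ⟨κ, i, hi, w, Or.inr ⟨h1, by rw [← hm]; exact h2 κ.2, k1, by rw [h1]; exact k2⟩⟩
    have tp : ∀ t < r, (∀ κ, tlab (2 * 1) (2 * r + 1) (fun _ => s) (fun _ => s + X κ) p q (2 * 1 + 2 * t) = p t) ∧
        lev (2 * 1) (2 * r + 1) (2 * 1 + 2 * t) = 0 := by
      intro t ht; refine ⟨fun κ => ?_, ?_⟩
      · unfold tlab; rw [if_neg (by omega), if_neg (by omega), if_pos (by omega)]
        congr 1; omega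
      · unfold lev; split_ifs <;> omega
    have tq : ∀ t < r, (∀ κ, tlab (2 * 1) (2 * r + 1) (fun _ => s) (fun _ => s + X κ) p q (2 * 1 + 2 * t + 1) = q t) ∧
        lev (2 * 1) (2 * r + 1) (2 * 1 + 2 * t + 1) = 1 := by
      intro t ht; refine ⟨fun κ => ?_, ?_⟩
      · unfold tlab; rw [if_neg (by omega), if_neg (by omega), if_neg (by omega)]
        congr 1; omega
      · unfold lev; split_ifs <;> omega
    have tl : (∀ κ, tlab (2 * 1) (2 * r + 1) (fun _ => s) (fun _ => s + X κ) p q (2 * 1 + 2 * r) = 0) ∧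
        lev (2 * 1) (2 * r + 1) (2 * 1 + 2 * r) = 2 := by
      refine ⟨fun κ => ?_, ?_⟩
      · unfold tlab; rw [if_neg (by omega), if_pos (by omega)]
      · unfold lev; split_ifs <;> omega
    have nx : ∀ i j, (i + 1 = j ∧ i + 1 ≠ 2 * 1 ∧ i + 1 ≠ 2 * 1 + (2 * r + 1)) ∨
        (i + 1 = 2 * 1 ∧ j = 0) → nxt (2 * 1) (2 * r + 1) i = j := by
      intro i j h; unfold nxt; split_ifs <;> omega
    obtain ⟨w, ⟨κ2, h⟩ | ⟨t, ht, h⟩ | ⟨t, ht, h⟩ | h⟩ :=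
      hcov d hd1 (by omega)
    · have n0 := nx 0 1 (by omega)
      have n1 := nx 1 0 (by omega)
      have l0 : lev (2 * 1) (2 * r + 1) 0 = 1 := rfl
      have l1 : lev (2 * 1) (2 * r + 1) 1 = 2 := rfl
      have e0 : tlab (2 * 1) (2 * r + 1) (fun _ => s) (fun _ => s + X κ2) p q 0 = s := rfl
      have e1 : tlab (2 * 1) (2 * r + 1) (fun _ => s) (fun _ => s + X κ2) p q 1 = s + X κ2 := rfl
      have hb : ∃ κ1 : Fin 2, (cb (κ1, κ2) 1 + 1 = a ∧ cb (κ1, κ2) 2 = b) ∨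
        (cb (κ1, κ2) 1 = a ∧ cb (κ1, κ2) 2 + 1 = b) := by
        exact digon_bits κ2 a b
      obtain ⟨κ1, ⟨k1, k2⟩ | ⟨k1, k2⟩⟩ := hb
      · refine hno ⟨(κ1, κ2), 0, by omega, w, Or.inl ⟨by rw [n0, l0, l1], ?_, ?_, ?_⟩⟩
        · rw [n0, ← hm]; show _ - _ = _; rw [e0, e1]; linarith
        · rw [l0]; exact k1
        · rw [n0, l1]; exact k2
      · refine hno ⟨(κ1, κ2), 1, by omega, w, Or.inr ⟨by rw [n1, l0, l1], ?_, ?_, ?_⟩⟩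
        · rw [n1, ← hm]; show _ - _ = _; rw [e0, e1]; linarith
        · rw [n1, l0]; exact k1
        · rw [l1]; exact k2
    · have hn := nx (2 * 1 + 2 * t) (2 * 1 + 2 * t + 1) (by omega)
      exact up (2 * 1 + 2 * t) (by omega) w (by rw [hn, (tp t ht).2, (tq t ht).2])
        (fun κ => by rw [hn, (tp t ht).1, (tq t ht).1, h])
    · have hn := nx (2 * 1 + 2 * t + 1) (2 * 1 + 2 * (t + 1)) (by omega)
      exact dn (2 * 1 + 2 * t + 1) (by omega) w
        (by rw [hn, (tp (t + 1) ht).2, (tq t (by omega)).2])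
        (fun κ => by rw [hn, (tp (t + 1) ht).1, (tq t (by omega)).1, h])
    · have hn := nx (2 * 1 + 2 * (r - 1) + 1) (2 * 1 + 2 * r) (by omega)
      exact up (2 * 1 + 2 * (r - 1) + 1) (by omega) w
        (by rw [hn, tl.2, (tq (r - 1) (by omega)).2])
        (fun κ => by rw [hn, tl.1, (tq (r - 1) (by omega)).1, ← h]; ring)

set_option maxHeartbeats 2000000 in
theorem tmpl_h (r : ℕ) (hr : r % 2 = 1) :
    Nonempty (Tmpl (2 * 1) (2 * r + 1)) := by
  refine tmpl_build1 r (-r) (fun κ => if κ = 0 then (r + 1 : ℤ) else (r + 2 : ℤ)) (fun t => (t : ℤ))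
    (fun t => if 2 * t + 1 < r ∨ r = 1 then (r : ℤ) - t else (r : ℤ) - 2 - t)
    (0) (-r) (0) (by omega) (2 * 1 + (2 * r + 1)) rfl ?_ ?_ ?_ ?_ (by omega) ?_ ?_ ?_ (by omega) ?_ ?_
  · intro t t' h1 h2; beta_reduce; (try split_ifs) <;> omega
  · intro t t' h1 h2; beta_reduce; (try split_ifs) <;> omega
  · intro t h1; beta_reduce; (try split_ifs) <;> omega
  · intro κ; beta_reduce; (try split_ifs) <;> omega
  · intro t h1; beta_reduce; (try split_ifs) <;> omega
  · intro t h1; beta_reduce; (try split_ifs) <;> omega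
  · intro κ; beta_reduce; (try split_ifs) <;> omega
  · beta_reduce; (try split_ifs) <;> first | omega | simp
  · intro d hd1 hd2; beta_reduce; push_cast at hd2 ⊢
    by_cases hg : r = 1
    · by_cases h0 : d ≤ 1
      · exact ⟨0, Or.inr (Or.inl ⟨(0 : ℤ).toNat, by omega, by (try split_ifs) <;> omega⟩)⟩
      by_cases h1 : d ≤ r + 1
      · exact ⟨0, Or.inl ⟨0, by rw [if_pos rfl]; omega⟩⟩
      by_cases h2 : d ≤ r + 2
      · exact ⟨0, Or.inl ⟨1, by rw [if_neg (by decide)]; omega⟩⟩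
      exact ⟨-1, Or.inr (Or.inr (Or.inr (by (try split_ifs) <;> omega)))⟩
    by_cases h0 : d ≤ 1
    · exact ⟨0, Or.inr (Or.inr (Or.inr (by (try split_ifs) <;> omega)))⟩
    by_cases h1 : d ≤ r
    · rcases Int.emod_two_eq_zero_or_one (r - d - 0) with h | h
      · exact ⟨0, Or.inr (Or.inl ⟨((r - d - 0) / 2 : ℤ).toNat, by omega, by (try split_ifs) <;> omega⟩)⟩
      · exact ⟨0, Or.inr (Or.inr (Or.inl ⟨((r - d - 0) / 2 : ℤ).toNat, by omega, by (try split_ifs) <;> omega⟩))⟩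
    by_cases h2 : d ≤ r + 1
    · exact ⟨0, Or.inl ⟨0, by rw [if_pos rfl]; omega⟩⟩
    by_cases h3 : d ≤ r + 2
    · exact ⟨0, Or.inl ⟨1, by rw [if_neg (by decide)]; omega⟩⟩
    rcases Int.emod_two_eq_zero_or_one (r - 2 - (d - (2 * r + 3)) - 0) with h | h
    · exact ⟨-1, Or.inr (Or.inl ⟨((r - 2 - (d - (2 * r + 3)) - 0) / 2 : ℤ).toNat, by omega, by (try split_ifs) <;> omega⟩)⟩
    · exact ⟨-1, Or.inr (Or.inr (Or.inl ⟨((r - 2 - (d - (2 * r + 3)) - 0) / 2 : ℤ).toNat, by omega, by (try split_ifs) <;> omega⟩))⟩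

set_option maxHeartbeats 2000000 in
theorem tmpl_i (r : ℕ) (hr : r % 2 = 0) (hr4 : 4 ≤ r) :
    Nonempty (Tmpl (2 * 1) (2 * r + 1)) := by
  refine tmpl_build1 r (r) (fun κ => if κ = 0 then (r - 1 : ℤ) else (r : ℤ)) (fun t => if 2 * t + 4 ≤ r then (t : ℤ) else t + 1)
    (fun t => if 2 * t + 4 < r then (r : ℤ) - 2 - t else if 2 * t + 4 = r then (t : ℤ) + 1 else (r : ℤ) - 3 - t)
    (0) (-2) (0) (by omega) (2 * 1 + (2 * r + 1)) rfl ?_ ?_ ?_ ?_ (by omega) ?_ ?_ ?_ (by omega) ?_ ?_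
  · intro t t' h1 h2; beta_reduce; (try split_ifs) <;> omega
  · intro t t' h1 h2; beta_reduce; (try split_ifs) <;> omega
  · intro t h1; beta_reduce; (try split_ifs) <;> omega
  · intro κ; beta_reduce; (try split_ifs) <;> omega
  · intro t h1; beta_reduce; (try split_ifs) <;> omega
  · intro t h1; beta_reduce; (try split_ifs) <;> omega
  · intro κ; beta_reduce; (try split_ifs) <;> omega
  · beta_reduce; (try split_ifs) <;> first | omega | simp
  · intro d hd1 hd2; beta_reduce; push_cast at hd2 ⊢
    by_cases h0 : d ≤ 1
    · exact ⟨0, Or.inr (Or.inl ⟨((r - 4 : ℤ) / 2 : ℤ).toNat, by omega, by (try split_ifs) <;> omega⟩)⟩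
    by_cases h1 : d ≤ 2
    · exact ⟨0, Or.inr (Or.inr (Or.inr (by (try split_ifs) <;> omega)))⟩
    by_cases h2 : d ≤ r - 2
    · rcases Int.emod_two_eq_zero_or_one (r - 2 - d - 0) with h | h
      · exact ⟨0, Or.inr (Or.inl ⟨((r - 2 - d - 0) / 2 : ℤ).toNat, by omega, by (try split_ifs) <;> omega⟩)⟩
      · exact ⟨0, Or.inr (Or.inr (Or.inl ⟨((r - 2 - d - 0) / 2 : ℤ).toNat, by omega, by (try split_ifs) <;> omega⟩))⟩
    by_cases h3 : d ≤ r - 1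
    · exact ⟨0, Or.inl ⟨0, by rw [if_pos rfl]; omega⟩⟩
    by_cases h4 : d ≤ r
    · exact ⟨0, Or.inl ⟨1, by rw [if_neg (by decide)]; omega⟩⟩
    rcases Int.emod_two_eq_zero_or_one (r - 4 - (d - (2 * r + 3)) - 0) with h | h
    · exact ⟨-1, Or.inr (Or.inl ⟨((r - 4 - (d - (2 * r + 3)) - 0) / 2 : ℤ).toNat, by omega, by (try split_ifs) <;> omega⟩)⟩
    · exact ⟨-1, Or.inr (Or.inr (Or.inl ⟨((r - 4 - (d - (2 * r + 3)) - 0) / 2 : ℤ).toNat, by omega, by (try split_ifs) <;> omega⟩))⟩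

set_option maxHeartbeats 2000000 in
theorem tmpl_j (r : ℕ) (hr : r = 2) :
    Nonempty (Tmpl (2 * 1) (2 * r + 1)) := by
  refine tmpl_build1 r (-2) (fun κ => if κ = 0 then (4 : ℤ) else (5 : ℤ)) (fun t => if t = 0 then (0 : ℤ) else 3)
    (fun t => if t = 0 then (2 : ℤ) else -1)
    (0) (-2) (0) (by omega) (2 * 1 + (2 * r + 1)) rfl ?_ ?_ ?_ ?_ (by omega) ?_ ?_ ?_ (by omega) ?_ ?_
  · intro t t' h1 h2; beta_reduce; (try split_ifs) <;> omega
  · intro t t' h1 h2; beta_reduce; (try split_ifs) <;> omega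
  · intro t h1; beta_reduce; (try split_ifs) <;> omega
  · intro κ; beta_reduce; (try split_ifs) <;> omega
  · intro t h1; beta_reduce; (try split_ifs) <;> omega
  · intro t h1; beta_reduce; (try split_ifs) <;> omega
  · intro κ; beta_reduce; (try split_ifs) <;> omega
  · beta_reduce; (try split_ifs) <;> first | omega | simp
  · intro d hd1 hd2; beta_reduce; push_cast at hd2 ⊢
    by_cases h0 : d ≤ 1
    · exact ⟨0, Or.inr (Or.inr (Or.inr (by (try split_ifs) <;> omega)))⟩
    by_cases h1 : d ≤ 2
    · exact ⟨0, Or.inr (Or.inl ⟨(0 : ℤ).toNat, by omega, by (try split_ifs) <;> omega⟩)⟩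
    by_cases h2 : d ≤ -4 + (2 * r + 3)
    · exact ⟨-1, Or.inr (Or.inl ⟨(1 : ℤ).toNat, by omega, by (try split_ifs) <;> omega⟩)⟩
    by_cases h3 : d ≤ 4
    · exact ⟨0, Or.inl ⟨0, by rw [if_pos rfl]; omega⟩⟩
    by_cases h4 : d ≤ 5
    · exact ⟨0, Or.inl ⟨1, by rw [if_neg (by decide)]; omega⟩⟩
    exact ⟨-1, Or.inr (Or.inr (Or.inl ⟨(0 : ℤ).toNat, by omega, by (try split_ifs) <;> omega⟩))⟩

theorem tmpl_all (f r : ℕ) (hf : 1 ≤ f) (hr : 1 ≤ r) : Nonempty (Tmpl (2 * f) (2 * r + 1)) := by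
  by_cases h1 : f = 1
  · subst h1
    by_cases h2 : r % 2 = 1
    · exact tmpl_h r h2
    · by_cases h3 : r = 2
      · exact tmpl_j r h3
      · exact tmpl_i r (by omega) (by omega)
  · by_cases h0 : f % 2 = 0
    · by_cases h2 : r % 2 = 1
      · exact tmpl_a f r (by omega) h0 h2
      · by_cases h3 : r = 2
        · exact tmpl_c f r (by omega) h0 h3
        · exact tmpl_b f r (by omega) h0 (by omega) (by omega)
    · by_cases h2 : r % 2 = 1
      · by_cases h3 : r = 1
        · exact tmpl_d f r (by omega) (by omega) h3
        · exact tmpl_e f r (by omega) (by omega) h2 (by omega)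
      · by_cases h3 : r = 2
        · exact tmpl_g f r (by omega) (by omega) h3
        · exact tmpl_f f r (by omega) (by omega) (by omega) (by omega)

end T2digon


section Runs

/-- A zig-zag run: the labels `s, s + d, s - mτ, s + d + mτ, s - 2mτ, …` with `n` edges whose signed
lengths are `d, -(d + mτ), d + 2mτ, …`.  The numbers `u, v` reduce the two strands of labels into
the window, and `σ, w` say how the lengths are normalised into `[1, N)`;
`a, b` are the parities of the two strands (only used for `m = 2`). -/
structure Run where
  s : ℤ
  d : ℤ
  τ : ℤ
  n : ℕ
  u : ℤ
  v : ℤ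
  σ : ℤ
  w : ℤ
  a : ℤ := 0
  b : ℤ := 0

/-- the `j`-th label of a run -/
def Run.pt (m : ℤ) (R : Run) (j : ℕ) : ℤ :=
  if j % 2 = 0 then R.s - m * R.τ * (j / 2 : ℕ) else R.s + R.d + m * R.τ * (j / 2 : ℕ)

/-- first label of a sequence of runs ending in `b` -/
def hd : List Run → ℤ → ℤ
  | [], b => b
  | R :: _, _ => R.s

/-- each run ends where the next one begins, the last one ends in `b` -/
def chain (m : ℤ) : List Run → ℤ → Prop
  | [], _ => True
  | R :: Rs, b => (R.n % 2 = 0 ∧ hd Rs b = R.s - m * R.τ * ((R.n : ℤ) / 2) ∨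
      R.n % 2 = 1 ∧ hd Rs b = R.s + R.d + m * R.τ * ((R.n : ℤ) / 2)) ∧ chain m Rs b

/-- total number of edges -/
def tot : List Run → ℕ
  | [] => 0
  | R :: Rs => R.n + tot Rs

/-- the concatenated sequence of labels -/
def sq (m : ℤ) : List Run → ℤ → ℕ → ℤ
  | [], b, _ => b
  | R :: Rs, b, t => if t < R.n then R.pt m t else sq m Rs b (t - R.n)

theorem sq_tot (m : ℤ) (Rs : List Run) (b : ℤ) : sq m Rs b (tot Rs) = b := by
  induction Rs with
  | nil => rfl
  | cons R Rs ih =>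
    unfold sq tot
    rw [if_neg (by omega)]
    simpa using ih

theorem sq_zero (m : ℤ) (Rs : List Run) (b : ℤ) (h : chain m Rs b) : sq m Rs b 0 = hd Rs b := by
  induction Rs with
  | nil => rfl
  | cons R Rs ih =>
    unfold sq
    split_ifs with h0
    · simp [Run.pt, hd]
    · have hn : R.n = 0 := by omega
      have h1 := h.1
      simp only [hn] at h1 ⊢
      rw [ih h.2]
      simpa [hd] using h1

theorem pt_end (m : ℤ) (R : Run) (Rs : List Run) (b : ℤ) (h : chain m (R :: Rs) b) :
    hd Rs b = R.pt m R.n := by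
  unfold Run.pt
  rcases h.1 with ⟨h1, h2⟩ | ⟨h1, h2⟩
  · rw [if_pos h1, h2]; push_cast; ring
  · rw [if_neg (by omega), h2]; push_cast; ring

theorem sq_edge (m : ℤ) (Rs : List Run) (b : ℤ) (h : chain m Rs b) (R : Run) (hR : R ∈ Rs)
    (j : ℕ) (hj : j < R.n) :
    ∃ t < tot Rs, sq m Rs b t = R.pt m j ∧ sq m Rs b (t + 1) = R.pt m (j + 1) := by
  induction Rs with
  | nil => simp at hR
  | cons R' Rs ih =>
    rcases List.mem_cons.1 hR with rfl | hR
    · refine ⟨j, by unfold tot; omega, ?_, ?_⟩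
      · unfold sq; rw [if_pos hj]
      · unfold sq
        split_ifs with h1
        · rfl
        · have : j + 1 = R.n := by omega
          rw [this, Nat.sub_self, sq_zero m Rs b h.2, pt_end m R Rs b h]
    · obtain ⟨t, ht, h1, h2⟩ := ih h.2 hR
      refine ⟨R'.n + t, by unfold tot; omega, ?_, ?_⟩
      · unfold sq; rw [if_neg (by omega), Nat.add_sub_cancel_left, h1]
      · unfold sq; rw [if_neg (by omega), Nat.add_assoc, Nat.add_sub_cancel_left, h2]

/-- the label `x` modulo `N` occurs among the labels (arithmetic condition) -/
def phit (m N x : ℤ) : List Run → Prop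
  | [] => False
  | R :: Rs => (R.τ * R.τ = 1 ∧
      ((0 ≤ R.τ * (R.s - (x + N * R.u)) ∧ 2 * (R.τ * (R.s - (x + N * R.u))) < m * R.n ∧
        (R.s - (x + N * R.u)) % m = 0) ∨
      (0 ≤ R.τ * (x + N * R.v - R.s - R.d) ∧
        2 * (R.τ * (x + N * R.v - R.s - R.d)) + m < m * R.n ∧
        (x + N * R.v - R.s - R.d) % m = 0))) ∨ phit m N x Rs

theorem nat_quot (m τ y : ℤ) (hm : 0 < m) (hτ : τ * τ = 1) (h0 : 0 ≤ τ * y) (h1 : y % m = 0) :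
    ∃ i : ℕ, y = m * τ * i := by
  obtain ⟨k, rfl⟩ := Int.dvd_of_emod_eq_zero h1
  have h2 : 0 ≤ τ * k := by
    rw [mul_left_comm] at h0
    exact nonneg_of_mul_nonneg_right h0 hm
  refine ⟨(τ * k).toNat, ?_⟩
  rw [Int.toNat_of_nonneg h2]
  linear_combination (-m * k) * hτ

theorem phit_sound (m N x : ℤ) (hm : 0 < m) (Rs : List Run) (b : ℤ) (hc : chain m Rs b)
    (h : phit m N x Rs) : ∃ t < tot Rs, N ∣ sq m Rs b t - x := by
  have key : ∃ R ∈ Rs, ∃ j < R.n, N ∣ R.pt m j - x := by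
    clear hc
    induction Rs with
    | nil => exact h.elim
    | cons R Rs ih =>
      rcases h with ⟨hτ, ⟨h1, h2, h3⟩ | ⟨h1, h2, h3⟩⟩ | h
      · obtain ⟨i, hi⟩ := nat_quot m R.τ _ hm hτ h1 h3
        refine ⟨R, by simp, 2 * i, ?_, R.u, ?_⟩
        · have e1 : R.τ * (R.s - (x + N * R.u)) = m * i := by
            rw [hi]; linear_combination (m * i) * hτ
          rw [e1] at h2
          have : (2 * (i : ℤ)) < R.n := lt_of_mul_lt_mul_left (by linarith) hm.le
          omega
        · unfold Run.pt; rw [if_pos (by omega), Nat.mul_div_cancel_left _ (by norm_num)]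
          linear_combination hi
      · obtain ⟨i, hi⟩ := nat_quot m R.τ _ hm hτ h1 h3
        refine ⟨R, by simp, 2 * i + 1, ?_, R.v, ?_⟩
        · have e1 : R.τ * (x + N * R.v - R.s - R.d) = m * i := by
            rw [hi]; linear_combination (m * i) * hτ
          rw [e1] at h2
          have : (2 * (i : ℤ) + 1) < R.n := lt_of_mul_lt_mul_left (by linarith) hm.le
          omega
        · unfold Run.pt; rw [if_neg (by omega), show (2 * i + 1) / 2 = i by omega]
          linear_combination -hi
      · obtain ⟨R', hR, h⟩ := ih h
        exact ⟨R', List.mem_cons_of_mem _ hR, h⟩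
  obtain ⟨R, hR, j, hj, hd⟩ := key
  obtain ⟨t, ht, h1, -⟩ := sq_edge m Rs b hc R hR j hj
  exact ⟨t, ht, by rw [h1]; exact hd⟩

/-- the length `δ` occurs modulo `M` up to sign (arithmetic condition) -/
def dh (m M δ : ℤ) (R : Run) : Prop :=
  R.τ * R.τ = 1 ∧ R.σ * R.σ = 1 ∧ 0 ≤ R.τ * (R.σ * (δ - M * R.w) - R.d) ∧
    R.τ * (R.σ * (δ - M * R.w) - R.d) < m * R.n ∧ (R.σ * (δ - M * R.w) - R.d) % m = 0

def dhit (m M δ : ℤ) : List Run → Prop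
  | [] => False
  | R :: Rs => dh m M δ R ∨ dhit m M δ Rs

/-- the length `δ` occurs with a base point of the parity of `p` -/
def ehit (m M δ p : ℤ) : List Run → Prop
  | [] => False
  | R :: Rs => (dh m M δ R ∧ (2 * R.s + (1 - R.σ) * R.d - 2 * p) % 4 = 0) ∨ ehit m M δ p Rs

theorem dhit_mem {m M δ : ℤ} {Rs : List Run} (h : dhit m M δ Rs) : ∃ R ∈ Rs, dh m M δ R := by
  induction Rs with
  | nil => exact h.elim
  | cons R Rs ih =>
    rcases h with h | h
    · exact ⟨R, by simp, h⟩
    · obtain ⟨R', h1, h2⟩ := ih h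
      exact ⟨R', List.mem_cons_of_mem _ h1, h2⟩

theorem ehit_mem {m M δ p : ℤ} {Rs : List Run} (h : ehit m M δ p Rs) :
    ∃ R ∈ Rs, dh m M δ R ∧ (2 * R.s + (1 - R.σ) * R.d - 2 * p) % 4 = 0 := by
  induction Rs with
  | nil => exact h.elim
  | cons R Rs ih =>
    rcases h with h | h
    · exact ⟨R, by simp, h⟩
    · obtain ⟨R', h1, h2⟩ := ih h
      exact ⟨R', List.mem_cons_of_mem _ h1, h2⟩

/-- `X, Y` differ by `δ` modulo `M` -/
def Df (M δ X Y : ℤ) : Prop := ∃ w : ℤ, Y - X = δ + M * w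

theorem dh_pt (m M δ : ℤ) (hm : 0 < m) (R : Run) (h : dh m M δ R) :
    ∃ j < R.n, ∃ i : ℕ, ((R.pt m j = R.s - m * R.τ * i ∧ R.pt m (j + 1) = R.s + R.d + m * R.τ * (j - i)) ∨
        (R.pt m (j + 1) = R.s - m * R.τ * i ∧ R.pt m j = R.s + R.d + m * R.τ * (j - i))) ∧
      R.σ * (R.d + m * R.τ * j) = δ - M * R.w := by
  obtain ⟨hτ, hσ, h1, h2, h3⟩ := h
  obtain ⟨j, hj⟩ := nat_quot m R.τ _ hm hτ h1 h3
  have e1 : R.τ * (R.σ * (δ - M * R.w) - R.d) = m * j := by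
    rw [hj]; linear_combination (m * j) * hτ
  rw [e1] at h2
  have hjn : (j : ℤ) < R.n := lt_of_mul_lt_mul_left h2 hm.le
  refine ⟨j, by omega, (j + 1) / 2, ?_, ?_⟩
  · rcases Nat.mod_two_eq_zero_or_one j with hp | hp
    · left
      unfold Run.pt
      rw [if_pos hp, if_neg (by omega)]
      have a1 : (j + 1) / 2 = j / 2 := by omega
      have a2 : (j : ℤ) = 2 * ((j / 2 : ℕ) : ℤ) := by omega
      rw [a1]
      refine ⟨rfl, ?_⟩
      rw [show (j : ℤ) - ((j / 2 : ℕ) : ℤ) = ((j / 2 : ℕ) : ℤ) by omega]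
    · right
      unfold Run.pt
      rw [if_pos (by omega), if_neg (by omega)]
      refine ⟨rfl, ?_⟩
      rw [show (j : ℤ) - (((j + 1) / 2 : ℕ) : ℤ) = ((j / 2 : ℕ) : ℤ) by omega]
  · have : R.d + m * R.τ * j = R.σ * (δ - M * R.w) := by linarith
    rw [this]; linear_combination (δ - M * R.w) * hσ

theorem sign_cases {σ : ℤ} (h : σ * σ = 1) : σ = 1 ∨ σ = -1 := by
  have : (σ - 1) * (σ + 1) = 0 := by linear_combination h
  rcases mul_eq_zero.1 this with h | h
  · left; omega
  · right; omega

theorem dhit_sound (m M δ : ℤ) (hm : 0 < m) (Rs : List Run) (b : ℤ) (hc : chain m Rs b)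
    (h : dhit m M δ Rs) : ∃ t < tot Rs, Df M δ (sq m Rs b t) (sq m Rs b (t + 1)) ∨
      Df M δ (sq m Rs b (t + 1)) (sq m Rs b t) := by
  obtain ⟨R, hR, hd⟩ := dhit_mem h
  obtain ⟨j, hj, i, h1, h2⟩ := dh_pt m M δ hm R hd
  obtain ⟨t, ht, e1, e2⟩ := sq_edge m Rs b hc R hR j hj
  refine ⟨t, ht, ?_⟩
  rw [e1, e2]
  rcases sign_cases hd.2.1 with hs | hs <;> rw [hs] at h2 <;> rcases h1 with ⟨h3, h4⟩ | ⟨h3, h4⟩ <;>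
    rw [h3, h4]
  · exact Or.inl ⟨-R.w, by linear_combination h2⟩
  · exact Or.inr ⟨-R.w, by linear_combination h2⟩
  · exact Or.inr ⟨-R.w, by linear_combination h2⟩
  · exact Or.inl ⟨-R.w, by linear_combination h2⟩

theorem ehit_sound (M δ p : ℤ) (Rs : List Run) (b : ℤ) (hc : chain 2 Rs b)
    (h : ehit 2 M δ p Rs) : ∃ t < tot Rs,
      (Df M δ (sq 2 Rs b t) (sq 2 Rs b (t + 1)) ∧ (sq 2 Rs b t - p) % 2 = 0) ∨
      (Df M δ (sq 2 Rs b (t + 1)) (sq 2 Rs b t) ∧ (sq 2 Rs b (t + 1) - p) % 2 = 0) := by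
  obtain ⟨R, hR, hd, hp⟩ := ehit_mem h
  obtain ⟨j, hj, i, h1, h2⟩ := dh_pt 2 M δ (by norm_num) R hd
  obtain ⟨t, ht, e1, e2⟩ := sq_edge 2 Rs b hc R hR j hj
  refine ⟨t, ht, ?_⟩
  rw [e1, e2]
  have par : ∀ k : ℤ, (2 * R.τ * k) % 2 = 0 := fun k => by
    rw [mul_assoc]; exact Int.mul_emod_right 2 _
  have p1 := par i
  have p2 := par (j - i)
  rcases sign_cases hd.2.1 with hs | hs <;> rw [hs] at h2 hp <;> rcases h1 with ⟨h3, h4⟩ | ⟨h3, h4⟩ <;>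
    rw [h3, h4]
  · exact Or.inl ⟨⟨-R.w, by linear_combination h2⟩, by omega⟩
  · exact Or.inr ⟨⟨-R.w, by linear_combination h2⟩, by omega⟩
  · exact Or.inr ⟨⟨-R.w, by linear_combination h2⟩, by omega⟩
  · exact Or.inl ⟨⟨-R.w, by linear_combination h2⟩, by omega⟩

/-- the recorded parities are correct -/
def par : List Run → Prop
  | [] => True
  | R :: Rs => (R.s - R.a) % 2 = 0 ∧ (R.s + R.d - R.b) % 2 = 0 ∧ par Rs

/-- `phit` for `m = 2`, with the congruences replaced by recorded parities -/
def phit2 (N x c : ℤ) : List Run → Prop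
  | [] => False
  | R :: Rs => (R.τ * R.τ = 1 ∧ R.a = c ∧
      0 ≤ R.τ * (R.s - (x + N * R.u)) ∧ R.τ * (R.s - (x + N * R.u)) < R.n) ∨
      (R.τ * R.τ = 1 ∧ R.b = c ∧ 0 ≤ R.τ * (x + N * R.v - R.s - R.d) ∧
        R.τ * (x + N * R.v - R.s - R.d) + 1 < R.n) ∨ phit2 N x c Rs

theorem phit2_phit {N x c : ℤ} (hN : N % 2 = 0) (hx : (x - c) % 2 = 0) {Rs : List Run} (hp : par Rs)
    (h : phit2 N x c Rs) : phit 2 N x Rs := by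
  have ev : ∀ k : ℤ, (N * k) % 2 = 0 := fun k => by rw [Int.mul_emod, hN]; simp
  induction Rs with
  | nil => exact h
  | cons R Rs ih =>
    obtain ⟨p1, p2, p3⟩ := hp
    have e1 := ev R.u
    have e2 := ev R.v
    rcases h with ⟨h1, h2, h3, h4⟩ | ⟨h1, h2, h3, h4⟩ | h
    · exact Or.inl ⟨h1, Or.inl ⟨h3, by linarith, by omega⟩⟩
    · exact Or.inl ⟨h1, Or.inr ⟨h3, by linarith, by omega⟩⟩
    · exact Or.inr (ih p3 h)

/-- `ehit` with the congruences replaced by recorded parities; `c` is the parity of `δ` -/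
def ehit2 (M δ p c : ℤ) : List Run → Prop
  | [] => False
  | R :: Rs => (R.τ * R.τ = 1 ∧ R.σ * R.σ = 1 ∧ (R.a + R.b + c) % 2 = 0 ∧
      ((1 + R.σ) * R.a + (1 - R.σ) * R.b - 2 * p) % 4 = 0 ∧
      0 ≤ R.τ * (R.σ * (δ - M * R.w) - R.d) ∧ R.τ * (R.σ * (δ - M * R.w) - R.d) < 2 * R.n) ∨
      ehit2 M δ p c Rs

theorem ehit2_ehit {M δ p c : ℤ} (hM : M % 2 = 0) (hδ : (δ - c) % 2 = 0) {Rs : List Run} (hp : par Rs)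
    (h : ehit2 M δ p c Rs) : ehit 2 M δ p Rs := by
  induction Rs with
  | nil => exact h
  | cons R Rs ih =>
    obtain ⟨p1, p2, p3⟩ := hp
    have e1 : (M * R.w) % 2 = 0 := by rw [Int.mul_emod, hM]; simp
    rcases h with ⟨h1, h2, h3, h4, h5, h6⟩ | h
    · refine Or.inl ⟨⟨h1, h2, h5, h6, ?_⟩, ?_⟩ <;> rcases sign_cases h2 with hs | hs <;>
        rw [hs] at h4 ⊢ <;> omega
    · exact Or.inr (ih p3 h)

end Runs


section T1a

/-- bit of an integer modulo `2N` -/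
def bt (N : ℕ) (X : ℤ) : Fin 2 := if X % (2 * N) < N then 0 else 1

theorem bt_congr (N : ℕ) (X Y w : ℤ) (h : Y = X + 2 * N * w) : bt N Y = bt N X := by
  unfold bt
  rw [h, Int.add_mul_emod_self_left]

theorem fin2_one_add : ((1 : Fin 2) + 1) = 0 := rfl

theorem bt_add (N : ℕ) (hN : 0 < N) (X : ℤ) : bt N (X + N) = bt N X + 1 := by
  unfold bt
  have h1 := Int.emod_nonneg X (show (2 * N : ℤ) ≠ 0 by positivity)
  have h2 := Int.emod_lt_of_pos X (show (0 : ℤ) < 2 * N by positivity)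
  have h3 := Int.emod_add_mul_ediv X (2 * N)
  set R := X % (2 * N)
  have hX : X + N = R + N + 2 * N * (X / (2 * N)) := by linarith
  rw [hX, Int.add_mul_emod_self_left]
  by_cases h : R < N
  · rw [if_pos h, Int.emod_eq_of_lt (by omega) (by omega), if_neg (by omega)]; rfl
  · have : R + N = R - N + 2 * N * 1 := by ring
    rw [if_neg h, this, Int.add_mul_emod_self_left, Int.emod_eq_of_lt (by omega) (by omega),
      if_pos (by omega)]; rfl

theorem bt_surj (N : ℕ) (hN : 0 < N) (x : ZMod N) (b : Fin 2) :
    ∃ X : ℤ, (X : ZMod N) = x ∧ bt N X = b := by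
  obtain ⟨X, rfl⟩ := ZMod.intCast_surjective x
  by_cases h : bt N X = b
  · exact ⟨X, rfl, h⟩
  · refine ⟨X + N, by simp, ?_⟩
    rw [bt_add N hN]
    revert h; generalize bt N X = c; revert b c; decide

/-- a base block containing the extra couple at position `z` -/
structure Starter (e o N : ℕ) where
  I : ℕ → ℤ
  z : ℕ
  hz : z < e + o
  β : Fin 2
  inj : ∀ i < e + o, ∀ j < e + o, i ≠ z → j ≠ z → (N : ℤ) ∣ I i - I j → i = j

def Starter.cfg {e o N : ℕ} (S : Starter e o N) (j : ZMod N) : Cfg (Option (ZMod N)) e o where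
  u i := if i = S.z then none else some ((S.I i + 2 * (j.val : ℤ) : ℤ) : ZMod N)
  t i := if i = S.z then S.β else bt N (S.I i + 2 * (j.val : ℤ))
  inj := by
    intro i hi i' hi' h
    split_ifs at h with h1 h2 h2
    · omega
    · have h3 := Option.some.inj h
      rw [ZMod.intCast_eq_intCast_iff_dvd_sub] at h3
      exact (S.inj i' hi' i hi h2 h1 (by
        have e1 : S.I i' + 2 * (j.val : ℤ) - (S.I i + 2 * (j.val : ℤ)) = S.I i' - S.I i := by ring
        rwa [e1] at h3)).symm

theorem shift_to (N : ℕ) (hN : 0 < N) (A X : ℤ) (h : (A - X) % 2 = 0) :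
    ∃ j : ZMod N, ∃ w : ℤ, A + 2 * (j.val : ℤ) = X + 2 * N * w := by
  haveI : NeZero N := ⟨by omega⟩
  refine ⟨(((X - A) / 2 : ℤ) : ZMod N), ?_⟩
  rw [ZMod.val_intCast]
  have h3 := Int.emod_add_mul_ediv ((X - A) / 2) N
  refine ⟨-((X - A) / 2 / N), ?_⟩
  have : 2 * ((X - A) / 2) = X - A := by omega
  linear_combination this + 2 * h3

theorem cov_T1a {e o N : ℕ} (hN : 0 < N) (hN2 : N % 2 = 0) (he : 2 ≤ e) (ho : 2 ≤ o)
    (S : Fin 2 → Starter e o N)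
    (hcov : ∀ δ p : ℤ, 1 ≤ δ → δ < N → ∃ k, ∃ i < e + o, i ≠ (S k).z ∧ nxt e o i ≠ (S k).z ∧
      ((Df (2 * N) δ ((S k).I i + N) ((S k).I (nxt e o i)) ∧ ((S k).I i - p) % 2 = 0) ∨
       (Df (2 * N) δ ((S k).I (nxt e o i)) ((S k).I i + N) ∧ ((S k).I (nxt e o i) - p) % 2 = 0)))
    (hinf : ∀ p : ℤ, ∀ b : Fin 2, ∃ k,
      (((S k).I (nxt e o (S k).z) - p) % 2 = 0 ∧ (S k).β + 1 = b) ∨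
      (∃ i < e + o, i ≠ (S k).z ∧ nxt e o i = (S k).z ∧ ((S k).I i - p) % 2 = 0 ∧ (S k).β = b)) :
    Cov (Option (ZMod N)) (Fin 2 × ZMod N) e o := by
  refine ⟨fun k => (S k.1).cfg k.2, ?_⟩
  have castw : ∀ X w : ℤ, ((X + 2 * N * w : ℤ) : ZMod N) = X := by intro X w; simp
  have main : ∀ X Y δ w0 : ℤ, 1 ≤ δ → δ < N → Y - X = δ + 2 * N * w0 → ∃ k : Fin 2 × ZMod N,
      ((S k.1).cfg k.2).E (some (X : ZMod N)) (bt N X) (some (Y : ZMod N)) (bt N Y) ∨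
      ((S k.1).cfg k.2).E (some (Y : ZMod N)) (bt N Y) (some (X : ZMod N)) (bt N X) := by
    intro X Y δ w0 h1 h2 h3
    obtain ⟨k, i, hi, hz1, hz2, ⟨⟨w, hw⟩, hp⟩ | ⟨⟨w, hw⟩, hp⟩⟩ := hcov δ X h1 h2
    · obtain ⟨j, w', hj⟩ := shift_to N hN ((S k).I i + N) X (by omega)
      have hA : (S k).I i + 2 * (j.val : ℤ) + N = X + 2 * N * w' := by linarith
      have hB : (S k).I (nxt e o i) + 2 * (j.val : ℤ) = Y + 2 * N * (w' + w - w0) := by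
        linear_combination hj + hw - h3
      refine ⟨(k, j), Or.inl ⟨i, hi, ?_, ?_, ?_, ?_⟩⟩ <;> simp only [Starter.cfg]
      · rw [if_neg hz1, show (S k).I i + 2 * (j.val : ℤ) = X + 2 * N * w' - N by linarith,
          Int.cast_sub, castw]; simp
      · rw [if_neg hz1, ← bt_add N hN, hA]; exact bt_congr N X _ w' rfl
      · rw [if_neg hz2, hB, castw]
      · rw [if_neg hz2, hB]; exact bt_congr N Y _ _ rfl
    · obtain ⟨j, w', hj⟩ := shift_to N hN ((S k).I (nxt e o i)) X hp
      have hB : (S k).I i + 2 * (j.val : ℤ) + N = Y + 2 * N * (w' + w - w0) := by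
        linear_combination hj + hw - h3
      refine ⟨(k, j), Or.inr ⟨i, hi, ?_, ?_, ?_, ?_⟩⟩ <;> simp only [Starter.cfg]
      · rw [if_neg hz1, show (S k).I i + 2 * (j.val : ℤ) = Y + 2 * N * (w' + w - w0) - N by linarith,
          Int.cast_sub, castw]; simp
      · rw [if_neg hz1, ← bt_add N hN, hB]; exact bt_congr N Y _ _ rfl
      · rw [if_neg hz2, hj, castw]
      · rw [if_neg hz2, hj]; exact bt_congr N X _ _ rfl
  have inf : ∀ (b : Fin 2) (X : ℤ), ∃ k : Fin 2 × ZMod N,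
      ((S k.1).cfg k.2).E none b (some (X : ZMod N)) (bt N X) ∨
      ((S k.1).cfg k.2).E (some (X : ZMod N)) (bt N X) none b := by
    intro b X
    obtain ⟨k, ⟨hp, hb⟩ | ⟨i, hi, hz1, hz2, hp, hb⟩⟩ := hinf X b
    · obtain ⟨j, w', hj⟩ := shift_to N hN _ X hp
      have hz := nxt_ne he ho (S k).hz
      refine ⟨(k, j), Or.inl ⟨(S k).z, (S k).hz, ?_, ?_, ?_, ?_⟩⟩ <;> simp only [Starter.cfg]
      · rw [if_pos trivial]
      · rw [if_pos trivial, hb]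
      · rw [if_neg hz, hj, castw]
      · rw [if_neg hz, hj]; exact bt_congr N X _ _ rfl
    · obtain ⟨j, w', hj⟩ := shift_to N hN ((S k).I i + N) X (by omega)
      have hA : (S k).I i + 2 * (j.val : ℤ) + N = X + 2 * N * w' := by linarith
      refine ⟨(k, j), Or.inr ⟨i, hi, ?_, ?_, ?_, ?_⟩⟩ <;> simp only [Starter.cfg]
      · rw [if_neg hz1, show (S k).I i + 2 * (j.val : ℤ) = X + 2 * N * w' - N by linarith,
          Int.cast_sub, castw]; simp
      · rw [if_neg hz1, ← bt_add N hN, hA]; exact bt_congr N X _ w' rfl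
      · rw [if_pos hz2]
      · rw [if_pos hz2, hb]
  intro x y hxy p q
  rcases x with _ | x <;> rcases y with _ | y
  · exact absurd rfl hxy
  · obtain ⟨Y, rfl, rfl⟩ := bt_surj N hN y q
    exact inf p Y
  · obtain ⟨X, rfl, rfl⟩ := bt_surj N hN x p
    obtain ⟨k, h⟩ := inf q X
    exact ⟨k, h.symm⟩
  · obtain ⟨X, rfl, rfl⟩ := bt_surj N hN x p
    obtain ⟨Y, rfl, rfl⟩ := bt_surj N hN y q
    have h1 := Int.emod_nonneg (Y - X) (show (2 * N : ℤ) ≠ 0 by positivity)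
    have h2 := Int.emod_lt_of_pos (Y - X) (show (0 : ℤ) < 2 * N by positivity)
    have h3 := Int.emod_add_mul_ediv (Y - X) (2 * N)
    set D := (Y - X) % (2 * N)
    have hD : ∀ w : ℤ, D ≠ N * w := by
      intro w hw
      apply hxy
      congr 1
      rw [ZMod.intCast_eq_intCast_iff_dvd_sub]
      exact ⟨w + 2 * ((Y - X) / (2 * N)), by linear_combination hw - h3⟩
    have hD0 := hD 0
    have hD1 := hD 1
    by_cases hlt : D < N
    · exact main X Y D ((Y - X) / (2 * N)) (by omega) hlt (by linarith)
    · obtain ⟨k, h⟩ := main Y X (2 * N - D) (-((Y - X) / (2 * N)) - 1) (by omega) (by omega)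
        (by linarith)
      exact ⟨k, h.symm⟩

end T1a


section Blocks

/-- A base block: the couples other than `∞` in the cycle of `∞` form the path described by the
runs `P` ending in `b`; the other cycle is described by the runs `C`, closing up in `c`. -/
structure Blk where
  P : List Run
  b : ℤ
  C : List Run
  c : ℤ
  β : Fin 2

/-- the labels fit together and cover everything modulo `N` -/
def Blk.ok (m : ℤ) (D : Blk) (N : ℕ) (lo cw wb : ℤ) : Prop :=
  chain m D.P D.b ∧ chain m D.C D.c ∧ D.c = hd D.C D.c + N * cw ∧ (cw - tot D.C) % 2 = 0 ∧
    0 < tot D.C ∧ tot D.P + 1 + tot D.C = N ∧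
    ∀ x : ℤ, lo ≤ x → x < lo + N → D.b = x + N * wb ∨ phit m N x D.P ∨ phit m N x D.C

/-- in-end of position `i`, if the path sits at offset `A` and the cycle at offset `B` -/
def Blk.I (m : ℤ) (D : Blk) (N A B i : ℕ) : ℤ :=
  if A ≤ i ∧ i < A + tot D.P + 1 then sq m D.P D.b (i - A) + N * (i - A : ℕ)
  else sq m D.C D.c (i - B) + N * (i - B : ℕ)

theorem Blk.I_path (m : ℤ) (D : Blk) (N A B t : ℕ) (h : t ≤ tot D.P) :
    D.I m N A B (A + t) = sq m D.P D.b t + N * t := by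
  unfold Blk.I
  rw [if_pos (by omega), Nat.add_sub_cancel_left]

theorem Blk.I_cyc (m : ℤ) (D : Blk) (N A B t : ℕ) (h : t < tot D.C)
    (h' : A + tot D.P + 1 ≤ B ∨ B + tot D.C ≤ A) :
    D.I m N A B (B + t) = sq m D.C D.c t + N * t := by
  unfold Blk.I
  rw [if_neg (by omega), Nat.add_sub_cancel_left]

/-- the path and the cycle are placed at `A` and `B` -/
def placed (e o A B a c : ℕ) : Prop := (A = 0 ∧ B = e ∧ a + 1 = e ∧ c = o) ∨ (A = e ∧ B = 0 ∧ a + 1 = o ∧ c = e)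

theorem Blk.starter {m : ℤ} (hm : 0 < m) (D : Blk) {N e o A B : ℕ} {lo cw wb : ℤ} (hN : 0 < N) (hN2 : N % 2 = 0)
    (ho : D.ok m N lo cw wb) (hp : placed e o A B (tot D.P + 1) (tot D.C)) :
    ∃ S : Starter e o N, S.I = D.I m N A B ∧ S.z = A + tot D.P + 1 ∧ S.β = D.β := by
  obtain ⟨h1, h2, h3, h4, h5, h6, h7⟩ := ho
  haveI : NeZero N := ⟨by omega⟩
  have hAB : A + tot D.P + 1 ≤ B ∨ B + tot D.C ≤ A := by unfold placed at hp; omega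
  have heo : e + o = N + 1 := by unfold placed at hp; omega
  refine ⟨⟨D.I m N A B, A + tot D.P + 1, by unfold placed at hp; omega, D.β, ?_⟩, rfl, rfl, rfl⟩
  set T := (Finset.range (e + o)).erase (A + tot D.P + 1) with hT
  have hcard : T.card = N := by
    rw [hT, Finset.card_erase_of_mem, Finset.card_range, heo, Nat.add_sub_cancel]
    rw [Finset.mem_range]; unfold placed at hp; omega
  have himg : T.image (fun i => ((D.I m N A B i : ℤ) : ZMod N)) = Finset.univ := by
    rw [Finset.eq_univ_iff_forall]
    intro y
    obtain ⟨x, hx1, hx2, rfl⟩ : ∃ x : ℤ, lo ≤ x ∧ x < lo + N ∧ (x : ZMod N) = y := by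
      obtain ⟨Y, rfl⟩ := ZMod.intCast_surjective y
      refine ⟨lo + (Y - lo) % N, ?_, ?_, by push_cast; rw [← Int.cast_sub]; simp⟩
      · have := Int.emod_nonneg (Y - lo) (show (N : ℤ) ≠ 0 by omega); omega
      · have := Int.emod_lt_of_pos (Y - lo) (show (0 : ℤ) < N by omega); omega
    rw [Finset.mem_image]
    have fin : ∀ (L x : ℤ) (t : ℕ), (N : ℤ) ∣ L - x → ((L + N * t : ℤ) : ZMod N) = x := by
      intro L x t h
      rw [← ZMod.intCast_eq_intCast_iff_dvd_sub] at h
      push_cast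
      rw [h]; simp
    rcases h7 x hx1 hx2 with h | h | h
    · refine ⟨A + tot D.P, ?_, ?_⟩
      · rw [hT, Finset.mem_erase, Finset.mem_range]; unfold placed at hp; omega
      · rw [Blk.I_path _ _ _ _ _ _ le_rfl, sq_tot]
        exact fin _ _ _ ⟨wb, by rw [h]; ring⟩
    · obtain ⟨t, ht, hd⟩ := phit_sound m N x hm _ _ h1 h
      refine ⟨A + t, ?_, ?_⟩
      · rw [hT, Finset.mem_erase, Finset.mem_range]; unfold placed at hp; omega
      · rw [Blk.I_path _ _ _ _ _ _ ht.le]; exact fin _ _ _ hd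
    · obtain ⟨t, ht, hd⟩ := phit_sound m N x hm _ _ h2 h
      refine ⟨B + t, ?_, ?_⟩
      · rw [hT, Finset.mem_erase, Finset.mem_range]; unfold placed at hp; omega
      · rw [Blk.I_cyc _ _ _ _ _ _ ht hAB]; exact fin _ _ _ hd
  have hinj := Finset.card_image_iff.1 (by rw [himg, hcard, Finset.card_univ, ZMod.card])
  intro i hi j hj hiz hjz hd
  refine hinj ?_ ?_ ?_
  · rw [Finset.mem_coe, hT, Finset.mem_erase, Finset.mem_range]; exact ⟨hiz, hi⟩
  · rw [Finset.mem_coe, hT, Finset.mem_erase, Finset.mem_range]; exact ⟨hjz, hj⟩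
  · show ((D.I m N A B i : ℤ) : ZMod N) = (D.I m N A B j : ℤ)
    rw [eq_comm, ZMod.intCast_eq_intCast_iff_dvd_sub]; exact hd

/-- the consecutive labels of a block are the labels around the cycles -/
theorem Blk.edge {m : ℤ} (D : Blk) {N e o A B : ℕ} {lo cw wb : ℤ} (hN2 : N % 2 = 0)
    (ho : D.ok m N lo cw wb) (hp : placed e o A B (tot D.P + 1) (tot D.C))
    (X Y : ℤ) (hX : (∃ t < tot D.P, sq m D.P D.b t = X ∧ sq m D.P D.b (t + 1) = Y) ∨
      (∃ t < tot D.C, sq m D.C D.c t = X ∧ sq m D.C D.c (t + 1) = Y)) :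
    ∃ i < e + o, i ≠ A + tot D.P + 1 ∧ nxt e o i ≠ A + tot D.P + 1 ∧ ∃ w w' v : ℤ,
      D.I m N A B i = X + 2 * w ∧ D.I m N A B (nxt e o i) - (D.I m N A B i + N) = Y - X + 2 * N * v ∧
      D.I m N A B (nxt e o i) = Y + 2 * w' := by
  obtain ⟨h1, h2, h3, h4, h5, h6, h7⟩ := ho
  have hAB : A + tot D.P + 1 ≤ B ∨ B + tot D.C ≤ A := by unfold placed at hp; omega
  obtain ⟨h, hN'⟩ : ∃ h : ℤ, (N : ℤ) = 2 * h := ⟨N / 2, by omega⟩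
  rcases hX with ⟨t, ht, rfl, rfl⟩ | ⟨t, ht, rfl, rfl⟩
  · have hn : nxt e o (A + t) = A + (t + 1) := by
      unfold nxt; unfold placed at hp; split_ifs <;> omega
    refine ⟨A + t, ?_, ?_, ?_, h * t, h * (t + 1), 0, ?_, ?_, ?_⟩
    · unfold placed at hp; omega
    · unfold placed at hp; omega
    · unfold placed at hp; omega
    · rw [Blk.I_path _ _ _ _ _ _ ht.le]; linear_combination (t : ℤ) * hN'
    · rw [hn, Blk.I_path _ _ _ _ _ _ ht.le, Blk.I_path _ _ _ _ _ _ ht]; push_cast; ring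
    · rw [hn, Blk.I_path _ _ _ _ _ _ ht]; push_cast; linear_combination (t + 1 : ℤ) * hN'
  · by_cases hl : t + 1 = tot D.C
    · have hn : nxt e o (B + t) = B + 0 := by
        unfold nxt; unfold placed at hp; split_ifs <;> omega
      have hc : sq m D.C D.c (t + 1) = sq m D.C D.c 0 + N * cw := by
        rw [hl, sq_tot, sq_zero m _ _ h2]; exact h3
      obtain ⟨v, hv⟩ : ∃ v : ℤ, cw = t + 1 + 2 * v := ⟨(cw - (t + 1)) / 2, by omega⟩
      refine ⟨B + t, ?_, ?_, ?_, h * t, h * (-(t + 1) - 2 * v), -(t + 1) - v, ?_, ?_, ?_⟩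
      · unfold placed at hp; omega
      · unfold placed at hp; omega
      · unfold placed at hp; omega
      · rw [Blk.I_cyc _ _ _ _ _ _ ht hAB]; linear_combination (t : ℤ) * hN'
      · rw [hn, Blk.I_cyc _ _ _ _ _ _ ht hAB, Blk.I_cyc _ _ _ _ _ _ h5 hAB, hc, hv]; push_cast; ring
      · rw [hn, Blk.I_cyc _ _ _ _ _ _ h5 hAB, hc, hv]; push_cast; linear_combination (-(t + 1) - 2 * v : ℤ) * hN'
    · have hn : nxt e o (B + t) = B + (t + 1) := by
        unfold nxt; unfold placed at hp; split_ifs <;> omega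
      have ht' : t + 1 < tot D.C := by omega
      refine ⟨B + t, ?_, ?_, ?_, h * t, h * (t + 1), 0, ?_, ?_, ?_⟩
      · unfold placed at hp; omega
      · unfold placed at hp; omega
      · unfold placed at hp; omega
      · rw [Blk.I_cyc _ _ _ _ _ _ ht hAB]; linear_combination (t : ℤ) * hN'
      · rw [hn, Blk.I_cyc _ _ _ _ _ _ ht hAB, Blk.I_cyc _ _ _ _ _ _ ht' hAB]; push_cast; ring
      · rw [hn, Blk.I_cyc _ _ _ _ _ _ ht' hAB]; push_cast; linear_combination (t + 1 : ℤ) * hN'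

theorem Blk.ehit_edge (D : Blk) {N e o A B : ℕ} {lo cw wb : ℤ} (hN2 : N % 2 = 0)
    (ho : D.ok 2 N lo cw wb) (hp : placed e o A B (tot D.P + 1) (tot D.C)) (δ p : ℤ)
    (h : ehit 2 (2 * N) δ p D.P ∨ ehit 2 (2 * N) δ p D.C) :
    ∃ i < e + o, i ≠ A + tot D.P + 1 ∧ nxt e o i ≠ A + tot D.P + 1 ∧
      ((Df (2 * N) δ (D.I 2 N A B i + N) (D.I 2 N A B (nxt e o i)) ∧ (D.I 2 N A B i - p) % 2 = 0) ∨
      (Df (2 * N) δ (D.I 2 N A B (nxt e o i)) (D.I 2 N A B i + N) ∧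
        (D.I 2 N A B (nxt e o i) - p) % 2 = 0)) := by
  obtain ⟨X, Y, h1, h2⟩ : ∃ X Y : ℤ, ((∃ t < tot D.P, sq 2 D.P D.b t = X ∧ sq 2 D.P D.b (t + 1) = Y) ∨
      (∃ t < tot D.C, sq 2 D.C D.c t = X ∧ sq 2 D.C D.c (t + 1) = Y)) ∧
      ((Df (2 * N) δ X Y ∧ (X - p) % 2 = 0) ∨ (Df (2 * N) δ Y X ∧ (Y - p) % 2 = 0)) := by
    rcases h with h | h
    · obtain ⟨t, ht, h⟩ := ehit_sound _ _ _ _ _ ho.1 h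
      exact ⟨_, _, Or.inl ⟨t, ht, rfl, rfl⟩, h⟩
    · obtain ⟨t, ht, h⟩ := ehit_sound _ _ _ _ _ ho.2.1 h
      exact ⟨_, _, Or.inr ⟨t, ht, rfl, rfl⟩, h⟩
  obtain ⟨i, hi, hz, hz', w, w', v, e1, e2, e3⟩ := D.edge hN2 ho hp X Y h1
  refine ⟨i, hi, hz, hz', ?_⟩
  rcases h2 with ⟨⟨u, hu⟩, hq⟩ | ⟨⟨u, hu⟩, hq⟩
  · exact Or.inl ⟨⟨u + v, by linear_combination e2 + hu⟩, by omega⟩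
  · exact Or.inr ⟨⟨u - v, by linear_combination hu - e2⟩, by omega⟩

theorem Blk.dhit_edge {m : ℤ} (hm : 0 < m) (D : Blk) {N e o A B : ℕ} {lo cw wb : ℤ} (hN2 : N % 2 = 0)
    (ho : D.ok m N lo cw wb) (hp : placed e o A B (tot D.P + 1) (tot D.C)) (δ : ℤ)
    (h : dhit m (2 * N) δ D.P ∨ dhit m (2 * N) δ D.C) :
    ∃ i < e + o, i ≠ A + tot D.P + 1 ∧ nxt e o i ≠ A + tot D.P + 1 ∧
      (Df (2 * N) δ (D.I m N A B i + N) (D.I m N A B (nxt e o i)) ∨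
      Df (2 * N) δ (D.I m N A B (nxt e o i)) (D.I m N A B i + N)) := by
  obtain ⟨X, Y, h1, h2⟩ : ∃ X Y : ℤ, ((∃ t < tot D.P, sq m D.P D.b t = X ∧ sq m D.P D.b (t + 1) = Y) ∨
      (∃ t < tot D.C, sq m D.C D.c t = X ∧ sq m D.C D.c (t + 1) = Y)) ∧
      (Df (2 * N) δ X Y ∨ Df (2 * N) δ Y X) := by
    rcases h with h | h
    · obtain ⟨t, ht, h⟩ := dhit_sound _ _ _ hm _ _ ho.1 h
      exact ⟨_, _, Or.inl ⟨t, ht, rfl, rfl⟩, h⟩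
    · obtain ⟨t, ht, h⟩ := dhit_sound _ _ _ hm _ _ ho.2.1 h
      exact ⟨_, _, Or.inr ⟨t, ht, rfl, rfl⟩, h⟩
  obtain ⟨i, hi, hz, hz', w, w', v, e1, e2, e3⟩ := D.edge hN2 ho hp X Y h1
  refine ⟨i, hi, hz, hz', ?_⟩
  rcases h2 with ⟨u, hu⟩ | ⟨u, hu⟩
  · exact Or.inl ⟨u + v, by linear_combination e2 + hu⟩
  · exact Or.inr ⟨u - v, by linear_combination hu - e2⟩

/-- the neighbours of `∞` are the ends of the path -/
theorem Blk.inf {m : ℤ} (D : Blk) {N e o A B : ℕ} {lo cw wb : ℤ} (hN2 : N % 2 = 0)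
    (ho : D.ok m N lo cw wb) (hp : placed e o A B (tot D.P + 1) (tot D.C)) :
    D.I m N A B (nxt e o (A + tot D.P + 1)) = hd D.P D.b ∧
    ∃ i < e + o, i ≠ A + tot D.P + 1 ∧ nxt e o i = A + tot D.P + 1 ∧
      (D.I m N A B i - D.b) % 2 = 0 := by
  constructor
  · have hn : nxt e o (A + tot D.P + 1) = A + 0 := by
      unfold nxt; unfold placed at hp; split_ifs <;> omega
    rw [hn, Blk.I_path _ _ _ _ _ _ (Nat.zero_le _), sq_zero m _ _ ho.1]; simp
  · refine ⟨A + tot D.P, by unfold placed at hp; omega, by omega, ?_, ?_⟩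
    · unfold nxt; unfold placed at hp; split_ifs <;> omega
    · obtain ⟨h, hN'⟩ : ∃ h : ℤ, (N : ℤ) = 2 * h := ⟨N / 2, by omega⟩
      rw [Blk.I_path _ _ _ _ _ _ le_rfl, sq_tot, hN', add_sub_cancel_left, mul_assoc]
      exact Int.mul_emod_right 2 _

/-- the position of `∞` is encoded by a boolean: in the even or in the odd cycle -/
theorem cov_pair {e o N : ℕ} (hN : 0 < N) (hN2 : N % 2 = 0) (he : 2 ≤ e) (ho : 2 ≤ o) (D : Fin 2 → Blk)
    (lo cw wb : Fin 2 → ℤ) (A B : Fin 2 → ℕ)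
    (hok : ∀ k, (D k).ok 2 N (lo k) (cw k) (wb k))
    (hp : ∀ k, placed e o (A k) (B k) (tot (D k).P + 1) (tot (D k).C))
    (hcov : ∀ δ p : ℤ, 1 ≤ δ → δ < N → (p = 0 ∨ p = 1) →
      ∃ k, ehit 2 (2 * N) δ p (D k).P ∨ ehit 2 (2 * N) δ p (D k).C)
    (hinf : ∀ p : ℤ, (p = 0 ∨ p = 1) → ∀ b : Fin 2, ∃ k,
      ((hd (D k).P (D k).b - p) % 2 = 0 ∧ (D k).β + 1 = b) ∨ (((D k).b - p) % 2 = 0 ∧ (D k).β = b)) :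
    Cov (Option (ZMod N)) (Fin 2 × ZMod N) e o := by
  choose S hI hz hβ using fun k => (D k).starter (by norm_num) hN hN2 (hok k) (hp k)
  refine cov_T1a hN hN2 he ho S ?_ ?_
  · intro δ p h1 h2
    obtain ⟨k, hk⟩ := hcov δ (p % 2) h1 h2 (by omega)
    obtain ⟨i, hi, z1, z2, h⟩ := (D k).ehit_edge hN2 (hok k) (hp k) δ (p % 2) hk
    refine ⟨k, i, hi, by rw [hz]; exact z1, by rw [hz]; exact z2, ?_⟩
    rw [hI]
    exact h.imp (fun h => ⟨h.1, by have := h.2; omega⟩) (fun h => ⟨h.1, by have := h.2; omega⟩)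
  · intro p b
    obtain ⟨k, hk⟩ := hinf (p % 2) (by omega) b
    obtain ⟨h1, i, hi, h2, h3, h4⟩ := (D k).inf hN2 (hok k) (hp k)
    refine ⟨k, ?_⟩
    rw [hI, hz, hβ, h1]
    rcases hk with ⟨hk, hb⟩ | ⟨hk, hb⟩
    · exact Or.inl ⟨by omega, hb⟩
    · exact Or.inr ⟨i, hi, h2, h3, by omega, hb⟩

/-- `Blk.ok` in the form used for pairs of blocks -/
def Blk.ok2 (D : Blk) (N : ℕ) (lo cw wb : ℤ) : Prop :=
  chain 2 D.P D.b ∧ chain 2 D.C D.c ∧ D.c = hd D.C D.c + N * cw ∧ (cw - tot D.C) % 2 = 0 ∧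
    0 < tot D.C ∧ tot D.P + 1 + tot D.C = N ∧ par D.P ∧ par D.C ∧
    ∀ x : ℤ, lo ≤ x → x < lo + N →
      (x % 2 = 0 → D.b = x + N * wb ∨ phit2 N x 0 D.P ∨ phit2 N x 0 D.C) ∧
      (x % 2 = 1 → D.b = x + N * wb ∨ phit2 N x 1 D.P ∨ phit2 N x 1 D.C)

theorem Blk.ok_of_ok2 {D : Blk} {N : ℕ} (hN : N % 2 = 0) {lo cw wb : ℤ} (h : D.ok2 N lo cw wb) :
    D.ok 2 N lo cw wb := by
  obtain ⟨h1, h2, h3, h4, h5, h6, h7, h8, h9⟩ := h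
  refine ⟨h1, h2, h3, h4, h5, h6, fun x hx hx' => ?_⟩
  rcases Int.emod_two_eq_zero_or_one x with hp | hp
  · exact ((h9 x hx hx').1 hp).imp_right
      (Or.imp (phit2_phit (by omega) (by omega) h7) (phit2_phit (by omega) (by omega) h8))
  · exact ((h9 x hx hx').2 hp).imp_right
      (Or.imp (phit2_phit (by omega) (by omega) h7) (phit2_phit (by omega) (by omega) h8))

/-- length `δ` of parity `c` with base parity `p` occurs in one of two blocks -/
def cover2 (N : ℕ) (F G : Blk) (δ p c : ℤ) : Prop :=
  ehit2 (2 * N) δ p c F.P ∨ ehit2 (2 * N) δ p c F.C ∨ ehit2 (2 * N) δ p c G.P ∨ ehit2 (2 * N) δ p c G.C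

/-- the version for two blocks which is used below -/
theorem cov_two {e o N : ℕ} (hN : 0 < N) (hN2 : N % 2 = 0) (he : 2 ≤ e) (ho : 2 ≤ o) (F G : Blk)
    (lo cF wF cG wG : ℤ) (A B A' B' : ℕ)
    (hβ : (F.β = G.β ∧ (hd F.P F.b - hd G.P G.b) % 2 = 1 ∧ (F.b - G.b) % 2 = 1) ∨
      (F.β ≠ G.β ∧ (hd F.P F.b - G.b) % 2 = 1 ∧ (F.b - hd G.P G.b) % 2 = 1))
    (hF' : F.ok2 N lo cF wF) (hG' : G.ok2 N lo cG wG)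
    (pF : placed e o A B (tot F.P + 1) (tot F.C)) (pG : placed e o A' B' (tot G.P + 1) (tot G.C))
    (hcov0 : ∀ δ : ℤ, 1 ≤ δ → δ < N → δ % 2 = 0 → cover2 N F G δ 0 0 ∧ cover2 N F G δ 1 0)
    (hcov1 : ∀ δ : ℤ, 1 ≤ δ → δ < N → δ % 2 = 1 → cover2 N F G δ 0 1 ∧ cover2 N F G δ 1 1) :
    Cov (Option (ZMod N)) (Fin 2 × ZMod N) e o := by
  have hF := Blk.ok_of_ok2 hN2 hF'
  have hG := Blk.ok_of_ok2 hN2 hG'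
  have tr : ∀ δ p c : ℤ, (δ - c) % 2 = 0 → cover2 N F G δ p c →
      (ehit 2 (2 * N) δ p F.P ∨ ehit 2 (2 * N) δ p F.C) ∨
      (ehit 2 (2 * N) δ p G.P ∨ ehit 2 (2 * N) δ p G.C) := by
    intro δ p c hδ h
    obtain ⟨-, -, -, -, -, -, a1, a2, -⟩ := hF'
    obtain ⟨-, -, -, -, -, -, a3, a4, -⟩ := hG'
    have hM : (2 * (N : ℤ)) % 2 = 0 := by omega
    rcases h with h | h | h | h
    · exact Or.inl (Or.inl (ehit2_ehit hM hδ a1 h))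
    · exact Or.inl (Or.inr (ehit2_ehit hM hδ a2 h))
    · exact Or.inr (Or.inl (ehit2_ehit hM hδ a3 h))
    · exact Or.inr (Or.inr (ehit2_ehit hM hδ a4 h))
  refine cov_pair hN hN2 he ho ![F, G] ![lo, lo] ![cF, cG] ![wF, wG] ![A, A'] ![B, B']
    (Fin.forall_fin_two.2 ⟨hF, hG⟩) (Fin.forall_fin_two.2 ⟨pF, pG⟩) ?_ ?_
  · intro δ p h1 h2 h3
    refine Fin.exists_fin_two.2 ?_
    rcases Int.emod_two_eq_zero_or_one δ with h0 | h0 <;> rcases h3 with rfl | rfl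
    · exact tr δ 0 0 (by omega) (hcov0 δ h1 h2 h0).1
    · exact tr δ 1 0 (by omega) (hcov0 δ h1 h2 h0).2
    · exact tr δ 0 1 (by omega) (hcov1 δ h1 h2 h0).1
    · exact tr δ 1 1 (by omega) (hcov1 δ h1 h2 h0).2
  · intro p hp b
    rw [Fin.exists_fin_two]
    simp only [Matrix.cons_val_zero, Matrix.cons_val_one]
    by_cases h0 : F.β = b
    · by_cases h1 : (F.b - p) % 2 = 0
      · exact Or.inl (Or.inr ⟨h1, h0⟩)
      · rcases hβ with ⟨h2, h3, h4⟩ | ⟨h2, h3, h4⟩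
        · exact Or.inr (Or.inr ⟨by omega, h2 ▸ h0⟩)
        · refine Or.inr (Or.inl ⟨by omega, ?_⟩)
          subst h0; revert h2; generalize F.β = x; generalize G.β = y; revert x y; decide
    · have h0' : F.β + 1 = b := by
        revert h0; generalize F.β = x; revert b x; decide
      by_cases h1 : (hd F.P F.b - p) % 2 = 0
      · exact Or.inl (Or.inl ⟨h1, h0'⟩)
      · rcases hβ with ⟨h2, h3, h4⟩ | ⟨h2, h3, h4⟩
        · exact Or.inr (Or.inl ⟨by omega, h2 ▸ h0'⟩)
        · refine Or.inr (Or.inr ⟨by omega, ?_⟩)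
          revert h2 h0; generalize F.β = x; generalize G.β = y; clear h0'; revert b x y; decide

/-- a single block together with its translate by one -/
theorem cov_single {e o N : ℕ} {m : ℤ} (hm : 0 < m) (hN : 0 < N) (hN2 : N % 2 = 0) (he : 2 ≤ e) (ho : 2 ≤ o) (D : Blk)
    (lo cw wb : ℤ) (A B : ℕ) (hok : D.ok m N lo cw wb)
    (hp : placed e o A B (tot D.P + 1) (tot D.C))
    (hcov : ∀ δ : ℤ, 1 ≤ δ → δ < N → dhit m (2 * N) δ D.P ∨ dhit m (2 * N) δ D.C) :
    Cov (Option (ZMod N)) (Fin 2 × ZMod N) e o := by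
  obtain ⟨S, hI, hz, hβ⟩ := D.starter hm hN hN2 hok hp
  refine cov_T1a hN hN2 he ho (fun k => ⟨fun i => S.I i + k.val, S.z, S.hz, S.β, ?_⟩) ?_ ?_
  · intro i hi j hj h1 h2 h
    rw [add_sub_add_right_eq_sub] at h
    exact S.inj i hi j hj h1 h2 h
  · intro δ p h1 h2
    obtain ⟨i, hi, z1, z2, h⟩ := D.dhit_edge hm hN2 hok hp δ (hcov δ h1 h2)
    simp only
    rw [hI, hz]
    rcases h with ⟨w, hw⟩ | ⟨w, hw⟩
    · rcases Int.emod_two_eq_zero_or_one (D.I m N A B i - p) with h0 | h0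
      · exact ⟨0, i, hi, z1, z2, Or.inl ⟨⟨w, by linear_combination hw⟩, by simpa using h0⟩⟩
      · exact ⟨1, i, hi, z1, z2, Or.inl ⟨⟨w, by linear_combination hw⟩, by simp; omega⟩⟩
    · rcases Int.emod_two_eq_zero_or_one (D.I m N A B (nxt e o i) - p) with h0 | h0
      · exact ⟨0, i, hi, z1, z2, Or.inr ⟨⟨w, by linear_combination hw⟩, by simpa using h0⟩⟩
      · exact ⟨1, i, hi, z1, z2, Or.inr ⟨⟨w, by linear_combination hw⟩, by simp; omega⟩⟩
  · intro p b
    obtain ⟨h1, i, hi, h2, h3, h4⟩ := D.inf hN2 hok hp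
    simp only
    rw [hI, hz, h1]
    by_cases hb : S.β = b
    · rcases Int.emod_two_eq_zero_or_one (D.b - p) with h0 | h0
      · exact ⟨0, Or.inr ⟨i, hi, h2, h3, by simp; omega, hb⟩⟩
      · exact ⟨1, Or.inr ⟨i, hi, h2, h3, by simp; omega, hb⟩⟩
    · have hb' : S.β + 1 = b := by
        revert hb; generalize S.β = c; revert b c; decide
      rcases Int.emod_two_eq_zero_or_one (hd D.P D.b - p) with h0 | h0
      · exact ⟨0, Or.inl ⟨by simp; omega, hb'⟩⟩
      · exact ⟨1, Or.inl ⟨by simp; omega, hb'⟩⟩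

end Blocks

set_option maxHeartbeats 1000000 in
theorem gen_rq00 (x y : ℕ) :
    Cov (Option (ZMod (8 * x + 4 * y + 14))) (Fin 2 × ZMod (8 * x + 4 * y + 14)) (4 * x + 6) (4 * x + 4 * y + 9) := by
  refine cov_two (by omega) (by omega) (by omega) (by omega)
    ⟨[⟨8 * x + 4 * y + 14, -8 * x - 4 * y - 12, 1, 1, 1, 0, -1, 0, 0, 0⟩,
    ⟨2, -4, -1, 2 * x, 0, 0, -1, 0, 0, 0⟩,
    ⟨2 * x + 2, -4 * x - 5, 1, 1, 0, 0, -1, 0, 0, 1⟩,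
    ⟨-2 * x - 3, 4 * x + 8, 1, 2 * y, 0, 0, 1, 0, 1, 1⟩,
    ⟨-2 * x - 2 * y - 3, 4 * x + 4 * y + 7, 1, 1, 0, 0, 1, 0, 1, 0⟩,
    ⟨2 * x + 2 * y + 4, -4 * x - 4 * y - 6, 1, 2 * y + 1, 0, 0, -1, 0, 0, 0⟩,
    ⟨-2 * x - 2, 4 * x + 5, 1, 1, 0, 0, 1, 0, 0, 1⟩,
    ⟨2 * x + 3, -4 * x - 4, 1, 2 * x + 2, 0, 0, -1, 0, 1, 1⟩], 1,
    [⟨-2 * x - 2 * y - 4, 4 * x + 4 * y + 10, 1, 2 * x + 1, 0, 0, 1, 0, 0, 0⟩,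
    ⟨4 * x + 2 * y + 6, 2, 1, 1, 0, 0, 1, 0, 0, 0⟩,
    ⟨4 * x + 2 * y + 8, -1, 1, 1, 1, 0, -1, 0, 0, 1⟩,
    ⟨4 * x + 2 * y + 7, -8 * x - 4 * y - 12, 1, 2 * x + 2, 0, 0, -1, 0, 1, 1⟩,
    ⟨2 * x + 2 * y + 5, -4 * x - 4 * y - 9, 1, 1, 0, 0, -1, 0, 1, 0⟩], -2 * x - 2 * y - 4, 0⟩
    ⟨[⟨0, 1, 1, 2 * x + 2, 0, 0, 1, 0, 0, 1⟩,
    ⟨-2 * x - 2, 4 * x + 4, 1, 1, 0, 0, 1, 0, 0, 0⟩,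
    ⟨2 * x + 2, -4 * x - 3, 1, 2 * x + 1, 0, 0, -1, 0, 0, 1⟩], -1,
    [⟨2 * x + 3, -4 * x - 7, -1, 2 * y + 1, 0, 0, -1, 0, 1, 0⟩,
    ⟨-2 * x - 2 * y - 4, 4 * x + 4 * y + 8, 1, 1, 0, 0, 1, 0, 0, 0⟩,
    ⟨2 * x + 2 * y + 4, -4 * x - 4 * y - 9, -1, 2 * x + 2, 0, 0, -1, 0, 0, 1⟩,
    ⟨4 * x + 2 * y + 6, 8 * x + 4 * y + 15, 1, 1, 0, 0, -1, 1, 0, 1⟩,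
    ⟨12 * x + 6 * y + 21, -8 * x - 4 * y - 13, 1, 2 * x + 2, 1, 1, -1, 0, 1, 0⟩,
    ⟨10 * x + 6 * y + 19, -4 * x - 4 * y - 8, 1, 1, 1, 0, -1, 0, 1, 1⟩,
    ⟨6 * x + 2 * y + 11, 4 * x + 4 * y + 5, -1, 2 * y, 1, 1, 1, 0, 1, 0⟩,
    ⟨6 * x + 4 * y + 11, 4 * x + 6, 1, 1, 1, 0, 1, 0, 1, 1⟩], 10 * x + 4 * y + 17, 1⟩
    (-4 * x - 2 * y - 6) 0 0 1 0 (4 * x + 6) 0 0 (4 * x + 6) (Or.inr ⟨zero_ne_one, ?_⟩) ?_ ?_ ?_ ?_ ?_ ?_ <;>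
  simp only [Blk.ok2, cover2, chain, hd, tot, par, phit2, placed, ehit2, and_true, true_and, or_false, false_and,
    false_or, one_mul, neg_mul, mul_zero, mul_one, add_zero, sub_zero, zero_ne_one, one_ne_zero, zero_mul, Int.reduceMod,
    Int.reduceMul, Int.reduceAdd, Int.reduceNeg, Int.reduceSub, Int.reduceEq, sub_self]
  all_goals intros; try and_intros
  all_goals (intros; omega)

set_option maxHeartbeats 1000000 in
theorem gen_qr00 (x y : ℕ) :
    Cov (Option (ZMod (8 * x + 4 * y + 14))) (Fin 2 × ZMod (8 * x + 4 * y + 14)) (4 * x + 4 * y + 10) (4 * x + 5) := by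
  refine cov_two (by omega) (by omega) (by omega) (by omega)
    ⟨[⟨8 * x + 4 * y + 14, -8 * x - 4 * y - 12, 1, 1, 1, 0, -1, 0, 0, 0⟩,
    ⟨2, -4, -1, 2 * x, 0, 0, -1, 0, 0, 0⟩,
    ⟨2 * x + 2, -4 * x - 3, 1, 1, 0, 0, -1, 0, 0, 1⟩,
    ⟨-2 * x - 1, 4 * x + 2, -1, 2 * x + 1, 0, 0, 1, 0, 1, 1⟩], 1,
    [⟨-2 * x - 2, 4 * x + 6, 1, 2 * y + 1, 0, 0, 1, 0, 0, 0⟩,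
    ⟨2 * x + 2 * y + 4, -4 * x - 4 * y - 9, 1, 1, 0, 0, -1, 0, 0, 1⟩,
    ⟨-2 * x - 2 * y - 5, 4 * x + 4 * y + 12, 1, 2 * x + 1, 0, 0, 1, 0, 1, 1⟩,
    ⟨4 * x + 2 * y + 7, 1, 1, 1, 0, 0, 1, 0, 1, 0⟩,
    ⟨4 * x + 2 * y + 8, -2, 1, 1, 1, 0, -1, 0, 0, 0⟩,
    ⟨4 * x + 2 * y + 6, -8 * x - 4 * y - 10, 1, 2 * x + 1, 0, 0, -1, 0, 0, 0⟩,
    ⟨-2 * x - 2 * y - 4, 4 * x + 4 * y + 9, 1, 1, 0, 0, 1, 0, 0, 1⟩,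
    ⟨2 * x + 2 * y + 5, -4 * x - 4 * y - 8, 1, 2 * y + 2, 0, 0, -1, 0, 1, 1⟩,
    ⟨2 * x + 3, -4 * x - 5, 1, 1, 0, 0, -1, 0, 1, 0⟩], -2 * x - 2, 0⟩
    ⟨[⟨0, 1, 1, 2 * x + 2, 0, 0, 1, 0, 0, 1⟩,
    ⟨-2 * x - 2, 4 * x + 4, 1, 1, 0, 0, 1, 0, 0, 0⟩,
    ⟨2 * x + 2, -4 * x - 5, -1, 2 * y + 2, 0, 0, -1, 0, 0, 1⟩,
    ⟨2 * x + 2 * y + 4, -4 * x - 4 * y - 8, 1, 1, 0, 0, -1, 0, 0, 0⟩,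
    ⟨-2 * x - 2 * y - 4, 4 * x + 4 * y + 7, -1, 2 * y + 1, 0, 0, 1, 0, 0, 1⟩,
    ⟨2 * x + 3, -4 * x - 4, 1, 1, 0, 0, -1, 0, 1, 1⟩,
    ⟨-2 * x - 1, 4 * x + 1, -1, 2 * x, 0, 0, 1, 0, 1, 0⟩], -1,
    [⟨2 * x + 2 * y + 5, -4 * x - 4 * y - 11, -1, 2 * x + 2, 0, 0, -1, 0, 1, 0⟩,
    ⟨4 * x + 2 * y + 7, 8 * x + 4 * y + 13, 1, 1, 0, 0, 1, 0, 1, 0⟩,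
    ⟨12 * x + 6 * y + 20, -8 * x - 4 * y - 11, 1, 2 * x + 1, 1, 1, -1, 0, 0, 1⟩,
    ⟨6 * x + 2 * y + 9, 4 * x + 4 * y + 10, 1, 1, 1, 0, 1, 0, 1, 1⟩], 10 * x + 6 * y + 19, 1⟩
    (-4 * x - 2 * y - 6) 0 0 1 0 (4 * x + 4 * y + 10) 0 0 (4 * x + 4 * y + 10) (Or.inr ⟨zero_ne_one, ?_⟩) ?_ ?_ ?_ ?_ ?_ ?_ <;>
  simp only [Blk.ok2, cover2, chain, hd, tot, par, phit2, placed, ehit2, and_true, true_and, or_false, false_and,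
    false_or, one_mul, neg_mul, mul_zero, mul_one, add_zero, sub_zero, zero_ne_one, one_ne_zero, zero_mul, Int.reduceMod,
    Int.reduceMul, Int.reduceAdd, Int.reduceNeg, Int.reduceSub, Int.reduceEq, sub_self]
  all_goals intros; try and_intros
  all_goals (intros; omega)

set_option maxHeartbeats 1000000 in
theorem gen_rq01 (x y : ℕ) :
    Cov (Option (ZMod (8 * x + 4 * y + 16))) (Fin 2 × ZMod (8 * x + 4 * y + 16)) (4 * x + 6) (4 * x + 4 * y + 11) := by
  refine cov_two (by omega) (by omega) (by omega) (by omega)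
    ⟨[⟨8 * x + 4 * y + 16, -8 * x - 4 * y - 14, 1, 1, 1, 0, -1, 0, 0, 0⟩,
    ⟨2, -4, -1, 2 * x, 0, 0, -1, 0, 0, 0⟩,
    ⟨2 * x + 2, -4 * x - 5, 1, 1, 0, 0, -1, 0, 0, 1⟩,
    ⟨-2 * x - 3, 4 * x + 8, 1, 2 * y + 1, 0, 0, 1, 0, 1, 1⟩,
    ⟨2 * x + 2 * y + 5, -4 * x - 4 * y - 9, 1, 1, 0, 0, -1, 0, 1, 0⟩,
    ⟨-2 * x - 2 * y - 4, 4 * x + 4 * y + 8, -1, 2 * y + 2, 0, 0, 1, 0, 0, 0⟩,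
    ⟨-2 * x - 2, 4 * x + 5, 1, 1, 0, 0, 1, 0, 0, 1⟩,
    ⟨2 * x + 3, -4 * x - 4, 1, 2 * x + 2, 0, 0, -1, 0, 1, 1⟩], 1,
    [⟨2 * x + 2 * y + 6, -4 * x - 4 * y - 12, -1, 2 * x + 1, 0, 0, -1, 0, 0, 0⟩,
    ⟨-4 * x - 2 * y - 6, 16 * x + 8 * y + 30, 1, 1, 0, 0, -1, 1, 0, 0⟩,
    ⟨12 * x + 6 * y + 24, -16 * x - 8 * y - 31, 1, 1, 1, 0, 1, 1, 0, 1⟩,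
    ⟨-4 * x - 2 * y - 7, 8 * x + 4 * y + 14, -1, 2 * x + 2, 0, 0, 1, 0, 1, 1⟩,
    ⟨-2 * x - 2 * y - 5, 4 * x + 4 * y + 11, 1, 1, 0, 0, 1, 0, 1, 0⟩], 2 * x + 2 * y + 6, 0⟩
    ⟨[⟨0, -1, -1, 2 * x + 2, 0, 0, -1, 0, 0, 1⟩,
    ⟨2 * x + 2, -4 * x - 4, 1, 1, 0, 0, -1, 0, 0, 0⟩,
    ⟨-2 * x - 2, 4 * x + 3, -1, 2 * x + 1, 0, 0, 1, 0, 0, 1⟩], 1,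
    [⟨-2 * x - 3, 4 * x + 7, 1, 2 * y + 2, 0, 0, 1, 0, 1, 0⟩,
    ⟨-2 * x - 2 * y - 5, 4 * x + 4 * y + 10, 1, 1, 0, 0, 1, 0, 1, 1⟩,
    ⟨2 * x + 2 * y + 5, -4 * x - 4 * y - 11, -1, 2 * x + 2, 0, 0, -1, 0, 1, 0⟩,
    ⟨4 * x + 2 * y + 7, 8 * x + 4 * y + 17, 1, 1, 0, 0, -1, 1, 1, 0⟩,
    ⟨12 * x + 6 * y + 24, -8 * x - 4 * y - 15, 1, 2 * x + 2, 1, 1, -1, 0, 0, 1⟩,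
    ⟨10 * x + 6 * y + 22, -4 * x - 4 * y - 10, 1, 1, 1, 0, -1, 0, 0, 0⟩,
    ⟨6 * x + 2 * y + 12, 4 * x + 4 * y + 7, -1, 2 * y + 1, 1, 1, 1, 0, 0, 1⟩,
    ⟨10 * x + 4 * y + 19, -4 * x - 6, 1, 1, 1, 0, -1, 0, 1, 1⟩], 6 * x + 4 * y + 13, 1⟩
    (-4 * x - 2 * y - 7) 0 0 1 0 (4 * x + 6) 0 0 (4 * x + 6) (Or.inr ⟨zero_ne_one, ?_⟩) ?_ ?_ ?_ ?_ ?_ ?_ <;>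
  simp only [Blk.ok2, cover2, chain, hd, tot, par, phit2, placed, ehit2, and_true, true_and, or_false, false_and,
    false_or, one_mul, neg_mul, mul_zero, mul_one, add_zero, sub_zero, zero_ne_one, one_ne_zero, zero_mul, Int.reduceMod,
    Int.reduceMul, Int.reduceAdd, Int.reduceNeg, Int.reduceSub, Int.reduceEq, sub_self]
  all_goals intros; try and_intros
  all_goals (intros; omega)

set_option maxHeartbeats 1000000 in
theorem gen_qr01 (x y : ℕ) :
    Cov (Option (ZMod (8 * x + 4 * y + 16))) (Fin 2 × ZMod (8 * x + 4 * y + 16)) (4 * x + 4 * y + 10) (4 * x + 7) := by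
  refine cov_two (by omega) (by omega) (by omega) (by omega)
    ⟨[⟨8 * x + 4 * y + 16, -8 * x - 4 * y - 14, 1, 1, 1, 0, -1, 0, 0, 0⟩,
    ⟨2, -4, -1, 2 * x + 1, 0, 0, -1, 0, 0, 0⟩,
    ⟨-2 * x - 2, 4 * x + 5, 1, 1, 0, 0, 1, 0, 0, 1⟩,
    ⟨2 * x + 3, -4 * x - 4, 1, 2 * x + 2, 0, 0, -1, 0, 1, 1⟩], 1,
    [⟨2 * x + 4, -4 * x - 8, -1, 2 * y, 0, 0, -1, 0, 0, 0⟩,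
    ⟨2 * x + 2 * y + 4, -4 * x - 4 * y - 9, 1, 1, 0, 0, -1, 0, 0, 1⟩,
    ⟨-2 * x - 2 * y - 5, 4 * x + 4 * y + 12, 1, 2 * x + 2, 0, 0, 1, 0, 1, 1⟩,
    ⟨-4 * x - 2 * y - 7, 16 * x + 8 * y + 31, 1, 1, 0, 0, -1, 1, 1, 0⟩,
    ⟨12 * x + 6 * y + 24, -16 * x - 8 * y - 30, 1, 1, 1, 0, 1, 1, 0, 0⟩,
    ⟨-4 * x - 2 * y - 6, 8 * x + 4 * y + 12, -1, 2 * x + 2, 0, 0, 1, 0, 0, 0⟩,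
    ⟨-2 * x - 2 * y - 4, 4 * x + 4 * y + 9, 1, 1, 0, 0, 1, 0, 0, 1⟩,
    ⟨2 * x + 2 * y + 5, -4 * x - 4 * y - 8, 1, 2 * y + 1, 0, 0, -1, 0, 1, 1⟩,
    ⟨-2 * x - 3, 4 * x + 7, 1, 1, 0, 0, 1, 0, 1, 0⟩], 2 * x + 4, 0⟩
    ⟨[⟨0, -1, -1, 2 * x + 3, 0, 0, -1, 0, 0, 1⟩,
    ⟨-2 * x - 3, 4 * x + 6, 1, 1, 0, 0, 1, 0, 1, 1⟩,
    ⟨2 * x + 3, -4 * x - 7, -1, 2 * y + 1, 0, 0, -1, 0, 1, 0⟩,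
    ⟨-2 * x - 2 * y - 4, 4 * x + 4 * y + 8, 1, 1, 0, 0, 1, 0, 0, 0⟩,
    ⟨2 * x + 2 * y + 4, -4 * x - 4 * y - 7, 1, 2 * y, 0, 0, -1, 0, 0, 1⟩,
    ⟨2 * x + 4, -4 * x - 6, 1, 1, 0, 0, -1, 0, 0, 0⟩,
    ⟨-2 * x - 2, 4 * x + 3, -1, 2 * x + 1, 0, 0, 1, 0, 0, 1⟩], 1,
    [⟨-2 * x - 2 * y - 5, 4 * x + 4 * y + 11, 1, 2 * x + 3, 0, 0, 1, 0, 1, 0⟩,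
    ⟨4 * x + 2 * y + 8, 8 * x + 4 * y + 15, 1, 1, 0, 0, 1, 0, 0, 1⟩,
    ⟨12 * x + 6 * y + 23, -8 * x - 4 * y - 13, 1, 2 * x + 2, 1, 1, -1, 0, 1, 0⟩,
    ⟨10 * x + 6 * y + 21, -4 * x - 4 * y - 10, 1, 1, 1, 0, -1, 0, 1, 1⟩], 6 * x + 2 * y + 11, 1⟩
    (-4 * x - 2 * y - 7) 0 0 1 0 (4 * x + 4 * y + 10) 0 0 (4 * x + 4 * y + 10) (Or.inr ⟨zero_ne_one, ?_⟩) ?_ ?_ ?_ ?_ ?_ ?_ <;>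
  simp only [Blk.ok2, cover2, chain, hd, tot, par, phit2, placed, ehit2, and_true, true_and, or_false, false_and,
    false_or, one_mul, neg_mul, mul_zero, mul_one, add_zero, sub_zero, zero_ne_one, one_ne_zero, zero_mul, Int.reduceMod,
    Int.reduceMul, Int.reduceAdd, Int.reduceNeg, Int.reduceSub, Int.reduceEq, sub_self]
  all_goals intros; try and_intros
  all_goals (intros; omega)

set_option maxHeartbeats 1000000 in
theorem gen_rq10 (x y : ℕ) :
    Cov (Option (ZMod (8 * x + 4 * y + 20))) (Fin 2 × ZMod (8 * x + 4 * y + 20)) (4 * x + 8) (4 * x + 4 * y + 13) := by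
  refine cov_two (by omega) (by omega) (by omega) (by omega)
    ⟨[⟨8 * x + 4 * y + 20, -8 * x - 4 * y - 18, 1, 1, 1, 0, -1, 0, 0, 0⟩,
    ⟨2, -4, -1, 2 * x + 1, 0, 0, -1, 0, 0, 0⟩,
    ⟨-2 * x - 2, 4 * x + 7, 1, 1, 0, 0, 1, 0, 0, 1⟩,
    ⟨2 * x + 5, -4 * x - 10, -1, 2 * y + 1, 0, 0, -1, 0, 1, 1⟩,
    ⟨-2 * x - 2 * y - 5, 4 * x + 4 * y + 11, 1, 1, 0, 0, 1, 0, 1, 0⟩,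
    ⟨2 * x + 2 * y + 6, -4 * x - 4 * y - 10, 1, 2 * y + 2, 0, 0, -1, 0, 0, 0⟩,
    ⟨2 * x + 4, -4 * x - 7, 1, 1, 0, 0, -1, 0, 0, 1⟩,
    ⟨-2 * x - 3, 4 * x + 6, -1, 2 * x + 3, 0, 0, 1, 0, 1, 1⟩], 1,
    [⟨-2 * x - 2 * y - 6, 4 * x + 4 * y + 14, 1, 2 * x + 2, 0, 0, 1, 0, 0, 0⟩,
    ⟨-4 * x - 2 * y - 8, 16 * x + 8 * y + 38, 1, 1, 0, 0, -1, 1, 0, 0⟩,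
    ⟨12 * x + 6 * y + 30, -16 * x - 8 * y - 39, 1, 1, 1, 0, 1, 1, 0, 1⟩,
    ⟨-4 * x - 2 * y - 9, 8 * x + 4 * y + 18, -1, 2 * x + 3, 0, 0, 1, 0, 1, 1⟩,
    ⟨2 * x + 2 * y + 7, -4 * x - 4 * y - 13, 1, 1, 0, 0, -1, 0, 1, 0⟩], -2 * x - 2 * y - 6, 0⟩
    ⟨[⟨1, 1, 1, 2 * x + 3, 0, 0, 1, 0, 1, 0⟩,
    ⟨2 * x + 4, -4 * x - 6, 1, 1, 0, 0, -1, 0, 0, 0⟩,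
    ⟨-2 * x - 2, 4 * x + 5, -1, 2 * x + 2, 0, 0, 1, 0, 0, 1⟩], 0,
    [⟨-2 * x - 3, 4 * x + 9, 1, 2 * y + 1, 0, 0, 1, 0, 1, 0⟩,
    ⟨2 * x + 2 * y + 6, -4 * x - 4 * y - 12, 1, 1, 0, 0, -1, 0, 0, 0⟩,
    ⟨-2 * x - 2 * y - 6, 4 * x + 4 * y + 15, 1, 2 * x + 2, 0, 0, 1, 0, 0, 1⟩,
    ⟨-4 * x - 2 * y - 8, 8 * x + 4 * y + 19, 1, 1, 0, 0, 1, 0, 0, 1⟩,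
    ⟨4 * x + 2 * y + 11, 8 * x + 4 * y + 19, -1, 2 * x + 4, 1, 1, 1, 0, 1, 0⟩,
    ⟨6 * x + 2 * y + 15, 4 * x + 4 * y + 12, 1, 1, 1, 0, 1, 0, 1, 1⟩,
    ⟨10 * x + 6 * y + 27, -4 * x - 4 * y - 11, 1, 2 * y + 2, 1, 1, -1, 0, 1, 0⟩,
    ⟨10 * x + 4 * y + 25, -4 * x - 8, 1, 1, 1, 0, -1, 0, 1, 1⟩], 6 * x + 4 * y + 17, 0⟩
    (-4 * x - 2 * y - 9) 0 0 1 0 (4 * x + 8) 0 0 (4 * x + 8) (Or.inl ⟨rfl, ?_⟩) ?_ ?_ ?_ ?_ ?_ ?_ <;>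
  simp only [Blk.ok2, cover2, chain, hd, tot, par, phit2, placed, ehit2, and_true, true_and, or_false, false_and,
    false_or, one_mul, neg_mul, mul_zero, mul_one, add_zero, sub_zero, zero_ne_one, one_ne_zero, zero_mul, Int.reduceMod,
    Int.reduceMul, Int.reduceAdd, Int.reduceNeg, Int.reduceSub, Int.reduceEq, sub_self]
  all_goals intros; try and_intros
  all_goals (intros; omega)

set_option maxHeartbeats 1000000 in
theorem gen_qr10 (x y : ℕ) :
    Cov (Option (ZMod (8 * x + 4 * y + 12))) (Fin 2 × ZMod (8 * x + 4 * y + 12)) (4 * x + 4 * y + 8) (4 * x + 5) := by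
  refine cov_two (by omega) (by omega) (by omega) (by omega)
    ⟨[⟨8 * x + 4 * y + 12, -8 * x - 4 * y - 10, 1, 1, 1, 0, -1, 0, 0, 0⟩,
    ⟨2, -4, -1, 2 * x, 0, 0, -1, 0, 0, 0⟩,
    ⟨2 * x + 2, -4 * x - 3, 1, 1, 0, 0, -1, 0, 0, 1⟩,
    ⟨-2 * x - 1, 4 * x + 2, -1, 2 * x + 1, 0, 0, 1, 0, 1, 1⟩], 1,
    [⟨-2 * x - 2, 4 * x + 6, 1, 2 * y, 0, 0, 1, 0, 0, 0⟩,
    ⟨-2 * x - 2 * y - 2, 4 * x + 4 * y + 7, 1, 1, 0, 0, 1, 0, 0, 1⟩,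
    ⟨2 * x + 2 * y + 5, -4 * x - 4 * y - 10, -1, 2 * x + 1, 0, 0, -1, 0, 1, 1⟩,
    ⟨-4 * x - 2 * y - 5, 16 * x + 8 * y + 23, 1, 1, 0, 0, -1, 1, 1, 0⟩,
    ⟨12 * x + 6 * y + 18, -16 * x - 8 * y - 22, 1, 1, 1, 0, 1, 1, 0, 0⟩,
    ⟨-4 * x - 2 * y - 4, 8 * x + 4 * y + 8, -1, 2 * x + 1, 0, 0, 1, 0, 0, 0⟩,
    ⟨2 * x + 2 * y + 4, -4 * x - 4 * y - 7, 1, 1, 0, 0, -1, 0, 0, 1⟩,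
    ⟨-2 * x - 2 * y - 3, 4 * x + 4 * y + 6, -1, 2 * y + 1, 0, 0, 1, 0, 1, 1⟩,
    ⟨2 * x + 3, -4 * x - 5, 1, 1, 0, 0, -1, 0, 1, 0⟩], -2 * x - 2, 0⟩
    ⟨[⟨1, 1, 1, 2 * x + 1, 0, 0, 1, 0, 1, 0⟩,
    ⟨2 * x + 2, -4 * x - 4, 1, 1, 0, 0, -1, 0, 0, 0⟩,
    ⟨-2 * x - 2, 4 * x + 7, 1, 2 * y, 0, 0, 1, 0, 0, 1⟩,
    ⟨-2 * x - 2 * y - 2, 4 * x + 4 * y + 6, 1, 1, 0, 0, 1, 0, 0, 0⟩,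
    ⟨2 * x + 2 * y + 4, -4 * x - 4 * y - 5, 1, 2 * y + 1, 0, 0, -1, 0, 0, 1⟩,
    ⟨-2 * x - 1, 4 * x + 4, 1, 1, 0, 0, 1, 0, 1, 1⟩,
    ⟨2 * x + 3, -4 * x - 3, 1, 2 * x + 1, 0, 0, -1, 0, 1, 0⟩], 0,
    [⟨-2 * x - 2 * y - 3, 4 * x + 4 * y + 9, 1, 2 * x + 2, 0, 0, 1, 0, 1, 0⟩,
    ⟨-4 * x - 2 * y - 5, 8 * x + 4 * y + 13, 1, 1, 0, 0, -1, 1, 1, 0⟩,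
    ⟨4 * x + 2 * y + 8, 8 * x + 4 * y + 9, -1, 2 * x + 1, 1, 1, 1, 0, 0, 1⟩,
    ⟨10 * x + 6 * y + 17, -4 * x - 4 * y - 8, 1, 1, 1, 0, -1, 0, 1, 1⟩], 6 * x + 2 * y + 9, 0⟩
    (-4 * x - 2 * y - 5) 0 0 1 0 (4 * x + 4 * y + 8) 0 0 (4 * x + 4 * y + 8) (Or.inl ⟨rfl, ?_⟩) ?_ ?_ ?_ ?_ ?_ ?_ <;>
  simp only [Blk.ok2, cover2, chain, hd, tot, par, phit2, placed, ehit2, and_true, true_and, or_false, false_and,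
    false_or, one_mul, neg_mul, mul_zero, mul_one, add_zero, sub_zero, zero_ne_one, one_ne_zero, zero_mul, Int.reduceMod,
    Int.reduceMul, Int.reduceAdd, Int.reduceNeg, Int.reduceSub, Int.reduceEq, sub_self]
  all_goals intros; try and_intros
  all_goals (intros; omega)

set_option maxHeartbeats 1000000 in
theorem gen_rq11 (x y : ℕ) :
    Cov (Option (ZMod (8 * x + 4 * y + 18))) (Fin 2 × ZMod (8 * x + 4 * y + 18)) (4 * x + 8) (4 * x + 4 * y + 11) := by
  refine cov_two (by omega) (by omega) (by omega) (by omega)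
    ⟨[⟨8 * x + 4 * y + 18, -8 * x - 4 * y - 16, 1, 1, 1, 0, -1, 0, 0, 0⟩,
    ⟨2, -4, -1, 2 * x + 1, 0, 0, -1, 0, 0, 0⟩,
    ⟨-2 * x - 2, 4 * x + 7, 1, 1, 0, 0, 1, 0, 0, 1⟩,
    ⟨2 * x + 5, -4 * x - 10, -1, 2 * y, 0, 0, -1, 0, 1, 1⟩,
    ⟨2 * x + 2 * y + 5, -4 * x - 4 * y - 9, 1, 1, 0, 0, -1, 0, 1, 0⟩,
    ⟨-2 * x - 2 * y - 4, 4 * x + 4 * y + 8, -1, 2 * y + 1, 0, 0, 1, 0, 0, 0⟩,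
    ⟨2 * x + 4, -4 * x - 7, 1, 1, 0, 0, -1, 0, 0, 1⟩,
    ⟨-2 * x - 3, 4 * x + 6, -1, 2 * x + 3, 0, 0, 1, 0, 1, 1⟩], 1,
    [⟨2 * x + 2 * y + 6, -4 * x - 4 * y - 12, -1, 2 * x + 2, 0, 0, -1, 0, 0, 0⟩,
    ⟨4 * x + 2 * y + 8, 2, 1, 1, 0, 0, 1, 0, 0, 0⟩,
    ⟨4 * x + 2 * y + 10, -1, 1, 1, 1, 0, -1, 0, 0, 1⟩,
    ⟨4 * x + 2 * y + 9, -8 * x - 4 * y - 16, 1, 2 * x + 3, 0, 0, -1, 0, 1, 1⟩,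
    ⟨-2 * x - 2 * y - 5, 4 * x + 4 * y + 11, 1, 1, 0, 0, 1, 0, 1, 0⟩], 2 * x + 2 * y + 6, 0⟩
    ⟨[⟨1, -1, -1, 2 * x + 3, 0, 0, -1, 0, 1, 0⟩,
    ⟨-2 * x - 2, 4 * x + 6, 1, 1, 0, 0, 1, 0, 0, 0⟩,
    ⟨2 * x + 4, -4 * x - 5, 1, 2 * x + 2, 0, 0, -1, 0, 0, 1⟩], 2,
    [⟨2 * x + 5, -4 * x - 9, -1, 2 * y, 0, 0, -1, 0, 1, 0⟩,
    ⟨2 * x + 2 * y + 5, -4 * x - 4 * y - 10, 1, 1, 0, 0, -1, 0, 1, 1⟩,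
    ⟨-2 * x - 2 * y - 5, 4 * x + 4 * y + 13, 1, 2 * x + 2, 0, 0, 1, 0, 1, 0⟩,
    ⟨-4 * x - 2 * y - 7, 8 * x + 4 * y + 17, 1, 1, 0, 0, 1, 0, 1, 0⟩,
    ⟨4 * x + 2 * y + 10, 8 * x + 4 * y + 17, -1, 2 * x + 4, 1, 1, 1, 0, 0, 1⟩,
    ⟨6 * x + 2 * y + 14, 4 * x + 4 * y + 10, 1, 1, 1, 0, 1, 0, 0, 0⟩,
    ⟨10 * x + 6 * y + 24, -4 * x - 4 * y - 9, 1, 2 * y + 1, 1, 1, -1, 0, 0, 1⟩,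
    ⟨6 * x + 4 * y + 15, 4 * x + 8, 1, 1, 1, 0, 1, 0, 1, 1⟩], 10 * x + 4 * y + 23, 0⟩
    (-4 * x - 2 * y - 8) 0 0 1 0 (4 * x + 8) 0 0 (4 * x + 8) (Or.inl ⟨rfl, ?_⟩) ?_ ?_ ?_ ?_ ?_ ?_ <;>
  simp only [Blk.ok2, cover2, chain, hd, tot, par, phit2, placed, ehit2, and_true, true_and, or_false, false_and,
    false_or, one_mul, neg_mul, mul_zero, mul_one, add_zero, sub_zero, zero_ne_one, one_ne_zero, zero_mul, Int.reduceMod,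
    Int.reduceMul, Int.reduceAdd, Int.reduceNeg, Int.reduceSub, Int.reduceEq, sub_self]
  all_goals intros; try and_intros
  all_goals (intros; omega)

set_option maxHeartbeats 1000000 in
theorem gen_qr11 (x y : ℕ) :
    Cov (Option (ZMod (8 * x + 4 * y + 18))) (Fin 2 × ZMod (8 * x + 4 * y + 18)) (4 * x + 4 * y + 12) (4 * x + 7) := by
  refine cov_two (by omega) (by omega) (by omega) (by omega)
    ⟨[⟨8 * x + 4 * y + 18, -8 * x - 4 * y - 16, 1, 1, 1, 0, -1, 0, 0, 0⟩,
    ⟨2, -4, -1, 2 * x + 1, 0, 0, -1, 0, 0, 0⟩,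
    ⟨-2 * x - 2, 4 * x + 5, 1, 1, 0, 0, 1, 0, 0, 1⟩,
    ⟨2 * x + 3, -4 * x - 4, 1, 2 * x + 2, 0, 0, -1, 0, 1, 1⟩], 1,
    [⟨2 * x + 4, -4 * x - 8, -1, 2 * y + 1, 0, 0, -1, 0, 0, 0⟩,
    ⟨-2 * x - 2 * y - 4, 4 * x + 4 * y + 11, 1, 1, 0, 0, 1, 0, 0, 1⟩,
    ⟨2 * x + 2 * y + 7, -4 * x - 4 * y - 14, -1, 2 * x + 2, 0, 0, -1, 0, 1, 1⟩,
    ⟨4 * x + 2 * y + 9, 1, 1, 1, 0, 0, 1, 0, 1, 0⟩,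
    ⟨4 * x + 2 * y + 10, -2, 1, 1, 1, 0, -1, 0, 0, 0⟩,
    ⟨4 * x + 2 * y + 8, -8 * x - 4 * y - 14, 1, 2 * x + 2, 0, 0, -1, 0, 0, 0⟩,
    ⟨2 * x + 2 * y + 6, -4 * x - 4 * y - 11, 1, 1, 0, 0, -1, 0, 0, 1⟩,
    ⟨-2 * x - 2 * y - 5, 4 * x + 4 * y + 10, -1, 2 * y + 2, 0, 0, 1, 0, 1, 1⟩,
    ⟨-2 * x - 3, 4 * x + 7, 1, 1, 0, 0, 1, 0, 1, 0⟩], 2 * x + 4, 0⟩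
    ⟨[⟨1, -1, -1, 2 * x + 2, 0, 0, -1, 0, 1, 0⟩,
    ⟨2 * x + 3, -4 * x - 6, 1, 1, 0, 0, -1, 0, 1, 1⟩,
    ⟨-2 * x - 3, 4 * x + 9, 1, 2 * y + 1, 0, 0, 1, 0, 1, 0⟩,
    ⟨2 * x + 2 * y + 6, -4 * x - 4 * y - 10, 1, 1, 0, 0, -1, 0, 0, 0⟩,
    ⟨-2 * x - 2 * y - 4, 4 * x + 4 * y + 9, -1, 2 * y + 2, 0, 0, 1, 0, 0, 1⟩,
    ⟨-2 * x - 2, 4 * x + 6, 1, 1, 0, 0, 1, 0, 0, 0⟩,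
    ⟨2 * x + 4, -4 * x - 5, 1, 2 * x + 2, 0, 0, -1, 0, 0, 1⟩], 2,
    [⟨2 * x + 2 * y + 7, -4 * x - 4 * y - 13, -1, 2 * x + 3, 0, 0, -1, 0, 1, 0⟩,
    ⟨-4 * x - 2 * y - 8, 8 * x + 4 * y + 19, 1, 1, 0, 0, -1, 1, 0, 1⟩,
    ⟨4 * x + 2 * y + 11, 8 * x + 4 * y + 15, -1, 2 * x + 2, 1, 1, 1, 0, 1, 0⟩,
    ⟨6 * x + 2 * y + 13, 4 * x + 4 * y + 12, 1, 1, 1, 0, 1, 0, 1, 1⟩], 10 * x + 6 * y + 25, 0⟩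
    (-4 * x - 2 * y - 8) 0 0 1 0 (4 * x + 4 * y + 12) 0 0 (4 * x + 4 * y + 12) (Or.inl ⟨rfl, ?_⟩) ?_ ?_ ?_ ?_ ?_ ?_ <;>
  simp only [Blk.ok2, cover2, chain, hd, tot, par, phit2, placed, ehit2, and_true, true_and, or_false, false_and,
    false_or, one_mul, neg_mul, mul_zero, mul_one, add_zero, sub_zero, zero_ne_one, one_ne_zero, zero_mul, Int.reduceMod,
    Int.reduceMul, Int.reduceAdd, Int.reduceNeg, Int.reduceSub, Int.reduceEq, sub_self]
  all_goals intros; try and_intros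
  all_goals (intros; omega)

set_option maxHeartbeats 1000000 in
theorem gen_q1a (y : ℕ) :
    Cov (Option (ZMod (4 * y + 10))) (Fin 2 × ZMod (4 * y + 10)) (4) (4 * y + 7) := by
  refine cov_two (by omega) (by omega) (by omega) (by omega)
    ⟨[⟨0, 3, 1, 1, 0, 0, 1, 0, 0, 1⟩,
    ⟨3, -6, -1, 2 * y, 0, 0, -1, 0, 1, 1⟩,
    ⟨2 * y + 3, -4 * y - 5, 1, 1, 0, 0, -1, 0, 1, 0⟩,
    ⟨-2 * y - 2, 4 * y + 4, -1, 2 * y + 1, 0, 0, 1, 0, 0, 0⟩,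
    ⟨2, -3, 1, 1, 0, 0, -1, 0, 0, 1⟩,
    ⟨-1, 2, -1, 1, 0, 0, 1, 0, 1, 1⟩], 1,
    [⟨2 * y + 4, 2, 1, 1, 0, 0, 1, 0, 0, 0⟩,
    ⟨2 * y + 6, -1, 1, 1, 1, 0, -1, 0, 0, 1⟩,
    ⟨2 * y + 5, -4 * y - 8, 1, 1, 0, 0, -1, 0, 1, 1⟩,
    ⟨-2 * y - 3, 4 * y + 7, 1, 1, 0, 0, 1, 0, 1, 0⟩], 2 * y + 4, 0⟩
    ⟨[⟨1, -1, -1, 1, 0, 0, -1, 0, 1, 0⟩,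
    ⟨0, 4 * y + 12, 1, 1, 0, 0, -1, 1, 0, 0⟩], 4 * y + 12,
    [⟨3, -5, -1, 2 * y, 0, 0, -1, 0, 1, 0⟩,
    ⟨2 * y + 3, -4 * y - 6, 1, 1, 0, 0, -1, 0, 1, 1⟩,
    ⟨-2 * y - 3, 4 * y + 9, 1, 1, 0, 0, 1, 0, 1, 0⟩,
    ⟨2 * y + 6, 4 * y + 9, -1, 2, 1, 1, 1, 0, 0, 1⟩,
    ⟨2 * y + 8, 4 * y + 6, 1, 1, 1, 0, 1, 0, 0, 0⟩,
    ⟨6 * y + 14, -4 * y - 5, 1, 2 * y + 1, 1, 1, -1, 0, 0, 1⟩,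
    ⟨4 * y + 9, 4, 1, 1, 1, 0, 1, 0, 1, 1⟩], 4 * y + 13, 0⟩
    (-2 * y - 4) 0 0 1 1 4 0 0 4 (Or.inl ⟨rfl, ?_⟩) ?_ ?_ ?_ ?_ ?_ ?_ <;>
  simp only [Blk.ok2, cover2, chain, hd, tot, par, phit2, placed, ehit2, and_true, true_and, or_false, false_and,
    false_or, one_mul, neg_mul, mul_zero, mul_one, add_zero, sub_zero, zero_ne_one, one_ne_zero, zero_mul, Int.reduceMod,
    Int.reduceMul, Int.reduceAdd, Int.reduceNeg, Int.reduceSub, Int.reduceEq, sub_self]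
  all_goals intros; try and_intros
  all_goals (intros; omega)

set_option maxHeartbeats 1000000 in
theorem gen_q1b (y : ℕ) :
    Cov (Option (ZMod (4 * y + 12))) (Fin 2 × ZMod (4 * y + 12)) (4) (4 * y + 9) := by
  refine cov_two (by omega) (by omega) (by omega) (by omega)
    ⟨[⟨0, 3, 1, 1, 0, 0, 1, 0, 0, 1⟩,
    ⟨3, -6, -1, 2 * y + 1, 0, 0, -1, 0, 1, 1⟩,
    ⟨-2 * y - 3, 4 * y + 7, 1, 1, 0, 0, 1, 0, 1, 0⟩,
    ⟨2 * y + 4, -4 * y - 6, 1, 2 * y + 2, 0, 0, -1, 0, 0, 0⟩,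
    ⟨2, -3, 1, 1, 0, 0, -1, 0, 0, 1⟩,
    ⟨-1, 2, -1, 1, 0, 0, 1, 0, 1, 1⟩], 1,
    [⟨-2 * y - 4, 8 * y + 22, 1, 1, 0, 0, -1, 1, 0, 0⟩,
    ⟨6 * y + 18, -8 * y - 23, 1, 1, 1, 0, 1, 1, 0, 1⟩,
    ⟨-2 * y - 5, 4 * y + 10, -1, 1, 0, 0, 1, 0, 1, 1⟩,
    ⟨2 * y + 5, -4 * y - 9, 1, 1, 0, 0, -1, 0, 1, 0⟩], -2 * y - 4, 0⟩
    ⟨[⟨1, 1, 1, 1, 0, 0, 1, 0, 1, 0⟩,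
    ⟨2, 4 * y + 10, 1, 1, 0, 0, 1, 0, 0, 0⟩], 4 * y + 12,
    [⟨-1, 5, 1, 2 * y + 1, 0, 0, 1, 0, 1, 0⟩,
    ⟨2 * y + 4, -4 * y - 8, 1, 1, 0, 0, -1, 0, 0, 0⟩,
    ⟨-2 * y - 4, 4 * y + 11, 1, 1, 0, 0, 1, 0, 0, 1⟩,
    ⟨2 * y + 7, 4 * y + 11, -1, 2, 1, 1, 1, 0, 1, 0⟩,
    ⟨2 * y + 9, 4 * y + 8, 1, 1, 1, 0, 1, 0, 1, 1⟩,
    ⟨6 * y + 17, -4 * y - 7, 1, 2 * y + 2, 1, 1, -1, 0, 1, 0⟩,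
    ⟨4 * y + 15, -4, 1, 1, 1, 0, -1, 0, 1, 1⟩], 4 * y + 11, 0⟩
    (-2 * y - 5) 0 0 1 1 4 0 0 4 (Or.inl ⟨rfl, ?_⟩) ?_ ?_ ?_ ?_ ?_ ?_ <;>
  simp only [Blk.ok2, cover2, chain, hd, tot, par, phit2, placed, ehit2, and_true, true_and, or_false, false_and,
    false_or, one_mul, neg_mul, mul_zero, mul_one, add_zero, sub_zero, zero_ne_one, one_ne_zero, zero_mul, Int.reduceMod,
    Int.reduceMul, Int.reduceAdd, Int.reduceNeg, Int.reduceSub, Int.reduceEq, sub_self]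
  all_goals intros; try and_intros
  all_goals (intros; omega)

set_option maxHeartbeats 1000000 in
theorem gen_r1 (y : ℕ) :
    Cov (Option (ZMod (4 * y + 10))) (Fin 2 × ZMod (4 * y + 10)) (4 * y + 8) (3) := by
  refine cov_two (by omega) (by omega) (by omega) (by omega)
    ⟨[⟨0, 1, 1, 1, 0, 0, 1, 0, 0, 1⟩], 1,
    [⟨2, -4, -1, 2 * y + 1, 0, 0, -1, 0, 0, 0⟩,
    ⟨-2 * y - 2, 4 * y + 7, 1, 1, 0, 0, 1, 0, 0, 1⟩,
    ⟨2 * y + 5, 1, 1, 1, 0, 0, 1, 0, 1, 0⟩,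
    ⟨2 * y + 6, -2, 1, 1, 1, 0, -1, 0, 0, 0⟩,
    ⟨2 * y + 4, -4 * y - 7, 1, 1, 0, 0, -1, 0, 0, 1⟩,
    ⟨-2 * y - 3, 4 * y + 6, -1, 2 * y + 2, 0, 0, 1, 0, 1, 1⟩,
    ⟨-1, 3, 1, 1, 0, 0, 1, 0, 1, 0⟩], 2, 0⟩
    ⟨[⟨1, -2, 1, 1, 0, 0, -1, 0, 1, 1⟩,
    ⟨-1, 5, 1, 2 * y + 1, 0, 0, 1, 0, 1, 0⟩,
    ⟨2 * y + 4, -4 * y - 6, 1, 1, 0, 0, -1, 0, 0, 0⟩,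
    ⟨-2 * y - 2, 4 * y + 5, -1, 2 * y + 2, 0, 0, 1, 0, 0, 1⟩,
    ⟨0, 4 * y + 12, 1, 1, 0, 0, -1, 1, 0, 0⟩], 4 * y + 12,
    [⟨2 * y + 5, -4 * y - 9, -1, 1, 0, 0, -1, 0, 1, 0⟩,
    ⟨-2 * y - 4, 4 * y + 11, 1, 1, 0, 0, -1, 1, 0, 1⟩,
    ⟨2 * y + 7, 4 * y + 8, 1, 1, 1, 0, 1, 0, 1, 1⟩], 6 * y + 15, 0⟩
    (-2 * y - 4) 0 0 1 1 (4 * y + 8) 0 0 (4 * y + 8) (Or.inl ⟨rfl, ?_⟩) ?_ ?_ ?_ ?_ ?_ ?_ <;>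
  simp only [Blk.ok2, cover2, chain, hd, tot, par, phit2, placed, ehit2, and_true, true_and, or_false, false_and,
    false_or, one_mul, neg_mul, mul_zero, mul_one, add_zero, sub_zero, zero_ne_one, one_ne_zero, zero_mul, Int.reduceMod,
    Int.reduceMul, Int.reduceAdd, Int.reduceNeg, Int.reduceSub, Int.reduceEq, sub_self]
  all_goals intros; try and_intros
  all_goals (intros; omega)


theorem o3a (k : ℕ) :
    Cov (Option (ZMod (12 * k + 12))) (Fin 2 × ZMod (12 * k + 12)) (12 * k + 10) 3 := by
  refine cov_single (m := 1) one_pos (by omega) (by omega) (by omega) (by omega)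
    ⟨[⟨0, 1, 1, 4 * k + 3, -1, 0, 1, 0, 0, 0⟩,
    ⟨2 * k + 2, -4 * k - 6, -1, 8 * k + 5, 0, -1, -1, 0, 0, 0⟩], -6 * k - 6,
    [⟨10 * k + 9, -12 * k - 11, -1, 1, 0, 0, -1, 0, 0, 0⟩,
    ⟨-2 * k - 2, -4 * k - 5, -1, 1, -1, 0, -1, 0, 0, 0⟩,
    ⟨-6 * k - 7, 4 * k + 4, 1, 1, -1, 0, 1, 0, 0, 0⟩], -2 * k - 3, 0⟩ 1 (-1) (-1) 0 (12 * k + 10) ?_ ?_ ?_ <;>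
  simp only [Blk.ok, chain, hd, tot, phit, placed, dhit, dh, and_true, true_and, or_false] <;>
    try and_intros
  all_goals (intros; omega)

theorem o3b (k : ℕ) :
    Cov (Option (ZMod (12 * k + 16))) (Fin 2 × ZMod (12 * k + 16)) (12 * k + 14) 3 := by
  refine cov_single (m := 1) one_pos (by omega) (by omega) (by omega) (by omega)
    ⟨[⟨0, 1, 1, 4 * k + 4, -1, 0, 1, 0, 0, 0⟩,
    ⟨-2 * k - 2, 4 * k + 7, 1, 8 * k + 8, -1, 0, 1, 0, 0, 0⟩], -6 * k - 6,
    [⟨2 * k + 3, -12 * k - 15, -1, 1, 0, 0, -1, 0, 0, 0⟩,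
    ⟨-10 * k - 12, 4 * k + 5, 1, 1, -1, 0, 1, 0, 0, 0⟩,
    ⟨-6 * k - 7, -4 * k - 6, -1, 1, -1, 0, -1, 0, 0, 0⟩], -10 * k - 13, 0⟩ 1 (-1) (-1) 0 (12 * k + 14) ?_ ?_ ?_ <;>
  simp only [Blk.ok, chain, hd, tot, phit, placed, dhit, dh, and_true, true_and, or_false] <;>
    try and_intros
  all_goals (intros; omega)

theorem o3c (k : ℕ) :
    Cov (Option (ZMod (12 * k + 8))) (Fin 2 × ZMod (12 * k + 8)) (12 * k + 6) 3 := by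
  refine cov_single (m := 1) one_pos (by omega) (by omega) (by omega) (by omega)
    ⟨[⟨0, 1, 1, 4 * k + 1, -1, 0, 1, 0, 0, 0⟩,
    ⟨2 * k + 1, -12 * k - 6, 1, 1, 0, 0, -1, 0, 0, 0⟩,
    ⟨-10 * k - 5, -4 * k - 5, -1, 8 * k + 1, -1, -2, -1, 0, 0, 0⟩,
    ⟨-18 * k - 10, -4 * k - 4, 1, 1, -2, 0, -1, 0, 0, 0⟩], -22 * k - 14,
    [⟨6 * k + 4, 4 * k + 3, -1, 2, 0, 0, 1, 0, 0, 0⟩,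
    ⟨6 * k + 5, 12 * k + 7, 1, 1, 0, 0, 1, 0, 0, 0⟩], 18 * k + 12, 0⟩ 1 (1) (-2) 0 (12 * k + 6) ?_ ?_ ?_ <;>
  simp only [Blk.ok, chain, hd, tot, phit, placed, dhit, dh, and_true, true_and, or_false] <;>
    try and_intros
  all_goals (intros; omega)

set_option maxHeartbeats 1000000 in
theorem e2_even (x : ℕ) :
    Cov (Option (ZMod (4 * x + 8))) (Fin 2 × ZMod (4 * x + 8)) (2) (4 * x + 7) := by
  refine cov_two (by omega) (by omega) (by omega) (by omega)
    ⟨[], 1,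
    [⟨4 * x + 8, -4 * x - 6, 1, 1, 1, 0, -1, 0, 0, 0⟩,
    ⟨2, -4, -1, 2 * x + 1, 0, 0, -1, 0, 0, 0⟩,
    ⟨-2 * x - 2, 8 * x + 14, 1, 1, 0, 0, -1, 1, 0, 0⟩,
    ⟨6 * x + 12, -8 * x - 15, 1, 1, 1, 0, 1, 1, 0, 1⟩,
    ⟨-2 * x - 3, 4 * x + 6, -1, 2 * x + 2, 0, 0, 1, 0, 1, 1⟩,
    ⟨-1, 8 * x + 17, 1, 1, 0, 0, 1, -1, 1, 0⟩], 8 * x + 16, 0⟩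
    ⟨[], 0,
    [⟨1, -3, -1, 2 * x + 3, 0, 0, -1, 0, 1, 0⟩,
    ⟨-2 * x - 4, 4 * x + 9, 1, 1, -1, 0, -1, 1, 0, 1⟩,
    ⟨2 * x + 5, 4 * x + 5, -1, 2 * x + 2, 1, 1, 1, 0, 1, 0⟩,
    ⟨4 * x + 7, 2, 1, 1, 1, 0, 1, 0, 1, 1⟩], 4 * x + 9, 0⟩
    (-2 * x - 3) 1 0 1 0 0 2 0 2 (Or.inl ⟨rfl, ?_⟩) ?_ ?_ ?_ ?_ ?_ ?_ <;>
  simp only [Blk.ok2, cover2, chain, hd, tot, par, phit2, placed, ehit2, and_true, true_and, or_false, false_and,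
    false_or, one_mul, neg_mul, mul_zero, mul_one, add_zero, sub_zero, zero_ne_one, one_ne_zero, zero_mul, Int.reduceMod,
    Int.reduceMul, Int.reduceAdd, Int.reduceNeg, Int.reduceSub, Int.reduceEq, sub_self]
  all_goals intros; try and_intros
  all_goals (intros; omega)

set_option maxHeartbeats 1000000 in
theorem e2_o3 :
    Cov (Option (ZMod (4))) (Fin 2 × ZMod (4)) (2) (3) := by
  refine cov_two (by omega) (by omega) (by omega) (by omega)
    ⟨[], 1,
    [⟨4, 2, 1, 1, 1, 0, 1, 0, 0, 0⟩,
    ⟨6, -7, 1, 1, 1, 0, 1, 1, 0, 1⟩,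
    ⟨-1, 9, 1, 1, -1, 0, 1, -1, 1, 0⟩], 8, 0⟩
    ⟨[], 0,
    [⟨1, -3, 1, 1, 0, 0, -1, 0, 1, 0⟩,
    ⟨-2, 5, 1, 1, -1, 0, -1, 1, 0, 1⟩,
    ⟨3, 2, 1, 1, 0, 0, 1, 0, 1, 1⟩], 5, 0⟩
    0 1 0 1 0 0 2 0 2 (Or.inl ⟨rfl, ?_⟩) ?_ ?_ ?_ ?_ ?_ ?_ <;>
  simp only [Blk.ok2, cover2, chain, hd, tot, par, phit2, placed, ehit2, and_true, true_and, or_false, false_and,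
    false_or, one_mul, neg_mul, mul_zero, mul_one, add_zero, sub_zero, zero_ne_one, one_ne_zero, zero_mul, Int.reduceMod,
    Int.reduceMul, Int.reduceAdd, Int.reduceNeg, Int.reduceSub, Int.reduceEq, sub_self]
  all_goals intros; try and_intros
  all_goals (intros; first | omega | simp)

set_option maxHeartbeats 1000000 in
theorem e4_o5 :
    Cov (Option (ZMod (8))) (Fin 2 × ZMod (8)) (4) (5) := by
  refine cov_two (by omega) (by omega) (by omega) (by omega)
    ⟨[⟨11, 1, 1, 1, 1, 0, 1, 0, 1, 0⟩,
    ⟨12, -2, 1, 1, 1, 0, -1, 0, 0, 0⟩], 10,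
    [⟨8, 6, 1, 1, 1, 0, 1, 0, 0, 0⟩,
    ⟨14, 1, 1, 1, 1, 0, 1, 0, 0, 1⟩,
    ⟨15, -6, 1, 1, 1, 0, -1, 0, 1, 1⟩,
    ⟨9, -4, 1, 1, 1, 0, -1, 0, 1, 1⟩,
    ⟨5, 11, 1, 1, 0, 0, -1, 1, 1, 0⟩], 16, 1⟩
    ⟨[⟨4, 11, 1, 1, 0, 0, -1, 1, 0, 1⟩,
    ⟨15, -14, 1, 1, 1, 0, 1, 1, 1, 1⟩], 1,
    [⟨6, 7, 1, 1, 0, 0, 1, 0, 0, 1⟩,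
    ⟨13, -13, 1, 1, 1, 0, 1, 1, 1, 0⟩,
    ⟨0, 3, 1, 1, 0, 0, 1, 0, 0, 1⟩,
    ⟨3, 7, 1, 1, 0, 0, 1, 0, 1, 0⟩,
    ⟨10, 4, 1, 1, 1, 0, 1, 0, 0, 0⟩], 14, 1⟩
    0 1 1 1 0 0 4 0 4 (Or.inl ⟨rfl, ?_⟩) ?_ ?_ ?_ ?_ ?_ ?_ <;>
  simp only [Blk.ok2, cover2, chain, hd, tot, par, phit2, placed, ehit2, and_true, true_and, or_false, false_and,
    false_or, one_mul, neg_mul, mul_zero, mul_one, add_zero, sub_zero, zero_ne_one, one_ne_zero, zero_mul, Int.reduceMod,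
    Int.reduceMul, Int.reduceAdd, Int.reduceNeg, Int.reduceSub, Int.reduceEq, sub_self]
  all_goals intros; try and_intros
  all_goals (intros; first | omega | simp)

set_option maxHeartbeats 1000000 in
theorem e6_o5 :
    Cov (Option (ZMod (10))) (Fin 2 × ZMod (10)) (6) (5) := by
  refine cov_two (by omega) (by omega) (by omega) (by omega)
    ⟨[⟨1, 5, 1, 1, 0, 0, 1, 0, 1, 0⟩,
    ⟨6, -6, 1, 1, 0, 0, -1, 0, 0, 0⟩,
    ⟨0, 2, 1, 1, 0, 0, 1, 0, 0, 0⟩], 2,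
    [⟨15, -7, 1, 1, 1, 0, -1, 0, 1, 0⟩,
    ⟨8, -1, 1, 1, 0, 0, -1, 0, 0, 1⟩,
    ⟨7, 7, 1, 1, 0, 0, 1, 0, 1, 0⟩,
    ⟨14, 5, 1, 1, 1, 0, 1, 0, 0, 1⟩,
    ⟨19, -16, 1, 1, 1, 0, 1, 1, 1, 1⟩,
    ⟨3, 12, 1, 1, 0, 0, -1, 1, 1, 1⟩], 15, 1⟩
    ⟨[⟨14, -11, 1, 1, 1, 0, 1, 1, 0, 1⟩,
    ⟨3, 2, 1, 1, 0, 0, 1, 0, 1, 1⟩,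
    ⟨5, 6, 1, 1, 0, 0, 1, 0, 1, 1⟩], 11,
    [⟨6, 11, 1, 1, 0, 0, -1, 1, 0, 1⟩,
    ⟨17, -17, 1, 1, 1, 0, 1, 1, 1, 0⟩,
    ⟨0, 12, 1, 1, 0, 0, -1, 1, 0, 0⟩,
    ⟨12, -4, 1, 1, 1, 0, -1, 0, 0, 0⟩,
    ⟨8, 1, 1, 1, 0, 0, 1, 0, 0, 1⟩,
    ⟨9, -3, 1, 1, 0, 0, -1, 0, 1, 0⟩], 6, 1⟩
    0 0 0 0 1 6 0 6 0 (Or.inl ⟨rfl, ?_⟩) ?_ ?_ ?_ ?_ ?_ ?_ <;>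
  simp only [Blk.ok2, cover2, chain, hd, tot, par, phit2, placed, ehit2, and_true, true_and, or_false, false_and,
    false_or, one_mul, neg_mul, mul_zero, mul_one, add_zero, sub_zero, zero_ne_one, one_ne_zero, zero_mul, Int.reduceMod,
    Int.reduceMul, Int.reduceAdd, Int.reduceNeg, Int.reduceSub, Int.reduceEq, sub_self]
  all_goals intros; try and_intros
  all_goals (intros; first | omega | simp)



section T1b

/-- accumulated bits along a sequence of runs, each with a prescribed bit change -/
def bsum : List (Run × ℤ) → ℕ → ℤ
  | [], _ => 0
  | R :: Rs, t => if t < R.1.n then t * (1 + R.2) else R.1.n * (1 + R.2) + bsum Rs (t - R.1.n)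

def btot : List (Run × ℤ) → ℤ
  | [] => 0
  | R :: Rs => R.1.n * (1 + R.2) + btot Rs

theorem bsum_zero (Q : List (Run × ℤ)) : bsum Q 0 = 0 := by
  induction Q with
  | nil => rfl
  | cons R Q ih =>
    unfold bsum
    split_ifs with h
    · simp
    · have : R.1.n = 0 := by omega
      simp [this, ih]

theorem bsum_tot (Q : List (Run × ℤ)) : bsum Q (tot (Q.map Prod.fst)) = btot Q := by
  induction Q with
  | nil => rfl
  | cons R Q ih =>
    simp only [bsum, List.map_cons, tot, btot]
    rw [if_neg (by omega), Nat.add_sub_cancel_left, ih]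

theorem sq_edge3 (m : ℤ) (Q : List (Run × ℤ)) (b : ℤ) (h : chain m (Q.map Prod.fst) b)
    (R : Run × ℤ) (hR : R ∈ Q) (j : ℕ) (hj : j < R.1.n) :
    ∃ t < tot (Q.map Prod.fst), sq m (Q.map Prod.fst) b t = R.1.pt m j ∧
      sq m (Q.map Prod.fst) b (t + 1) = R.1.pt m (j + 1) ∧ bsum Q (t + 1) = bsum Q t + 1 + R.2 := by
  induction Q with
  | nil => simp at hR
  | cons R' Q ih =>
    simp only [List.map_cons] at h ⊢
    rcases List.mem_cons.1 hR with rfl | hR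
    · refine ⟨j, by unfold tot; omega, ?_, ?_, ?_⟩
      · unfold sq; rw [if_pos hj]
      · unfold sq
        split_ifs with h1
        · rfl
        · have : j + 1 = R.1.n := by omega
          rw [this, Nat.sub_self, sq_zero m _ b h.2, pt_end m R.1 _ b h]
      · unfold bsum
        rw [if_pos hj]
        split_ifs with h1
        · push_cast; ring
        · have : j + 1 = R.1.n := by omega
          rw [this, Nat.sub_self, bsum_zero, ← this]; push_cast; ring
    · obtain ⟨t, ht, h1, h2, h3⟩ := ih h.2 hR
      refine ⟨R'.1.n + t, by unfold tot; omega, ?_, ?_, ?_⟩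
      · unfold sq; rw [if_neg (by omega), Nat.add_sub_cancel_left, h1]
      · unfold sq; rw [if_neg (by omega), Nat.add_assoc, Nat.add_sub_cancel_left, h2]
      · unfold bsum
        rw [if_neg (by omega), if_neg (by omega), Nat.add_assoc, Nat.add_sub_cancel_left,
          Nat.add_sub_cancel_left, h3]
        ring

/-- length `δ` (of parity `c`) with base parity `p` and bit change `q` -/
def ehit3 (M δ p c q : ℤ) : List (Run × ℤ) → Prop
  | [] => False
  | R :: Rs => (R.2 = q ∧ ehit2 M δ p c [R.1]) ∨ ehit3 M δ p c q Rs

theorem ehit3_sound {M δ p c q : ℤ} (hM : M % 2 = 0) (hδ : (δ - c) % 2 = 0) {Q : List (Run × ℤ)}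
    {b : ℤ} (hc : chain 2 (Q.map Prod.fst) b) (hp : par (Q.map Prod.fst)) (h : ehit3 M δ p c q Q) :
    ∃ t < tot (Q.map Prod.fst), bsum Q (t + 1) = bsum Q t + 1 + q ∧
      ((Df M δ (sq 2 (Q.map Prod.fst) b t) (sq 2 (Q.map Prod.fst) b (t + 1)) ∧
        (sq 2 (Q.map Prod.fst) b t - p) % 2 = 0) ∨
      (Df M δ (sq 2 (Q.map Prod.fst) b (t + 1)) (sq 2 (Q.map Prod.fst) b t) ∧
        (sq 2 (Q.map Prod.fst) b (t + 1) - p) % 2 = 0)) := by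
  have key : ∃ R ∈ Q, R.2 = q ∧ ehit 2 M δ p [R.1] := by
    clear hc
    induction Q with
    | nil => exact h.elim
    | cons R Q ih =>
      simp only [List.map_cons] at hp
      rcases h with ⟨h1, h2⟩ | h
      · exact ⟨R, by simp, h1, ehit2_ehit hM hδ ⟨hp.1, hp.2.1, trivial⟩ h2⟩
      · obtain ⟨R', hR, h'⟩ := ih hp.2.2 h
        exact ⟨R', List.mem_cons_of_mem _ hR, h'⟩
  obtain ⟨R, hR, hq, hh⟩ := key
  have hch : chain 2 [R.1] (R.1.pt 2 R.1.n) := by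
    refine ⟨?_, trivial⟩
    unfold hd Run.pt
    rcases Nat.mod_two_eq_zero_or_one R.1.n with h0 | h0
    · left; rw [if_pos h0]; exact ⟨h0, by push_cast; ring⟩
    · right; rw [if_neg (by omega)]; exact ⟨h0, by push_cast; ring⟩
  obtain ⟨j, hj, hd⟩ := ehit_sound M δ p [R.1] _ hch hh
  have hj' : j < R.1.n := by simpa [tot] using hj
  obtain ⟨t, ht, e1, e2, e3⟩ := sq_edge3 2 Q b hc R hR j hj'
  have f1 : sq 2 [R.1] (R.1.pt 2 R.1.n) j = R.1.pt 2 j := by unfold sq; rw [if_pos hj']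
  have f2 : sq 2 [R.1] (R.1.pt 2 R.1.n) (j + 1) = R.1.pt 2 (j + 1) := by
    unfold sq
    split_ifs with h1
    · rfl
    · rw [show j + 1 = R.1.n by omega]; rfl
  rw [f1, f2] at hd
  refine ⟨t, ht, by rw [e3, hq], ?_⟩
  rw [e1, e2]; exact hd

/-- a base block with bits `t` which do not change under translation -/
def Starter.cfgB {e o N : ℕ} (S : Starter e o N) (t : ℕ → Fin 2) (j : ℤ) : Cfg (Option (ZMod N)) e o where
  u i := if i = S.z then none else some ((S.I i + 2 * j : ℤ) : ZMod N)
  t := t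
  inj := by
    intro i hi i' hi' h
    split_ifs at h with h1 h2 h2
    · omega
    · have h3 := Option.some.inj h
      rw [ZMod.intCast_eq_intCast_iff_dvd_sub] at h3
      exact (S.inj i' hi' i hi h2 h1 (by
        have e1 : S.I i' + 2 * j - (S.I i + 2 * j) = S.I i' - S.I i := by ring
        rwa [e1] at h3)).symm

theorem shift_toB (h : ℕ) (hh : 0 < h) (A X : ℤ) (hp : (A - X) % 2 = 0) :
    ∃ j : ZMod h, ∃ w : ℤ, A + 2 * (j.val : ℤ) = X + (2 * h : ℕ) * w := by
  haveI : NeZero h := ⟨by omega⟩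
  refine ⟨(((X - A) / 2 : ℤ) : ZMod h), ?_⟩
  rw [ZMod.val_intCast]
  have h3 := Int.emod_add_mul_ediv ((X - A) / 2) h
  refine ⟨-((X - A) / 2 / h), ?_⟩
  have : 2 * ((X - A) / 2) = X - A := by omega
  push_cast
  linear_combination this + 2 * h3

theorem cov_T1b {e o h : ℕ} (hh : 0 < h) (he : 2 ≤ e) (ho : 2 ≤ o)
    (S : Fin 2 → Starter e o (2 * h)) (t : Fin 2 → Fin 2 → ℕ → Fin 2)
    (hcov : ∀ X Y δ : ℤ, 1 ≤ δ → δ ≤ h → Y - X = δ → ∀ p q, ∃ k κ, ∃ i < e + o, i ≠ (S k).z ∧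
      nxt e o i ≠ (S k).z ∧
      ((Df (2 * h : ℕ) (Y - X) ((S k).I i) ((S k).I (nxt e o i)) ∧ ((S k).I i - X) % 2 = 0 ∧
        t k κ i + 1 = p ∧ t k κ (nxt e o i) = q) ∨
       (Df (2 * h : ℕ) (Y - X) ((S k).I (nxt e o i)) ((S k).I i) ∧ ((S k).I (nxt e o i) - X) % 2 = 0 ∧
        t k κ i + 1 = q ∧ t k κ (nxt e o i) = p)))
    (hinf : ∀ (X : ℤ) (b q : Fin 2), ∃ k κ,
      (((S k).I (nxt e o (S k).z) - X) % 2 = 0 ∧ t k κ (S k).z + 1 = b ∧ t k κ (nxt e o (S k).z) = q) ∨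
      (∃ i < e + o, i ≠ (S k).z ∧ nxt e o i = (S k).z ∧ ((S k).I i - X) % 2 = 0 ∧ t k κ i + 1 = q ∧
        t k κ (S k).z = b)) :
    Cov (Option (ZMod (2 * h))) (Fin 2 × Fin 2 × ZMod h) e o := by
  refine ⟨fun k => (S k.1).cfgB (t k.1 k.2.1) k.2.2.val, ?_⟩
  have castw : ∀ X w : ℤ, ((X + (2 * h : ℕ) * w : ℤ) : ZMod (2 * h)) = X := by
    intro X w
    rw [eq_comm, ZMod.intCast_eq_intCast_iff_dvd_sub]
    exact ⟨w, by ring⟩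
  have main : ∀ X Y δ : ℤ, 1 ≤ δ → δ ≤ h → Y - X = δ → ∀ p q, ∃ k : Fin 2 × Fin 2 × ZMod h,
      ((S k.1).cfgB (t k.1 k.2.1) k.2.2.val).E (some (X : ZMod (2 * h))) p (some (Y : ZMod (2 * h))) q ∨
      ((S k.1).cfgB (t k.1 k.2.1) k.2.2.val).E (some (Y : ZMod (2 * h))) q (some (X : ZMod (2 * h))) p := by
    intro X Y δ h1 h2 h3 p q
    obtain ⟨k, κ, i, hi, hz1, hz2, ⟨⟨w, hw⟩, hp, t1, t2⟩ | ⟨⟨w, hw⟩, hp, t1, t2⟩⟩ := hcov X Y δ h1 h2 h3 p q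
    · obtain ⟨j, w', hj⟩ := shift_toB h hh _ X hp
      have hB : (S k).I (nxt e o i) + 2 * (j.val : ℤ) = Y + (2 * h : ℕ) * (w' + w) := by
        linear_combination hj + hw
      refine ⟨(k, κ, j), Or.inl ⟨i, hi, ?_, t1, ?_, t2⟩⟩ <;> simp only [Starter.cfgB]
      · rw [if_neg hz1, hj, castw]
      · rw [if_neg hz2, hB, castw]
    · obtain ⟨j, w', hj⟩ := shift_toB h hh _ X hp
      have hB : (S k).I i + 2 * (j.val : ℤ) = Y + (2 * h : ℕ) * (w' + w) := by
        linear_combination hj + hw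
      refine ⟨(k, κ, j), Or.inr ⟨i, hi, ?_, t1, ?_, t2⟩⟩ <;> simp only [Starter.cfgB]
      · rw [if_neg hz1, hB, castw]
      · rw [if_neg hz2, hj, castw]
  have inf : ∀ (b q : Fin 2) (X : ℤ), ∃ k : Fin 2 × Fin 2 × ZMod h,
      ((S k.1).cfgB (t k.1 k.2.1) k.2.2.val).E none b (some (X : ZMod (2 * h))) q ∨
      ((S k.1).cfgB (t k.1 k.2.1) k.2.2.val).E (some (X : ZMod (2 * h))) q none b := by
    intro b q X
    obtain ⟨k, κ, ⟨hp, t1, t2⟩ | ⟨i, hi, hz1, hz2, hp, t1, t2⟩⟩ := hinf X b q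
    · obtain ⟨j, w', hj⟩ := shift_toB h hh _ X hp
      have hz := nxt_ne he ho (S k).hz
      refine ⟨(k, κ, j), Or.inl ⟨(S k).z, (S k).hz, ?_, t1, ?_, t2⟩⟩ <;> simp only [Starter.cfgB]
      · rw [if_pos trivial]
      · rw [if_neg hz, hj, castw]
    · obtain ⟨j, w', hj⟩ := shift_toB h hh _ X hp
      refine ⟨(k, κ, j), Or.inr ⟨i, hi, ?_, t1, ?_, hz2 ▸ t2⟩⟩ <;> simp only [Starter.cfgB]
      · rw [if_neg hz1, hj, castw]
      · rw [if_pos hz2]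
  intro x y hxy p q
  rcases x with _ | x <;> rcases y with _ | y
  · exact absurd rfl hxy
  · obtain ⟨Y, rfl⟩ := ZMod.intCast_surjective y
    exact inf p q Y
  · obtain ⟨X, rfl⟩ := ZMod.intCast_surjective x
    obtain ⟨k, h⟩ := inf q p X
    exact ⟨k, h.symm⟩
  · obtain ⟨X, rfl⟩ := ZMod.intCast_surjective x
    obtain ⟨Y, rfl⟩ := ZMod.intCast_surjective y
    have h1 := Int.emod_nonneg (Y - X) (show (2 * h : ℤ) ≠ 0 by positivity)
    have h2 := Int.emod_lt_of_pos (Y - X) (show (0 : ℤ) < 2 * h by positivity)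
    have h3 := Int.emod_add_mul_ediv (Y - X) (2 * h)
    set D := (Y - X) % (2 * h) with hD
    have h4 : D ≠ 0 := by
      intro h0
      apply hxy
      congr 1
      rw [ZMod.intCast_eq_intCast_iff_dvd_sub]
      push_cast
      exact Int.dvd_of_emod_eq_zero (hD ▸ h0)
    by_cases h5 : D ≤ h
    · have e1 : (Y : ZMod (2 * h)) = ((X + D : ℤ) : ZMod (2 * h)) := by
        rw [eq_comm, ZMod.intCast_eq_intCast_iff_dvd_sub]
        exact ⟨(Y - X) / (2 * h), by push_cast; linear_combination -h3⟩
      rw [e1]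
      exact main X (X + D) D (by omega) h5 (by ring) p q
    · have e1 : (X : ZMod (2 * h)) = ((Y + (2 * h - D) : ℤ) : ZMod (2 * h)) := by
        rw [eq_comm, ZMod.intCast_eq_intCast_iff_dvd_sub]
        exact ⟨-((Y - X) / (2 * h)) - 1, by push_cast; linear_combination h3⟩
      rw [e1]
      obtain ⟨k, hk⟩ := main Y (Y + (2 * h - D)) (2 * h - D) (by omega) (by omega) (by ring) q p
      exact ⟨k, hk.symm⟩

end T1b


section T1b2

/-- labels which hit every residue class are distinct modulo `N` -/
theorem inj_of_surj (N L : ℕ) (hN : 0 < N) (lo : ℤ) (I : ℕ → ℤ) (Z : Finset ℕ) (hZ : Z.card = N)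
    (hs : ∀ x : ℤ, lo ≤ x → x < lo + N → ∃ i ∈ Z, (N : ℤ) ∣ I i - x) :
    ∀ i ∈ Z, ∀ j ∈ Z, (N : ℤ) ∣ I i - I j → i = j := by
  haveI : NeZero N := ⟨by omega⟩
  have himg : Z.image (fun i => ((I i : ℤ) : ZMod N)) = Finset.univ := by
    rw [Finset.eq_univ_iff_forall]
    intro y
    obtain ⟨Y, rfl⟩ := ZMod.intCast_surjective y
    have h1 := Int.emod_nonneg (Y - lo) (show (N : ℤ) ≠ 0 by omega)
    have h2 := Int.emod_lt_of_pos (Y - lo) (show (0 : ℤ) < N by omega)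
    have h3 := Int.emod_add_mul_ediv (Y - lo) N
    obtain ⟨i, hi, hd⟩ := hs (lo + (Y - lo) % N) (by omega) (by omega)
    refine Finset.mem_image.2 ⟨i, hi, ?_⟩
    rw [eq_comm, ZMod.intCast_eq_intCast_iff_dvd_sub]
    obtain ⟨w, hw⟩ := hd
    exact ⟨w - (Y - lo) / N, by linear_combination hw + h3⟩
  have hinj := Finset.card_image_iff.1 (by rw [himg, hZ, Finset.card_univ, ZMod.card])
  intro i hi j hj hd
  refine hinj hi hj ?_
  show ((I i : ℤ) : ZMod N) = (I j : ℤ)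
  rw [eq_comm, ZMod.intCast_eq_intCast_iff_dvd_sub]; exact hd

/-- parity as a bit -/
def fb (X : ℤ) : Fin 2 := if X % 2 = 0 then 0 else 1

theorem fb_congr {X Y : ℤ} (h : (X - Y) % 2 = 0) : fb X = fb Y := by
  unfold fb; split_ifs <;> first | rfl | omega

theorem fb_succ (X : ℤ) : fb (X + 1) = fb X + 1 := by
  unfold fb; split_ifs <;> first | rfl | omega

/-- length `δ` occurs with base parity `p` and bit change `q` -/
def cover3 (h : ℕ) (P C : List (Run × ℤ)) (δ p c q : ℤ) : Prop :=
  ehit3 (2 * h : ℕ) δ p c q P ∨ ehit3 (2 * h : ℕ) δ p c q C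

theorem cov_e2 {h : ℕ} (hh : 3 ≤ h) (ho : h % 2 = 1) (P C : List (Run × ℤ)) (b c : ℤ)
    (hP : chain 2 (P.map Prod.fst) b) (hC : chain 2 (C.map Prod.fst) c)
    (hc : c = hd (C.map Prod.fst) c) (tP : tot (P.map Prod.fst) + 3 = 2 * h)
    (tC : tot (C.map Prod.fst) + 1 = 2 * h) (pP : par (P.map Prod.fst)) (pC : par (C.map Prod.fst))
    (bC : btot C % 2 = 0)
    (w0 : ∀ x : ℤ, 1 - (h : ℤ) ≤ x → x ≤ h → x % 2 = 0 →
      (x = 0 ∨ b = x ∨ phit2 (2 * h : ℕ) x 0 (P.map Prod.fst)) ∧ phit2 (2 * h : ℕ) x 0 (C.map Prod.fst))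
    (w1 : ∀ x : ℤ, 1 - (h : ℤ) ≤ x → x ≤ h → x % 2 = 1 →
      (x = 1 ∨ phit2 (2 * h : ℕ) x 1 (P.map Prod.fst)) ∧ (x = h ∨ phit2 (2 * h : ℕ) x 1 (C.map Prod.fst)))
    (i0 : hd (P.map Prod.fst) b % 2 = 0) (i1 : b % 2 = 0)
    (hcov0 : ∀ δ : ℤ, 1 ≤ δ → δ < h → δ % 2 = 0 →
      cover3 h P C δ 0 0 0 ∧ cover3 h P C δ 0 0 1 ∧ cover3 h P C δ 1 0 0 ∧ cover3 h P C δ 1 0 1)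
    (hcov1 : ∀ δ : ℤ, 1 ≤ δ → δ < h → δ % 2 = 1 → (δ = 1 ∨ cover3 h P C δ 0 1 0) ∧
      (δ = 1 ∨ cover3 h P C δ 0 1 1) ∧ cover3 h P C δ 1 1 0 ∧ cover3 h P C δ 1 1 1)
    (hcovh : (cover3 h P C h 0 1 0 ∨ cover3 h P C h 1 1 0) ∧ (cover3 h P C h 0 1 1 ∨ cover3 h P C h 1 1 1)) :
    Cov (Option (ZMod (2 * h))) (Fin 2 × Fin 2 × ZMod h) 2 (2 * h - 1) := by
  have hN2 : ((2 * h : ℕ) : ℤ) % 2 = 0 := by omega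
  have bit0 : ∀ p : Fin 2, p ≠ 1 → p = 0 := by decide
  have bit2 : ∀ q : Fin 2, q + 1 + 1 = q := by decide
  -- the first block
  let IF : ℕ → ℤ := fun i => if i < 2 then i else sq 2 (P.map Prod.fst) b (i - 2)
  let IG : ℕ → ℤ := fun i => if i < 2 then h else sq 2 (C.map Prod.fst) c (i - 2)
  have hF : ∀ i ∈ Finset.range (2 * h), ∀ j ∈ Finset.range (2 * h), ((2 * h : ℕ) : ℤ) ∣ IF i - IF j → i = j := by
    refine inj_of_surj (2 * h) 0 (by omega) (1 - h) IF _ (Finset.card_range _) fun x hx1 hx2 => ?_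
    have key : x = 0 ∨ x = 1 ∨ b = x ∨ phit 2 (2 * h : ℕ) x (P.map Prod.fst) := by
      rcases Int.emod_two_eq_zero_or_one x with h0 | h0
      · rcases (w0 x hx1 (by push_cast at hx2; omega) h0).1 with h1 | h1 | h1
        · exact Or.inl h1
        · exact Or.inr (Or.inr (Or.inl h1))
        · exact Or.inr (Or.inr (Or.inr (phit2_phit hN2 (by omega) pP h1)))
      · rcases (w1 x hx1 (by push_cast at hx2; omega) h0).1 with h1 | h1
        · exact Or.inr (Or.inl h1)
        · exact Or.inr (Or.inr (Or.inr (phit2_phit hN2 (by omega) pP h1)))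
    rcases key with rfl | rfl | h1 | h1
    · exact ⟨0, Finset.mem_range.2 (by omega), by simp [IF]⟩
    · exact ⟨1, Finset.mem_range.2 (by omega), by simp [IF]⟩
    · refine ⟨2 + tot (P.map Prod.fst), Finset.mem_range.2 (by omega), ?_⟩
      simp only [IF]
      rw [if_neg (by omega), Nat.add_sub_cancel_left, sq_tot, h1]; simp
    · obtain ⟨t, ht, hd⟩ := phit_sound 2 _ x (by norm_num) _ _ hP h1
      refine ⟨2 + t, Finset.mem_range.2 (by omega), ?_⟩
      simp only [IF]
      rw [if_neg (by omega), Nat.add_sub_cancel_left]; exact hd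
  have hG : ∀ i ∈ Finset.Icc 1 (2 * h), ∀ j ∈ Finset.Icc 1 (2 * h), ((2 * h : ℕ) : ℤ) ∣ IG i - IG j → i = j := by
    refine inj_of_surj (2 * h) 0 (by omega) (1 - h) IG _ (by simp) fun x hx1 hx2 => ?_
    have key : x = h ∨ phit 2 (2 * h : ℕ) x (C.map Prod.fst) := by
      rcases Int.emod_two_eq_zero_or_one x with h0 | h0
      · exact Or.inr (phit2_phit hN2 (by omega) pC (w0 x hx1 (by push_cast at hx2; omega) h0).2)
      · exact (w1 x hx1 (by push_cast at hx2; omega) h0).2.imp_right (phit2_phit hN2 (by omega) pC)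
    rcases key with rfl | h1
    · exact ⟨1, Finset.mem_Icc.2 (by omega), by simp [IG]⟩
    · obtain ⟨t, ht, hd⟩ := phit_sound 2 _ x (by norm_num) _ _ hC h1
      refine ⟨2 + t, Finset.mem_Icc.2 (by omega), ?_⟩
      simp only [IG]
      rw [if_neg (by omega), Nat.add_sub_cancel_left]; exact hd
  let SF : Starter 2 (2 * h - 1) (2 * h) := ⟨IF, 2 * h, by omega, 0, fun i hi j hj h1 h2 h3 =>
    hF i (Finset.mem_range.2 (by omega)) j (Finset.mem_range.2 (by omega)) h3⟩
  let SG : Starter 2 (2 * h - 1) (2 * h) := ⟨IG, 0, by omega, 0, fun i hi j hj h1 h2 h3 =>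
    hG i (Finset.mem_Icc.2 (by omega)) j (Finset.mem_Icc.2 (by omega)) h3⟩
  let tF : Fin 2 → ℕ → Fin 2 := fun κ i => if i = 0 then 0 else if i = 1 then κ else
    if i = 2 * h then 0 else κ + fb (bsum P (i - 2))
  let tG : Fin 2 → ℕ → Fin 2 := fun κ i => if i = 0 then 0 else if i = 1 then κ else κ + fb (bsum C (i - 2))
  -- consecutive labels are neighbours
  have eF : ∀ t < tot (P.map Prod.fst), nxt 2 (2 * h - 1) (2 + t) = 2 + (t + 1) := by
    intro t ht; unfold nxt; split_ifs <;> omega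
  have edge : ∀ (X Y π : ℤ) (p q : Fin 2), q = p + fb π →
      ((∃ t < tot (P.map Prod.fst), sq 2 (P.map Prod.fst) b t = X ∧ sq 2 (P.map Prod.fst) b (t + 1) = Y ∧
          bsum P (t + 1) = bsum P t + 1 + π) ∨
       (∃ t < tot (C.map Prod.fst), sq 2 (C.map Prod.fst) c t = X ∧ sq 2 (C.map Prod.fst) c (t + 1) = Y ∧
          bsum C (t + 1) = bsum C t + 1 + π)) →
      ∃ k κ, ∃ i < 2 + (2 * h - 1), i ≠ (![SF, SG] k).z ∧ nxt 2 (2 * h - 1) i ≠ (![SF, SG] k).z ∧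
        (![SF, SG] k).I i = X ∧ (![SF, SG] k).I (nxt 2 (2 * h - 1) i) = Y ∧
        (![tF, tG] k) κ i + 1 = p ∧ (![tF, tG] k) κ (nxt 2 (2 * h - 1) i) = q := by
    have alg : ∀ (s π : ℤ) (p q : Fin 2), q = p + fb π →
        (p + fb s + 1) + fb s + 1 = p ∧ (p + fb s + 1) + fb (s + 1 + π) = q := by
      intro s π p q hq
      have e : fb (s + 1 + π) = fb s + 1 + fb π := by
        unfold fb; split_ifs <;> first | rfl | omega
      rw [e, hq]; clear hq e
      generalize fb s = x; generalize fb π = y; revert p x y; decide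
    intro X Y π p q hpq hX
    rcases hX with ⟨t, ht, h1, h2, h3⟩ | ⟨t, ht, h1, h2, h3⟩
    · have al := alg (bsum P t) π p q hpq
      refine ⟨0, p + fb (bsum P t) + 1, 2 + t, by omega, ?_, ?_, ?_, ?_, ?_, ?_⟩ <;>
        simp only [Matrix.cons_val_zero, SF, IF, tF, eF t ht]
      · omega
      · omega
      · rw [if_neg (by omega), Nat.add_sub_cancel_left]; exact h1
      · rw [if_neg (by omega), Nat.add_sub_cancel_left]; exact h2
      · rw [if_neg (by omega), if_neg (by omega), if_neg (by omega), Nat.add_sub_cancel_left]; exact al.1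
      · rw [if_neg (by omega), if_neg (by omega), if_neg (by omega), Nat.add_sub_cancel_left, h3]; exact al.2
    · have al := alg (bsum C t) π p q hpq
      have hn : ∃ t', nxt 2 (2 * h - 1) (2 + t) = 2 + t' ∧ sq 2 (C.map Prod.fst) c t' = Y ∧
          fb (bsum C t') = fb (bsum C t + 1 + π) := by
        by_cases hl : t + 1 = tot (C.map Prod.fst)
        · refine ⟨0, by unfold nxt; split_ifs <;> omega, ?_, ?_⟩
          · rw [sq_zero _ _ _ hC, ← h2, hl, sq_tot, ← hc]
          · rw [← h3, hl, bsum_tot, bsum_zero]; exact fb_congr (by omega)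
        · exact ⟨t + 1, by unfold nxt; split_ifs <;> omega, h2, by rw [h3]⟩
      obtain ⟨t', n1, n2, n3⟩ := hn
      refine ⟨1, p + fb (bsum C t) + 1, 2 + t, by omega, ?_, ?_, ?_, ?_, ?_, ?_⟩ <;>
        simp only [Matrix.cons_val_one, Matrix.cons_val_zero, SG, IG, tG, n1]
      · omega
      · omega
      · rw [if_neg (by omega), Nat.add_sub_cancel_left]; exact h1
      · rw [if_neg (by omega), Nat.add_sub_cancel_left]; exact n2
      · rw [if_neg (by omega), if_neg (by omega), Nat.add_sub_cancel_left]; exact al.1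
      · rw [if_neg (by omega), if_neg (by omega), Nat.add_sub_cancel_left, n3]; exact al.2
  refine cov_T1b (by omega) le_rfl (by omega) ![SF, SG] ![tF, tG] ?_ ?_
  · intro X Y δ d1 d2 d3 p q
    obtain ⟨π, hπ, hpq⟩ : ∃ π : ℤ, (π = 0 ∨ π = 1) ∧ q = p + fb π := by
      by_cases hpq : p = q
      · exact ⟨0, Or.inl rfl, by rw [hpq]; simp [fb]⟩
      · exact ⟨1, Or.inr rfl, by revert hpq; revert p q; decide⟩
    have hqp : p = q + fb π := by
      rw [hpq]; clear hpq; generalize fb π = x; revert p x; decide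
    have use : ∀ x r c' : ℤ, (r = X ∨ (r = Y ∧ δ = h)) → (x - r) % 2 = 0 → (δ - c') % 2 = 0 →
        cover3 h P C δ x c' π → ∃ k κ, ∃ i < 2 + (2 * h - 1), i ≠ (![SF, SG] k).z ∧
      nxt 2 (2 * h - 1) i ≠ (![SF, SG] k).z ∧
      ((Df (2 * h : ℕ) (Y - X) ((![SF, SG] k).I i) ((![SF, SG] k).I (nxt 2 (2 * h - 1) i)) ∧
        ((![SF, SG] k).I i - X) % 2 = 0 ∧
        (![tF, tG] k) κ i + 1 = p ∧ (![tF, tG] k) κ (nxt 2 (2 * h - 1) i) = q) ∨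
       (Df (2 * h : ℕ) (Y - X) ((![SF, SG] k).I (nxt 2 (2 * h - 1) i)) ((![SF, SG] k).I i) ∧
        ((![SF, SG] k).I (nxt 2 (2 * h - 1) i) - X) % 2 = 0 ∧
        (![tF, tG] k) κ i + 1 = q ∧ (![tF, tG] k) κ (nxt 2 (2 * h - 1) i) = p)) := by
      intro x r c' hr hx hc' hcv
      have hcv' : ∃ A B : ℤ, ((Df (2 * h : ℕ) δ A B ∧ (A - x) % 2 = 0) ∨ (Df (2 * h : ℕ) δ B A ∧ (B - x) % 2 = 0)) ∧
        ((∃ t < tot (P.map Prod.fst), sq 2 (P.map Prod.fst) b t = A ∧ sq 2 (P.map Prod.fst) b (t + 1) = B ∧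
          bsum P (t + 1) = bsum P t + 1 + π) ∨
         (∃ t < tot (C.map Prod.fst), sq 2 (C.map Prod.fst) c t = A ∧ sq 2 (C.map Prod.fst) c (t + 1) = B ∧
          bsum C (t + 1) = bsum C t + 1 + π)) := by
        rcases hcv with hcv | hcv
        · obtain ⟨t, ht, h1, h2⟩ := ehit3_sound hN2 hc' hP pP hcv
          exact ⟨_, _, h2, Or.inl ⟨t, ht, rfl, rfl, h1⟩⟩
        · obtain ⟨t, ht, h1, h2⟩ := ehit3_sound hN2 hc' hC pC hcv
          exact ⟨_, _, h2, Or.inr ⟨t, ht, rfl, rfl, h1⟩⟩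
      obtain ⟨A, B, hAB, hX⟩ := hcv'
      -- orient the edge
      have ori : (Df (2 * h : ℕ) (Y - X) A B ∧ (A - X) % 2 = 0) ∨ (Df (2 * h : ℕ) (Y - X) B A ∧ (B - X) % 2 = 0) := by
        rcases hr with rfl | ⟨rfl, hδ⟩
        · rcases hAB with ⟨h1, h2⟩ | ⟨h1, h2⟩
          · exact Or.inl ⟨d3.symm ▸ h1, by omega⟩
          · exact Or.inr ⟨d3.symm ▸ h1, by omega⟩
        · rcases hAB with ⟨⟨w, h1⟩, h2⟩ | ⟨⟨w, h1⟩, h2⟩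
          · refine Or.inr ⟨⟨-w - 1, by push_cast at h1 ⊢; linear_combination -h1 - d3 - 2 * hδ⟩, ?_⟩
            have h3 : (((2 * h : ℕ) : ℤ) * w) % 2 = 0 := by rw [Int.mul_emod, hN2]; simp
            omega
          · refine Or.inl ⟨⟨-w - 1, by push_cast at h1 ⊢; linear_combination -h1 - d3 - 2 * hδ⟩, ?_⟩
            have h3 : (((2 * h : ℕ) : ℤ) * w) % 2 = 0 := by rw [Int.mul_emod, hN2]; simp
            omega
      rcases ori with ori | ori
      · obtain ⟨k, κ, i, a1, a2, a3, a4, a5, a6, a7⟩ := edge A B π p q hpq hX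
        exact ⟨k, κ, i, a1, a2, a3, Or.inl ⟨by rw [a4, a5]; exact ori.1, by rw [a4]; exact ori.2, a6, a7⟩⟩
      · obtain ⟨k, κ, i, a1, a2, a3, a4, a5, a6, a7⟩ := edge A B π q p hqp hX
        exact ⟨k, κ, i, a1, a2, a3, Or.inr ⟨by rw [a4, a5]; exact ori.1, by rw [a5]; exact ori.2, a6, a7⟩⟩
    by_cases hdig : δ = 1 ∧ X % 2 = 0
    · -- the digon
      have hn0 : nxt 2 (2 * h - 1) 0 = 1 := by unfold nxt; split_ifs <;> omega
      have hn1 : nxt 2 (2 * h - 1) 1 = 0 := by unfold nxt; split_ifs <;> omega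
      by_cases h1 : p = 1
      · refine ⟨0, q, 0, by omega, ?_, ?_, Or.inl ⟨?_, ?_, ?_, ?_⟩⟩ <;>
          simp only [Matrix.cons_val_zero, SF, IF, tF, hn0]
        · omega
        · omega
        · exact ⟨0, by simp; omega⟩
        · simp; omega
        · rw [h1]; rfl
        · simp
      · have h0 : p = 0 := bit0 p h1
        refine ⟨0, q + 1, 1, by omega, ?_, ?_, Or.inr ⟨?_, ?_, ?_, ?_⟩⟩ <;>
          simp only [Matrix.cons_val_zero, SF, IF, tF, hn1]
        · omega
        · omega
        · exact ⟨0, by simp; omega⟩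
        · simp; omega
        · simp; exact bit2 q
        · simp [h0]
    · rcases eq_or_lt_of_le d2 with hlt | hlt
      · have hcv : cover3 h P C δ 0 1 π ∨ cover3 h P C δ 1 1 π := by
          rw [hlt]
          rcases hπ with rfl | rfl
          · exact hcovh.1
          · exact hcovh.2
        have hY : ∀ x : ℤ, (x = 0 ∨ x = 1) → ∃ r, (r = X ∨ (r = Y ∧ δ = h)) ∧ (x - r) % 2 = 0 := by
          intro x hx
          by_cases h1 : (x - X) % 2 = 0
          · exact ⟨X, Or.inl rfl, h1⟩
          · exact ⟨Y, Or.inr ⟨rfl, hlt⟩, by omega⟩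
        rcases hcv with hcv | hcv
        · obtain ⟨r, h1, h2⟩ := hY 0 (Or.inl rfl)
          exact use 0 r 1 h1 h2 (by omega) hcv
        · obtain ⟨r, h1, h2⟩ := hY 1 (Or.inr rfl)
          exact use 1 r 1 h1 h2 (by omega) hcv
      · rcases Int.emod_two_eq_zero_or_one δ with e | e
        · obtain ⟨c00, c01, c10, c11⟩ := hcov0 δ d1 hlt e
          rcases Int.emod_two_eq_zero_or_one X with e' | e'
          · exact use 0 X 0 (Or.inl rfl) (by omega) (by omega) (by rcases hπ with rfl | rfl <;> assumption)
          · exact use 1 X 0 (Or.inl rfl) (by omega) (by omega) (by rcases hπ with rfl | rfl <;> assumption)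
        · obtain ⟨c00, c01, c10, c11⟩ := hcov1 δ d1 hlt e
          rcases Int.emod_two_eq_zero_or_one X with e' | e'
          · have hne : δ ≠ 1 := fun h => hdig ⟨h, e'⟩
            have c00 := c00.resolve_left hne
            have c01 := c01.resolve_left hne
            exact use 0 X 1 (Or.inl rfl) (by omega) (by omega) (by rcases hπ with rfl | rfl <;> assumption)
          · exact use 1 X 1 (Or.inl rfl) (by omega) (by omega) (by rcases hπ with rfl | rfl <;> assumption)
  · intro X bb q
    rcases Int.emod_two_eq_zero_or_one X with e' | e'
    · by_cases h1 : bb = 1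
      · refine ⟨0, q, Or.inl ?_⟩
        have hn : nxt 2 (2 * h - 1) (2 * h) = 2 + 0 := by unfold nxt; split_ifs <;> omega
        simp only [Matrix.cons_val_zero, SF, IF, tF, hn]
        refine ⟨?_, ?_, ?_⟩
        · rw [if_neg (by omega), Nat.add_sub_cancel_left, sq_zero _ _ _ hP]; omega
        · rw [if_neg (by omega), if_neg (by omega), if_pos trivial, h1]; rfl
        · rw [if_neg (by omega), if_neg (by omega), if_neg (by omega), Nat.add_sub_cancel_left, bsum_zero]
          simp [fb]
      · have h0 : bb = 0 := bit0 bb h1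
        refine ⟨0, q + fb (bsum P (tot (P.map Prod.fst))) + 1, Or.inr ⟨2 + tot (P.map Prod.fst), by omega, ?_⟩⟩
        have hn : nxt 2 (2 * h - 1) (2 + tot (P.map Prod.fst)) = 2 * h := by unfold nxt; split_ifs <;> omega
        simp only [Matrix.cons_val_zero, SF, IF, tF, hn]
        refine ⟨by omega, trivial, ?_, ?_, ?_⟩
        · rw [if_neg (by omega), Nat.add_sub_cancel_left, sq_tot]; omega
        · rw [if_neg (by omega), if_neg (by omega), if_neg (by omega), Nat.add_sub_cancel_left]
          generalize fb (bsum P (tot (P.map Prod.fst))) = x; revert q x; decide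
        · rw [if_neg (by omega), if_neg (by omega), if_pos trivial, h0]
    · by_cases h1 : bb = 1
      · refine ⟨1, q, Or.inl ?_⟩
        have hn : nxt 2 (2 * h - 1) 0 = 1 := by unfold nxt; split_ifs <;> omega
        simp only [Matrix.cons_val_one, Matrix.cons_val_zero, SG, IG, tG, hn]
        refine ⟨by simp; omega, by rw [h1]; rfl, by simp⟩
      · have h0 : bb = 0 := bit0 bb h1
        refine ⟨1, q + 1, Or.inr ⟨1, by omega, ?_⟩⟩
        have hn : nxt 2 (2 * h - 1) 1 = 0 := by unfold nxt; split_ifs <;> omega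
        simp only [Matrix.cons_val_one, Matrix.cons_val_zero, SG, IG, tG, hn]
        refine ⟨by omega, trivial, by simp; omega, ?_, by simp [h0]⟩
        simp; exact bit2 q

end T1b2

set_option maxHeartbeats 2000000 in
theorem e2_odda (y : ℕ) : Cov (Option (ZMod (2 * (4 * y + 3)))) (Fin 2 × Fin 2 × ZMod (4 * y + 3)) 2
    (2 * (4 * y + 3) - 1) := by
  refine cov_e2 (by omega) (by omega)
    [(⟨4 * y + 2, -8 * y - 2, 1, 2 * y, 0, 0, 1, 1, 0, 0⟩, 1),
    (⟨2 * y + 2, -4 * y - 2, 1, 2 * y, 0, 0, -1, 0, 0, 0⟩, 0),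
    (⟨2, -3, 1, 1, 0, 0, -1, 0, 0, 1⟩, 0),
    (⟨-1, 4, 1, 2 * y, 0, 0, 1, 0, 1, 1⟩, 0),
    (⟨-2 * y - 1, 4 * y + 4, 1, 2 * y + 1, 0, 0, -1, 1, 1, 1⟩, 1),
    (⟨4 * y + 3, -8 * y - 5, 1, 1, 0, 0, 1, 1, 1, 0⟩, 0)]
    [(⟨0, 2, 1, 1, 0, 0, 1, 0, 0, 0⟩, 0),
    (⟨2, -5, -1, 2 * y, 0, 0, -1, 0, 0, 1⟩, 0),
    (⟨2 * y + 2, -4 * y - 5, -1, 2 * y, 0, 0, 1, 1, 0, 1⟩, 1),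
    (⟨4 * y + 2, -8 * y - 4, 1, 1, 0, 0, 1, 1, 0, 0⟩, 1),
    (⟨-4 * y - 2, 8 * y + 3, -1, 2 * y + 1, 0, 0, -1, 1, 0, 1⟩, 1),
    (⟨2 * y + 1, -4 * y - 1, 1, 2 * y, 0, 0, -1, 0, 1, 0⟩, 0),
    (⟨1, -2, 1, 1, 0, 0, -1, 0, 1, 1⟩, 0),
    (⟨-1, 1, 1, 1, 0, 0, 1, 0, 1, 0⟩, 1)]
    (-4 * y - 2) 0 ?_ ?_ ?_ ?_ ?_ ?_ ?_ ?_ ?_ ?_ ?_ ?_ ?_ ?_ ?_ <;>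
  simp only [cover3, ehit3, btot, List.map_cons, List.map_nil, chain, hd, tot, par, phit2, ehit2, and_true, true_and, or_false,
    false_and, false_or, one_mul, neg_mul, mul_zero, mul_one, add_zero, sub_zero, zero_add, zero_ne_one, one_ne_zero, zero_mul,
    Int.reduceMod, Int.reduceMul, Int.reduceAdd, Int.reduceNeg, Int.reduceSub, Int.reduceEq, sub_self]
  all_goals intros; try and_intros
  all_goals (intros; omega)

set_option maxHeartbeats 2000000 in
theorem e2_oddb (y : ℕ) : Cov (Option (ZMod (2 * (4 * y + 5)))) (Fin 2 × Fin 2 × ZMod (4 * y + 5)) 2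
    (2 * (4 * y + 5) - 1) := by
  refine cov_e2 (by omega) (by omega)
    [(⟨4 * y + 4, -8 * y - 6, 1, 2 * y + 1, 0, 0, 1, 1, 0, 0⟩, 1),
    (⟨-2 * y - 2, 4 * y + 4, -1, 2 * y + 1, 0, 0, 1, 0, 0, 0⟩, 0),
    (⟨2, -3, 1, 1, 0, 0, -1, 0, 0, 1⟩, 0),
    (⟨-1, 4, 1, 2 * y + 1, 0, 0, 1, 0, 1, 1⟩, 0),
    (⟨2 * y + 3, -4 * y - 6, -1, 2 * y + 2, 0, 0, 1, 1, 1, 1⟩, 1),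
    (⟨4 * y + 5, -8 * y - 9, 1, 1, 0, 0, 1, 1, 1, 0⟩, 0)]
    [(⟨0, 2, 1, 1, 0, 0, 1, 0, 0, 0⟩, 0),
    (⟨2, -5, -1, 2 * y + 1, 0, 0, -1, 0, 0, 1⟩, 0),
    (⟨-2 * y - 3, 4 * y + 7, 1, 2 * y + 1, 0, 0, -1, 1, 1, 0⟩, 1),
    (⟨4 * y + 4, -8 * y - 8, 1, 1, 0, 0, 1, 1, 0, 0⟩, 1),
    (⟨-4 * y - 4, 8 * y + 7, -1, 2 * y + 2, 0, 0, -1, 1, 0, 1⟩, 1),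
    (⟨-2 * y - 2, 4 * y + 3, -1, 2 * y + 1, 0, 0, 1, 0, 0, 1⟩, 0),
    (⟨1, -2, 1, 1, 0, 0, -1, 0, 1, 1⟩, 0),
    (⟨-1, 1, 1, 1, 0, 0, 1, 0, 1, 0⟩, 1)]
    (-4 * y - 4) 0 ?_ ?_ ?_ ?_ ?_ ?_ ?_ ?_ ?_ ?_ ?_ ?_ ?_ ?_ ?_ <;>
  simp only [cover3, ehit3, btot, List.map_cons, List.map_nil, chain, hd, tot, par, phit2, ehit2, and_true, true_and, or_false,
    false_and, false_or, one_mul, neg_mul, mul_zero, mul_one, add_zero, sub_zero, zero_add, zero_ne_one, one_ne_zero, zero_mul,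
    Int.reduceMod, Int.reduceMul, Int.reduceAdd, Int.reduceNeg, Int.reduceSub, Int.reduceEq, sub_self]
  all_goals intros; try and_intros
  all_goals (intros; omega)



section T1c

/-- the three colours of positions as affine functions of two free bits -/
def cbit (κ : Fin 2 × Fin 2) (x : Fin 3) : Fin 2 :=
  if x = 0 then κ.1 else if x = 1 then κ.2 else κ.1 + κ.2

theorem cbit_solve (x y : Fin 3) (h : x ≠ y) (p q : Fin 2) : ∃ κ, cbit κ x + 1 = p ∧ cbit κ y = q := by
  revert x y p q; decide

/-- a family of labellings covering every pair gives a covering family, using four lifts of each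
labelling which come from a proper 3-colouring of the positions -/
theorem cov_col {V J : Type} {e o : ℕ} (u : J → ℕ → V)
    (inj : ∀ j, ∀ i < e + o, ∀ i' < e + o, u j i = u j i' → i = i') (col : ℕ → Fin 3)
    (hcol : ∀ i < e + o, col i ≠ col (nxt e o i))
    (hcov : ∀ x y, x ≠ y → ∃ j, ∃ i < e + o, (u j i = x ∧ u j (nxt e o i) = y) ∨
      (u j i = y ∧ u j (nxt e o i) = x)) : Cov V ((Fin 2 × Fin 2) × J) e o := by
  refine ⟨fun k => ⟨u k.2, fun i => cbit k.1 (col i), inj k.2⟩, fun x y hxy p q => ?_⟩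
  obtain ⟨j, i, hi, ⟨h1, h2⟩ | ⟨h1, h2⟩⟩ := hcov x y hxy
  · obtain ⟨κ, k1, k2⟩ := cbit_solve _ _ (hcol i hi) p q
    exact ⟨(κ, j), Or.inl ⟨i, hi, h1, k1, h2, k2⟩⟩
  · obtain ⟨κ, k1, k2⟩ := cbit_solve _ _ (hcol i hi) q p
    exact ⟨(κ, j), Or.inr ⟨i, hi, h1, k1, h2, k2⟩⟩

/-- a starter which is invariant under the translation by `h`: an even cycle `C, C + h` and an odd
cycle `∞, P, P + h` with the second path traversed backwards -/
theorem cov_sym {q r h : ℕ} (hq : 2 ≤ q) (hr : 1 ≤ r) (hh : h = q + r) (P C : List Run)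
    (b c lo wb wc : ℤ) (hP : chain 1 P b) (hC : chain 1 C c) (tP : tot P + 1 = r) (tC : tot C = q)
    (hc : c = hd C c + h + 2 * h * wc)
    (hlab : ∀ x : ℤ, lo ≤ x → x < lo + h → b = x + h * wb ∨ phit 1 h x P ∨ phit 1 h x C)
    (hcov : ∀ δ : ℤ, 1 ≤ δ → δ < h → dhit 1 (2 * h) δ P ∨ dhit 1 (2 * h) δ C) :
    Cov (Option (ZMod (2 * h))) ((Fin 2 × Fin 2) × ZMod h) (2 * q) (2 * r + 1) := by
  haveI : NeZero h := ⟨by omega⟩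
  let L : ℕ → ℤ := fun i => if i < q then sq 1 C c i else if i < 2 * q then sq 1 C c (i - q) + h else
    if i ≤ 2 * q + r then sq 1 P b (i - 2 * q - 1) else sq 1 P b (2 * q + 2 * r - i) + h
  have LC1 : ∀ t < q, L t = sq 1 C c t := fun t ht => by simp only [L]; rw [if_pos ht]
  have LC2 : ∀ t < q, L (q + t) = sq 1 C c t + h := fun t ht => by
    simp only [L]; rw [if_neg (by omega), if_pos (by omega), Nat.add_sub_cancel_left]
  have LP1 : ∀ t < r, L (2 * q + 1 + t) = sq 1 P b t := fun t ht => by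
    simp only [L]
    rw [if_neg (by omega), if_neg (by omega), if_pos (by omega), show 2 * q + 1 + t - 2 * q - 1 = t by omega]
  have LP2 : ∀ t < r, L (2 * q + 2 * r - t) = sq 1 P b t + h := fun t ht => by
    simp only [L]
    rw [if_neg (by omega), if_neg (by omega), if_neg (by omega),
      show 2 * q + 2 * r - (2 * q + 2 * r - t) = t by omega]
  -- all labels are distinct
  have hinj : ∀ i ∈ (Finset.range (2 * q + (2 * r + 1))).erase (2 * q),
      ∀ j ∈ (Finset.range (2 * q + (2 * r + 1))).erase (2 * q), ((2 * h : ℕ) : ℤ) ∣ L i - L j → i = j := by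
    refine inj_of_surj (2 * h) 0 (by omega) lo L _ ?_ fun x _ _ => ?_
    · rw [Finset.card_erase_of_mem (Finset.mem_range.2 (by omega)), Finset.card_range]; omega
    · have h1 := Int.emod_nonneg (x - lo) (show (h : ℤ) ≠ 0 by omega)
      have h2 := Int.emod_lt_of_pos (x - lo) (show (0 : ℤ) < h by omega)
      have h3 := Int.emod_add_mul_ediv (x - lo) h
      have key : (∃ t < r, (h : ℤ) ∣ sq 1 P b t - x) ∨ (∃ t < q, (h : ℤ) ∣ sq 1 C c t - x) := by
        have sh : ∀ y : ℤ, (h : ℤ) ∣ y - (lo + (x - lo) % h) → (h : ℤ) ∣ y - x := by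
          rintro y ⟨w, hw⟩
          exact ⟨w - (x - lo) / h, by linear_combination hw + h3⟩
        rcases hlab (lo + (x - lo) % h) (by omega) (by omega) with h0 | h0 | h0
        · exact Or.inl ⟨tot P, by omega, sh _ ⟨wb, by rw [sq_tot, h0]; ring⟩⟩
        · obtain ⟨t, ht, hd⟩ := phit_sound 1 _ _ one_pos _ _ hP h0
          exact Or.inl ⟨t, by omega, sh _ hd⟩
        · obtain ⟨t, ht, hd⟩ := phit_sound 1 _ _ one_pos _ _ hC h0
          exact Or.inr ⟨t, by omega, sh _ hd⟩
      have par2 : ∀ y : ℤ, (h : ℤ) ∣ y - x → ((2 * h : ℕ) : ℤ) ∣ y - x ∨ ((2 * h : ℕ) : ℤ) ∣ y + h - x := by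
        rintro y ⟨w, hw⟩
        rcases Int.even_or_odd' w with ⟨v, rfl | rfl⟩
        · exact Or.inl ⟨v, by rw [hw]; push_cast; ring⟩
        · exact Or.inr ⟨v + 1, by push_cast; linear_combination hw⟩
      rcases key with ⟨t, ht, hd⟩ | ⟨t, ht, hd⟩
      · rcases par2 _ hd with h4 | h4
        · exact ⟨2 * q + 1 + t, by simp; omega, by rw [LP1 t ht]; exact h4⟩
        · exact ⟨2 * q + 2 * r - t, by simp; omega, by rw [LP2 t ht]; exact h4⟩
      · rcases par2 _ hd with h4 | h4
        · exact ⟨t, by simp; omega, by rw [LC1 t ht]; exact h4⟩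
        · exact ⟨q + t, by simp; omega, by rw [LC2 t ht]; exact h4⟩
  -- pairs of labels on edges
  let Pr : ℤ → ℤ → Prop := fun A B => ∃ i < 2 * q + (2 * r + 1), i ≠ 2 * q ∧ nxt (2 * q) (2 * r + 1) i ≠ 2 * q ∧
    ((((2 * h : ℕ) : ℤ) ∣ L i - A ∧ ((2 * h : ℕ) : ℤ) ∣ L (nxt (2 * q) (2 * r + 1) i) - B) ∨
     (((2 * h : ℕ) : ℤ) ∣ L i - B ∧ ((2 * h : ℕ) : ℤ) ∣ L (nxt (2 * q) (2 * r + 1) i) - A))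
  have prP : ∀ t < tot P, Pr (sq 1 P b t) (sq 1 P b (t + 1)) ∧ Pr (sq 1 P b t + h) (sq 1 P b (t + 1) + h) := by
    intro t ht
    constructor
    · have hn : nxt (2 * q) (2 * r + 1) (2 * q + 1 + t) = 2 * q + 1 + (t + 1) := by
        unfold nxt; split_ifs <;> omega
      refine ⟨2 * q + 1 + t, by omega, by omega, by omega, Or.inl ?_⟩
      rw [hn, LP1 t (by omega), LP1 (t + 1) (by omega)]; simp
    · have hn : nxt (2 * q) (2 * r + 1) (2 * q + 2 * r - (t + 1)) = 2 * q + 2 * r - t := by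
        unfold nxt; split_ifs <;> omega
      refine ⟨2 * q + 2 * r - (t + 1), by omega, by omega, by omega, Or.inr ?_⟩
      rw [hn, LP2 t (by omega), LP2 (t + 1) (by omega)]; simp
  have prC : ∀ t < tot C, Pr (sq 1 C c t) (sq 1 C c (t + 1)) ∧ Pr (sq 1 C c t + h) (sq 1 C c (t + 1) + h) := by
    intro t ht
    by_cases hl : t + 1 = q
    · have e1 : sq 1 C c (t + 1) = sq 1 C c 0 + h + 2 * h * wc := by
        rw [hl, ← tC, sq_tot, sq_zero _ _ _ hC, ← hc]
      constructor
      · have hn : nxt (2 * q) (2 * r + 1) t = q + 0 := by unfold nxt; split_ifs <;> omega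
        refine ⟨t, by omega, by omega, by omega, Or.inl ?_⟩
        rw [hn, LC1 t (by omega), LC2 0 (by omega), e1]
        exact ⟨by simp, -wc, by push_cast; ring⟩
      · have hn : nxt (2 * q) (2 * r + 1) (q + t) = 0 := by unfold nxt; split_ifs <;> omega
        refine ⟨q + t, by omega, by omega, by omega, Or.inl ?_⟩
        rw [hn, LC2 t (by omega), LC1 0 (by omega), e1]
        exact ⟨by simp, -wc - 1, by push_cast; ring⟩
    · constructor
      · have hn : nxt (2 * q) (2 * r + 1) t = t + 1 := by unfold nxt; split_ifs <;> omega
        refine ⟨t, by omega, by omega, by omega, Or.inl ?_⟩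
        rw [hn, LC1 t (by omega), LC1 (t + 1) (by omega)]; simp
      · have hn : nxt (2 * q) (2 * r + 1) (q + t) = q + (t + 1) := by unfold nxt; split_ifs <;> omega
        refine ⟨q + t, by omega, by omega, by omega, Or.inl ?_⟩
        rw [hn, LC2 t (by omega), LC2 (t + 1) (by omega)]; simp
  have prh : Pr b (b + h) ∧ Pr (b + h) (b + h + h) := by
    have hn : nxt (2 * q) (2 * r + 1) (2 * q + 1 + (r - 1)) = 2 * q + 2 * r - (r - 1) := by
      unfold nxt; split_ifs <;> omega
    have e1 : sq 1 P b (r - 1) = b := by rw [show r - 1 = tot P by omega, sq_tot]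
    constructor
    · refine ⟨2 * q + 1 + (r - 1), by omega, by omega, by omega, Or.inl ?_⟩
      rw [hn, LP1 _ (by omega), LP2 _ (by omega), e1]; simp
    · refine ⟨2 * q + 1 + (r - 1), by omega, by omega, by omega, Or.inr ?_⟩
      rw [hn, LP1 _ (by omega), LP2 _ (by omega), e1]
      exact ⟨⟨-1, by push_cast; ring⟩, by simp⟩
  let u : ZMod h → ℕ → Option (ZMod (2 * h)) := fun j i =>
    if i = 2 * q then none else some ((L i + (j.val : ℤ) : ℤ) : ZMod (2 * h))
  have shift : ∀ A X : ℤ, ∃ j : ZMod h, ∃ w : ℤ, A + (j.val : ℤ) = X + h * w := by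
    intro A X
    refine ⟨((X - A : ℤ) : ZMod h), -((X - A) / h), ?_⟩
    rw [ZMod.val_intCast]
    linear_combination Int.emod_add_mul_ediv (X - A) h
  have casteq : ∀ X Y : ℤ, ((2 * h : ℕ) : ℤ) ∣ X - Y → ((X : ℤ) : ZMod (2 * h)) = (Y : ℤ) := by
    intro X Y hd
    rw [eq_comm, ZMod.intCast_eq_intCast_iff_dvd_sub]; exact hd
  -- a pair of labels and its translate cover all pairs with the same difference
  have main : ∀ X Y A B : ℤ, ((2 * h : ℕ) : ℤ) ∣ (B - A) - (Y - X) → Pr A B → Pr (A + h) (B + h) →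
      ∃ j, ∃ i < 2 * q + (2 * r + 1),
        (u j i = some (X : ZMod (2 * h)) ∧ u j (nxt (2 * q) (2 * r + 1) i) = some (Y : ZMod (2 * h))) ∨
        (u j i = some (Y : ZMod (2 * h)) ∧ u j (nxt (2 * q) (2 * r + 1) i) = some (X : ZMod (2 * h))) := by
    have fin : ∀ X Y A B : ℤ, ((2 * h : ℕ) : ℤ) ∣ (B - A) - (Y - X) → Pr A B → ∀ j : ZMod h,
        ((2 * h : ℕ) : ℤ) ∣ A + (j.val : ℤ) - X → ∃ i < 2 * q + (2 * r + 1),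
        (u j i = some (X : ZMod (2 * h)) ∧ u j (nxt (2 * q) (2 * r + 1) i) = some (Y : ZMod (2 * h))) ∨
        (u j i = some (Y : ZMod (2 * h)) ∧ u j (nxt (2 * q) (2 * r + 1) i) = some (X : ZMod (2 * h))) := by
      intro X Y A B hd ⟨i, hi, z1, z2, hp⟩ j hj
      have hB : ((2 * h : ℕ) : ℤ) ∣ B + (j.val : ℤ) - Y := by
        have := dvd_add hd hj
        rwa [show B - A - (Y - X) + (A + (j.val : ℤ) - X) = B + (j.val : ℤ) - Y by ring] at this
      have tr : ∀ Z W T : ℤ, ((2 * h : ℕ) : ℤ) ∣ Z - W → ((2 * h : ℕ) : ℤ) ∣ W + (j.val : ℤ) - T →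
          ((2 * h : ℕ) : ℤ) ∣ Z + (j.val : ℤ) - T := by
        intro Z W T h1 h2
        have := dvd_add h1 h2
        rwa [show Z - W + (W + (j.val : ℤ) - T) = Z + (j.val : ℤ) - T by ring] at this
      refine ⟨i, hi, ?_⟩
      simp only [u]
      rw [if_neg z1, if_neg z2]
      rcases hp with ⟨h1, h2⟩ | ⟨h1, h2⟩
      · left; rw [casteq _ _ (tr _ _ _ h1 hj), casteq _ _ (tr _ _ _ h2 hB)]; exact ⟨rfl, rfl⟩
      · right; rw [casteq _ _ (tr _ _ _ h1 hB), casteq _ _ (tr _ _ _ h2 hj)]; exact ⟨rfl, rfl⟩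
    intro X Y A B hd h1 h2
    obtain ⟨j, w, hw⟩ := shift A X
    refine ⟨j, ?_⟩
    rcases Int.even_or_odd' w with ⟨v, rfl | rfl⟩
    · exact fin X Y A B hd h1 j ⟨v, by push_cast; linear_combination hw⟩
    · refine fin X Y (A + h) (B + h) ?_ h2 j ⟨v + 1, by push_cast; linear_combination hw⟩
      rwa [show B + (h : ℤ) - (A + h) - (Y - X) = B - A - (Y - X) by ring]
  have small : ∀ X Y : ℤ, 1 ≤ Y - X → Y - X ≤ h → ∃ j, ∃ i < 2 * q + (2 * r + 1),
        (u j i = some (X : ZMod (2 * h)) ∧ u j (nxt (2 * q) (2 * r + 1) i) = some (Y : ZMod (2 * h))) ∨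
        (u j i = some (Y : ZMod (2 * h)) ∧ u j (nxt (2 * q) (2 * r + 1) i) = some (X : ZMod (2 * h))) := by
    intro X Y h1 h2
    rcases eq_or_lt_of_le h2 with h3 | h3
    · exact main X Y b (b + h) ⟨0, by linear_combination -h3⟩ prh.1 prh.2
    · have key : ∃ A B, Df (2 * h) (Y - X) A B ∧ (Pr A B ∧ Pr (A + h) (B + h)) := by
        have sym : ∀ A B, Pr A B → Pr B A := by
          rintro A B ⟨i, h1, h2, h3, h4⟩
          exact ⟨i, h1, h2, h3, h4.symm⟩
        rcases hcov _ h1 h3 with h4 | h4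
        · obtain ⟨t, ht, hd | hd⟩ := dhit_sound 1 _ _ one_pos _ _ hP h4
          · exact ⟨_, _, hd, prP t ht⟩
          · exact ⟨_, _, hd, sym _ _ (prP t ht).1, sym _ _ (prP t ht).2⟩
        · obtain ⟨t, ht, hd | hd⟩ := dhit_sound 1 _ _ one_pos _ _ hC h4
          · exact ⟨_, _, hd, prC t ht⟩
          · exact ⟨_, _, hd, sym _ _ (prC t ht).1, sym _ _ (prC t ht).2⟩
      obtain ⟨A, B, ⟨w, hw⟩, k1, k2⟩ := key
      exact main X Y A B ⟨w, by push_cast; linear_combination hw⟩ k1 k2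
  have inf : ∀ X : ℤ, ∃ j, ∃ i < 2 * q + (2 * r + 1),
        (u j i = none ∧ u j (nxt (2 * q) (2 * r + 1) i) = some (X : ZMod (2 * h))) ∨
        (u j i = some (X : ZMod (2 * h)) ∧ u j (nxt (2 * q) (2 * r + 1) i) = none) := by
    intro X
    obtain ⟨j, w, hw⟩ := shift (sq 1 P b 0) X
    refine ⟨j, ?_⟩
    rcases Int.even_or_odd' w with ⟨v, rfl | rfl⟩
    · have hn : nxt (2 * q) (2 * r + 1) (2 * q) = 2 * q + 1 + 0 := by unfold nxt; split_ifs <;> omega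
      refine ⟨2 * q, by omega, Or.inl ?_⟩
      simp only [u]
      rw [hn, if_pos trivial, if_neg (by omega), LP1 0 (by omega)]
      exact ⟨rfl, congrArg some (casteq _ _ ⟨v, by push_cast; linear_combination hw⟩)⟩
    · have hn : nxt (2 * q) (2 * r + 1) (2 * q + 2 * r - 0) = 2 * q := by unfold nxt; split_ifs <;> omega
      refine ⟨2 * q + 2 * r - 0, by omega, Or.inr ?_⟩
      simp only [u]
      rw [hn, if_neg (by omega), if_pos rfl, LP2 0 (by omega)]
      exact ⟨congrArg some (casteq _ _ ⟨v + 1, by push_cast; linear_combination hw⟩), rfl⟩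
  refine cov_col u ?_ (fun i => if i = 2 * q then 2 else if i % 2 = 0 then 0 else 1) ?_ ?_
  · intro j i hi i' hi' he
    simp only [u] at he
    split_ifs at he with h1 h2 h2
    · omega
    · have h3 := Option.some.inj he
      rw [eq_comm, ZMod.intCast_eq_intCast_iff_dvd_sub] at h3
      exact hinj i (by simp; omega) i' (by simp; omega) (by
        rwa [show L i + (j.val : ℤ) - (L i' + (j.val : ℤ)) = L i - L i' by ring] at h3)
  · intro i hi
    simp only [nxt]
    split_ifs <;> first | omega | decide
  · intro x y hxy
    rcases x with _ | x <;> rcases y with _ | y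
    · exact absurd rfl hxy
    · obtain ⟨Y, rfl⟩ := ZMod.intCast_surjective y
      exact inf Y
    · obtain ⟨X, rfl⟩ := ZMod.intCast_surjective x
      obtain ⟨j, i, hi, h1⟩ := inf X
      exact ⟨j, i, hi, h1.symm⟩
    · obtain ⟨X, rfl⟩ := ZMod.intCast_surjective x
      obtain ⟨Y, rfl⟩ := ZMod.intCast_surjective y
      have h1 := Int.emod_nonneg (Y - X) (show (2 * h : ℤ) ≠ 0 by omega)
      have h2 := Int.emod_lt_of_pos (Y - X) (show (0 : ℤ) < 2 * h by omega)
      have h3 := Int.emod_add_mul_ediv (Y - X) (2 * h)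
      set D := (Y - X) % (2 * h) with hD
      have h4 : D ≠ 0 := by
        intro h0
        apply hxy
        congr 1
        rw [ZMod.intCast_eq_intCast_iff_dvd_sub]
        push_cast
        exact Int.dvd_of_emod_eq_zero (hD ▸ h0)
      by_cases h5 : D ≤ h
      · rw [casteq Y (X + D) ⟨(Y - X) / (2 * h), by push_cast; linear_combination -h3⟩]
        exact small X (X + D) (by omega) (by omega)
      · rw [casteq X (Y + (2 * h - D)) ⟨-((Y - X) / (2 * h)) - 1, by push_cast; linear_combination h3⟩]
        obtain ⟨j, i, hi, h6⟩ := small Y (Y + (2 * h - D)) (by omega) (by omega)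
        exact ⟨j, i, hi, h6.symm⟩

end T1c

theorem sym0_1 (k : ℕ) : Cov (Option (ZMod (2 * (8 * k + 10)))) ((Fin 2 × Fin 2) × ZMod (8 * k + 10))
    (2 * (4 * k + 5)) (2 * (4 * k + 5) + 1) := by
  refine cov_sym (by omega) (by omega) (by omega)
    [⟨0, 1, 1, 2 * k + 2, 0, 1, 1, 0, 0, 0⟩,
    ⟨-k - 1, -2 * k - 3, 1, 1, 0, 0, -1, 0, 0, 0⟩,
    ⟨-3 * k - 4, 6 * k + 9, 1, 2 * k + 1, 0, 1, 1, 0, 0, 0⟩]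
    [⟨k + 2, -6 * k - 8, -1, 1, 1, 0, -1, 0, 0, 0⟩,
    ⟨-5 * k - 6, -6 * k - 7, 1, 4 * k + 4, 0, -1, -1, 0, 0, 0⟩]
    (4 * k + 5) (-7 * k - 8) (-8 * k - 9) (1) (-1) ?_ ?_ ?_ ?_ ?_ ?_ ?_ <;>
  simp only [chain, hd, tot, phit, dhit, dh, and_true, true_and, or_false] <;> try and_intros
  all_goals (intros; omega)

theorem sym0_2 (k : ℕ) : Cov (Option (ZMod (2 * (8 * k + 12)))) ((Fin 2 × Fin 2) × ZMod (8 * k + 12))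
    (2 * (4 * k + 6)) (2 * (4 * k + 6) + 1) := by
  refine cov_sym (by omega) (by omega) (by omega)
    [⟨0, 4 * k + 8, 1, 4 * k + 3, 0, 1, 1, 0, 0, 0⟩,
    ⟨6 * k + 9, 4 * k + 7, -1, 2, 1, 2, 1, 0, 0, 0⟩]
    [⟨1, 2 * k + 4, -1, 1, 1, 0, 1, 0, 0, 0⟩,
    ⟨2 * k + 5, -2, -1, 2 * k + 2, 1, 1, -1, 0, 0, 0⟩,
    ⟨3 * k + 6, 1, -1, 1, 1, 0, 1, 0, 0, 0⟩,
    ⟨3 * k + 7, -2 * k - 5, -1, 2 * k + 1, 1, 1, -1, 0, 0, 0⟩,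
    ⟨2, 8 * k + 11, -1, 1, 1, 0, 1, 0, 0, 0⟩]
    (6 * k + 10) (8 * k + 13) (-8 * k - 11) (1) (0) ?_ ?_ ?_ ?_ ?_ ?_ ?_ <;>
  simp only [chain, hd, tot, phit, dhit, dh, and_true, true_and, or_false] <;> try and_intros
  all_goals (intros; omega)

theorem sym0_3 (k : ℕ) : Cov (Option (ZMod (2 * (8 * k + 6)))) ((Fin 2 × Fin 2) × ZMod (8 * k + 6))
    (2 * (4 * k + 3)) (2 * (4 * k + 3) + 1) := by
  refine cov_sym (by omega) (by omega) (by omega)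
    [⟨0, 1, 1, 2 * k + 1, 0, 1, 1, 0, 0, 0⟩,
    ⟨k + 1, 2 * k + 2, -1, 1, 1, 0, 1, 0, 0, 0⟩,
    ⟨3 * k + 3, -6 * k - 6, -1, 2 * k, 1, 0, -1, 0, 0, 0⟩]
    [⟨7 * k + 5, 6 * k + 5, 1, 1, 1, 0, 1, 0, 0, 0⟩,
    ⟨13 * k + 10, 6 * k + 4, -1, 4 * k + 2, 2, 3, 1, 0, 0, 0⟩]
    (4 * k + 3) (15 * k + 11) (-8 * k - 5) (1) (0) ?_ ?_ ?_ ?_ ?_ ?_ ?_ <;>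
  simp only [chain, hd, tot, phit, dhit, dh, and_true, true_and, or_false] <;> try and_intros
  all_goals (intros; omega)

theorem sym0_0 (k : ℕ) : Cov (Option (ZMod (2 * (8 * k + 8)))) ((Fin 2 × Fin 2) × ZMod (8 * k + 8))
    (2 * (4 * k + 4)) (2 * (4 * k + 4) + 1) := by
  refine cov_sym (by omega) (by omega) (by omega)
    [⟨0, 8 * k + 6, -1, 2 * k, 1, 1, 1, 0, 0, 0⟩,
    ⟨k, -8 * k - 7, -1, 1, 1, 0, -1, 0, 0, 0⟩,
    ⟨-7 * k - 7, 6 * k + 5, -1, 2 * k + 2, 0, 0, 1, 0, 0, 0⟩]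
    [⟨6 * k + 5, -6 * k - 6, 1, 1, 1, 0, -1, 0, 0, 0⟩,
    ⟨-1, -4 * k - 3, -1, 1, 0, 0, -1, 0, 0, 0⟩,
    ⟨-4 * k - 4, -1, -1, 4 * k + 2, 0, 0, -1, 0, 0, 0⟩]
    (-6 * k - 6) (-2 * k - 3) (-8 * k - 8) (0) (-1) ?_ ?_ ?_ ?_ ?_ ?_ ?_ <;>
  simp only [chain, hd, tot, phit, dhit, dh, and_true, true_and, or_false] <;> try and_intros
  all_goals (intros; omega)

theorem sym1_1 (k : ℕ) : Cov (Option (ZMod (2 * (8 * k + 11)))) ((Fin 2 × Fin 2) × ZMod (8 * k + 11))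
    (2 * (4 * k + 6)) (2 * (4 * k + 5) + 1) := by
  refine cov_sym (by omega) (by omega) (by omega)
    [⟨0, 2, 1, 4 * k + 4, 0, 1, 1, 0, 0, 0⟩]
    [⟨2 * k + 4, -4 * k - 7, -1, 2 * k + 1, 1, 0, -1, 0, 0, 0⟩,
    ⟨-3 * k - 3, -1, 1, 1, 0, 0, -1, 0, 0, 0⟩,
    ⟨-3 * k - 4, 6 * k + 9, 1, 2 * k + 2, 0, 1, 1, 0, 0, 0⟩,
    ⟨-4 * k - 5, 4 * k + 6, -1, 1, 0, 0, 1, 0, 0, 0⟩,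
    ⟨1, -6 * k - 8, -1, 1, 1, 0, -1, 0, 0, 0⟩]
    (-2 * k - 2) (-6 * k - 7) (-8 * k - 10) (0) (-1) ?_ ?_ ?_ ?_ ?_ ?_ ?_ <;>
  simp only [chain, hd, tot, phit, dhit, dh, and_true, true_and, or_false] <;> try and_intros
  all_goals (intros; omega)

theorem sym1_2 (k : ℕ) : Cov (Option (ZMod (2 * (8 * k + 13)))) ((Fin 2 × Fin 2) × ZMod (8 * k + 13))
    (2 * (4 * k + 7)) (2 * (4 * k + 6) + 1) := by
  refine cov_sym (by omega) (by omega) (by omega)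
    [⟨0, 4 * k + 7, 1, 4 * k + 5, 0, 1, 1, 0, 0, 0⟩]
    [⟨3 * k + 5, -8 * k - 12, -1, 1, 1, 0, -1, 0, 0, 0⟩,
    ⟨-5 * k - 7, -2 * k - 5, -1, 2 * k + 1, 0, 0, -1, 0, 0, 0⟩,
    ⟨-8 * k - 12, -2 * k - 4, -1, 1, 0, 0, -1, 0, 0, 0⟩,
    ⟨-10 * k - 16, 4 * k + 6, 1, 1, -1, 0, 1, 0, 0, 0⟩,
    ⟨-6 * k - 10, 1, 1, 2 * k + 3, 0, 0, 1, 0, 0, 0⟩]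
    (6 * k + 9) (-5 * k - 8) (-8 * k - 12) (1) (-1) ?_ ?_ ?_ ?_ ?_ ?_ ?_ <;>
  simp only [chain, hd, tot, phit, dhit, dh, and_true, true_and, or_false] <;> try and_intros
  all_goals (intros; omega)

theorem sym1_3 (k : ℕ) : Cov (Option (ZMod (2 * (8 * k + 7)))) ((Fin 2 × Fin 2) × ZMod (8 * k + 7))
    (2 * (4 * k + 4)) (2 * (4 * k + 3) + 1) := by
  refine cov_sym (by omega) (by omega) (by omega)
    [⟨0, 4 * k + 4, 1, 2 * k + 1, 0, 1, 1, 0, 0, 0⟩,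
    ⟨5 * k + 4, -8 * k - 6, 1, 1, 1, 0, -1, 0, 0, 0⟩,
    ⟨-3 * k - 2, -6 * k - 6, -1, 2 * k, 0, -1, -1, 0, 0, 0⟩]
    [⟨6 * k + 6, 4 * k + 3, 1, 1, 1, 0, 1, 0, 0, 0⟩,
    ⟨10 * k + 9, 1, 1, 4 * k + 2, 2, 2, 1, 0, 0, 0⟩,
    ⟨8 * k + 8, 6 * k + 5, 1, 1, 2, 0, 1, 0, 0, 0⟩]
    (-2 * k - 2) (14 * k + 13) (-8 * k - 6) (0) (0) ?_ ?_ ?_ ?_ ?_ ?_ ?_ <;>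
  simp only [chain, hd, tot, phit, dhit, dh, and_true, true_and, or_false] <;> try and_intros
  all_goals (intros; omega)

theorem sym1_0 (k : ℕ) : Cov (Option (ZMod (2 * (8 * k + 9)))) ((Fin 2 × Fin 2) × ZMod (8 * k + 9))
    (2 * (4 * k + 5)) (2 * (4 * k + 4) + 1) := by
  refine cov_sym (by omega) (by omega) (by omega)
    [⟨0, 4 * k + 4, -1, 4 * k + 3, 1, 1, 1, 0, 0, 0⟩]
    [⟨2 * k + 2, -4 * k - 5, -1, 1, 1, 0, -1, 0, 0, 0⟩,
    ⟨-2 * k - 3, 8 * k + 8, -1, 2 * k + 2, 0, 1, 1, 0, 0, 0⟩,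
    ⟨-k - 2, 1, 1, 1, 0, 0, 1, 0, 0, 0⟩,
    ⟨-k - 1, 6 * k + 5, -1, 2 * k, 0, 1, 1, 0, 0, 0⟩,
    ⟨-1, -6 * k - 6, 1, 1, 0, 0, -1, 0, 0, 0⟩]
    (2 * k + 3) (-6 * k - 7) (-8 * k - 9) (1) (-1) ?_ ?_ ?_ ?_ ?_ ?_ ?_ <;>
  simp only [chain, hd, tot, phit, dhit, dh, and_true, true_and, or_false] <;> try and_intros
  all_goals (intros; omega)

theorem sym1_1' : Cov (Option (ZMod (2 * 3))) ((Fin 2 × Fin 2) × ZMod 3) (2 * 2) (2 * 1 + 1) := by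
  refine cov_sym (by omega) (by omega) (by omega) [] [⟨1, 1, 1, 1, 0, 0, 1, 0, 0, 0⟩, ⟨2, 2, 1, 1, 0, 0, 1, 0, 0, 0⟩]
    0 4 0 0 0 ?_ ?_ ?_ ?_ ?_ ?_ ?_ <;>
  simp only [chain, hd, tot, phit, dhit, dh, and_true, true_and, or_false] <;> try and_intros
  all_goals (intros; omega)



section Assembly

/-- the case `n = m` with cycles of lengths `e` and `o` is solvable -/
def Base (e o : ℕ) : Prop :=
  ∃ (K : Type) (_ : Fintype K), Fintype.card K = 2 * (e + o - 1) ∧ Cov (ZMod (e + o)) K e o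

theorem Base.of {e o e' o' N : ℕ} {K : Type} [Fintype K] (h : Cov (Option (ZMod N)) K e' o') (he : e' = e)
    (ho : o' = o) (hN : 0 < N) (hN' : N + 1 = e + o) (hK : Fintype.card K = 2 * N) : Base e o := by
  subst he; subst ho
  haveI : NeZero N := ⟨by omega⟩
  haveI : NeZero (e' + o') := ⟨by omega⟩
  have hc : Fintype.card (Option (ZMod N)) = Fintype.card (ZMod (e' + o')) := by
    rw [Fintype.card_option, ZMod.card, ZMod.card, hN']
  exact ⟨K, inferInstance, by rw [hK]; omega, h.transport (Fintype.equivOfCardEq hc) (Equiv.refl K)⟩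

theorem Base.ofA {e o e' o' N : ℕ} (h : Cov (Option (ZMod N)) (Fin 2 × ZMod N) e' o') (he : e' = e)
    (ho : o' = o) (hN : 0 < N) (hN' : N + 1 = e + o) : Base e o := by
  haveI : NeZero N := ⟨by omega⟩
  exact Base.of h he ho hN hN' (by rw [Fintype.card_prod, ZMod.card, Fintype.card_fin])

theorem Base.ofB {e o e' o' N : ℕ} (h : Cov (Option (ZMod (2 * N))) (Fin 2 × Fin 2 × ZMod N) e' o')
    (he : e' = e) (ho : o' = o) (hN : 0 < N) (hN' : 2 * N + 1 = e + o) : Base e o := by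
  haveI : NeZero N := ⟨by omega⟩
  exact Base.of h he ho (by omega) hN' (by simp only [Fintype.card_prod, ZMod.card, Fintype.card_fin])

theorem Base.ofC {e o e' o' N : ℕ} (h : Cov (Option (ZMod (2 * N))) ((Fin 2 × Fin 2) × ZMod N) e' o')
    (he : e' = e) (ho : o' = o) (hN : 0 < N) (hN' : 2 * N + 1 = e + o) : Base e o := by
  haveI : NeZero N := ⟨by omega⟩
  exact Base.of h he ho (by omega) hN' (by simp only [Fintype.card_prod, ZMod.card, Fintype.card_fin]; omega)

theorem base_two (r : ℕ) (hr : 1 ≤ r) : Base 2 (2 * r + 1) := by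
  by_cases h1 : r = 1
  · subst h1; exact Base.ofA e2_o3 rfl rfl (by omega) (by omega)
  rcases (by omega : r % 2 = 1 ∨ r % 4 = 2 ∨ r % 4 = 0) with h | h | h
  · exact Base.ofA (e2_even ((r - 3) / 2)) rfl (by omega) (by omega) (by omega)
  · exact Base.ofB (e2_odda ((r - 2) / 4)) rfl (by omega) (by omega) (by omega)
  · exact Base.ofB (e2_oddb ((r - 4) / 4)) rfl (by omega) (by omega) (by omega)

theorem base_four (r : ℕ) (hr : 1 ≤ r) : Base 4 (2 * r + 1) := by
  by_cases h1 : r = 1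
  · subst h1; exact Base.ofC sym1_1' rfl rfl (by omega) (by omega)
  by_cases h2 : r = 2
  · subst h2; exact Base.ofA e4_o5 rfl rfl (by omega) (by omega)
  rcases (by omega : r % 2 = 1 ∨ r % 2 = 0) with h | h
  · exact Base.ofA (gen_q1a ((r - 3) / 2)) rfl (by omega) (by omega) (by omega)
  · exact Base.ofA (gen_q1b ((r - 4) / 2)) rfl (by omega) (by omega) (by omega)

theorem base_three (f : ℕ) (hf : 3 ≤ f) : Base (2 * f) 3 := by
  rcases (by omega : f % 2 = 0 ∨ f % 6 = 3 ∨ f % 6 = 5 ∨ f % 6 = 1) with h | h | h | h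
  · exact Base.ofA (gen_r1 ((f - 4) / 2)) (by omega) rfl (by omega) (by omega)
  · exact Base.ofA (o3c ((f - 3) / 6)) (by omega) rfl (by omega) (by omega)
  · exact Base.ofA (o3a ((f - 5) / 6)) (by omega) rfl (by omega) (by omega)
  · exact Base.ofA (o3b ((f - 7) / 6)) (by omega) rfl (by omega) (by omega)

theorem base_sym0 (r : ℕ) (hr : 3 ≤ r) : Base (2 * r) (2 * r + 1) := by
  rcases (by omega : r % 4 = 0 ∨ r % 4 = 1 ∨ r % 4 = 2 ∨ r % 4 = 3) with h | h | h | h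
  · exact Base.ofC (sym0_0 ((r - 4) / 4)) (by omega) (by omega) (by omega) (by omega)
  · exact Base.ofC (sym0_1 ((r - 5) / 4)) (by omega) (by omega) (by omega) (by omega)
  · exact Base.ofC (sym0_2 ((r - 6) / 4)) (by omega) (by omega) (by omega) (by omega)
  · exact Base.ofC (sym0_3 ((r - 3) / 4)) (by omega) (by omega) (by omega) (by omega)

theorem base_sym1 (r : ℕ) (hr : 2 ≤ r) : Base (2 * r + 2) (2 * r + 1) := by
  by_cases h2 : r = 2
  · subst h2; exact Base.ofA e6_o5 rfl rfl (by omega) (by omega)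
  rcases (by omega : r % 4 = 0 ∨ r % 4 = 1 ∨ r % 4 = 2 ∨ r % 4 = 3) with h | h | h | h
  · exact Base.ofC (sym1_0 ((r - 4) / 4)) (by omega) (by omega) (by omega) (by omega)
  · exact Base.ofC (sym1_1 ((r - 5) / 4)) (by omega) (by omega) (by omega) (by omega)
  · exact Base.ofC (sym1_2 ((r - 6) / 4)) (by omega) (by omega) (by omega) (by omega)
  · exact Base.ofC (sym1_3 ((r - 3) / 4)) (by omega) (by omega) (by omega) (by omega)

/-- the even cycle is shorter -/
theorem base_rq (q r : ℕ) (hq : 2 ≤ q) (h : q + 2 ≤ r) : Base (2 * q + 2) (2 * r + 1) := by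
  rcases Nat.mod_two_eq_zero_or_one q with h1 | h1 <;> rcases Nat.mod_two_eq_zero_or_one r with h2 | h2
  · exact Base.ofA (gen_rq00 ((q - 2) / 2) ((r - q - 2) / 2)) (by omega) (by omega) (by omega) (by omega)
  · exact Base.ofA (gen_rq01 ((q - 2) / 2) ((r - q - 2) / 2)) (by omega) (by omega) (by omega) (by omega)
  · exact Base.ofA (gen_rq10 ((q - 2) / 2) ((r - q - 2) / 2)) (by omega) (by omega) (by omega) (by omega)
  · exact Base.ofA (gen_rq11 ((q - 2) / 2) ((r - q - 2) / 2)) (by omega) (by omega) (by omega) (by omega)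

/-- the even cycle is longer -/
theorem base_qr (q r : ℕ) (hr : 2 ≤ r) (h : r + 1 ≤ q) : Base (2 * q + 2) (2 * r + 1) := by
  rcases Nat.mod_two_eq_zero_or_one q with h1 | h1 <;> rcases Nat.mod_two_eq_zero_or_one r with h2 | h2
  · exact Base.ofA (gen_qr00 ((r - 2) / 2) ((q - r - 1) / 2)) (by omega) (by omega) (by omega) (by omega)
  · exact Base.ofA (gen_qr01 ((r - 2) / 2) ((q - r - 1) / 2)) (by omega) (by omega) (by omega) (by omega)
  · exact Base.ofA (gen_qr10 ((r - 2) / 2) ((q - r - 1) / 2)) (by omega) (by omega) (by omega) (by omega)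
  · exact Base.ofA (gen_qr11 ((r - 2) / 2) ((q - r - 1) / 2)) (by omega) (by omega) (by omega) (by omega)

theorem base_all (f r : ℕ) (hf : 1 ≤ f) (hr : 1 ≤ r) : Base (2 * f) (2 * r + 1) := by
  rcases (by omega : f = 1 ∨ f = 2 ∨ 3 ≤ f) with rfl | rfl | h3
  · exact base_two r hr
  · exact base_four r hr
  rcases (by omega : r = 1 ∨ 2 ≤ r) with rfl | h2
  · exact base_three f h3
  rcases (by omega : f = r ∨ f = r + 1 ∨ f + 1 ≤ r ∨ r + 2 ≤ f) with rfl | rfl | h | h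
  · exact base_sym0 f h3
  · exact base_sym1 r h2
  · have := base_rq (f - 1) r (by omega) (by omega)
    rwa [show 2 * (f - 1) + 2 = 2 * f by omega] at this
  · have := base_qr (f - 1) r h2 (by omega)
    rwa [show 2 * (f - 1) + 2 = 2 * f by omega] at this

/-- the covering family for `n = (2k + 1) m` -/
theorem cov_all (f r k : ℕ) (hf : 1 ≤ f) (hr : 1 ≤ r) :
    ∃ (V K : Type) (_ : Fintype V) (_ : Fintype K), Fintype.card V = (2 * f + (2 * r + 1)) * (2 * k + 1) ∧
      Fintype.card K * (2 * f + (2 * r + 1)) = 2 * ((2 * f + (2 * r + 1)) * (2 * k + 1)) *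
        ((2 * f + (2 * r + 1)) * (2 * k + 1) - 1) ∧ Cov V K (2 * f) (2 * r + 1) := by
  obtain ⟨T⟩ := tmpl_all f r hf hr
  obtain ⟨K, _, hK, hc⟩ := base_all f r hf hr
  refine ⟨_, _, inferInstance, inferInstance, ?_, ?_, cov_T2 (k := k) T (by omega) (by omega) hc⟩
  · rw [Fintype.card_prod, ZMod.card, ZMod.card]
  · simp only [Fintype.card_sum, Fintype.card_prod, ZMod.card, Fintype.card_fin, hK]
    obtain ⟨c, hc⟩ : ∃ c, 2 * f + (2 * r + 1) = c + 1 := ⟨2 * f + 2 * r, by omega⟩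
    rw [hc, Nat.add_sub_cancel, show (c + 1) * (2 * k + 1) = (c + 1) * (2 * k) + c + 1 by ring, Nat.add_sub_cancel]
    ring

theorem final (s a b : ℕ) (ha : 2 ≤ a) (hb : 2 ≤ b) (hodd : Odd (a + b))
    (hcong : s + (a + b) ≡ a + b [MOD 2 * (a + b)]) : HOPSolution (s + (a + b)) s 2 ![a, b] := by
  obtain ⟨k, hk⟩ : ∃ k, s = 2 * (a + b) * k := by
    have h1 : s ≡ 0 [MOD 2 * (a + b)] := by
      apply Nat.ModEq.add_right_cancel' (a + b)
      rwa [Nat.zero_add]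
    exact (Nat.modEq_zero_iff_dvd.1 h1)
  have go : ∀ e o, e % 2 = 0 → 2 ≤ e → 2 ≤ o → e + o = a + b → ∃ (V K : Type) (_ : Fintype V) (_ : Fintype K),
      Fintype.card V = s + (a + b) ∧ Fintype.card K * (a + b) = 2 * (s + (a + b)) * (s + (a + b) - 1) ∧
      Cov V K e o := by
    intro e o he h2 h3 hs
    have ho : o % 2 = 1 := by
      obtain ⟨w, hw⟩ := hodd; omega
    obtain ⟨f, rfl⟩ : ∃ f, e = 2 * f := ⟨e / 2, by omega⟩
    obtain ⟨r, rfl⟩ : ∃ r, o = 2 * r + 1 := ⟨o / 2, by omega⟩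
    obtain ⟨V, K, iV, iK, h4, h5, h6⟩ := cov_all f r k (by omega) (by omega)
    have e1 : (2 * f + (2 * r + 1)) * (2 * k + 1) = s + (a + b) := by rw [hs, hk]; ring
    rw [e1] at h4 h5
    rw [hs] at h5
    exact ⟨V, K, iV, iK, h4, h5, h6⟩
  rcases Nat.mod_two_eq_zero_or_one a with h | h
  · obtain ⟨V, K, _, _, h4, h5, h6⟩ := go a b h ha hb rfl
    exact sol_of_cov h6 ha hb h4 rfl h5
  · have hb' : b % 2 = 0 := by
      obtain ⟨w, hw⟩ := hodd; omega
    obtain ⟨V, K, _, _, h4, h5, h6⟩ := go b a hb' hb ha (by omega)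
    exact sol_of_cov (h6.swap hb ha) ha hb h4 rfl h5

end Assembly

end HOPaux

theorem hop_two_round_tables_mod_m (s m₁ m₂ m n : ℕ)
    (hm₁ : 2 ≤ m₁) (hm₁₂ : m₁ ≤ m₂) (hm : m = m₁ + m₂) (hn : n = s + m)
    (hmodd : Odd m) (hcong : n ≡ m [MOD 2 * m]) :
    HOPSolution n s 2 ![m₁, m₂] := by
  subst hm
  subst hn
  exact HOPaux.final s m₁ m₂ hm₁ (by omega) hmodd hcong
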